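/- Let K be a CM field with maximal totally real subfield K₊. Then the norm-induced homomorphism Nm_{K/K₊} : Cl(𝓞_K) → Cl(𝓞_{K₊}) on ideal class groups is surjective. -/

import Mathlib

set_option synthInstance.maxHeartbeats 400000
open NumberField IntermediateField
open scoped nonZeroDivisors

/-- A subfield of `ℂ` is totally real if every field embedding of it into `ℂ`
has image contained in `ℝ`. -/
def TotallyReal (F : IntermediateField ℚ ℂ) : Prop :=
  ∀ φ : F →+* ℂ, ∀ x : F, (φ x).im = 0

/-- A subfield of `ℂ` is totally imaginary if no field embedding of it into `ℂ`
has image contained in `ℝ`. -/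
def TotallyImaginary (K : IntermediateField ℚ ℂ) : Prop :=
  ∀ φ : K →+* ℂ, ∃ x : K, (φ x).im ≠ 0

instance (F : IntermediateField ℚ ℂ) [FiniteDimensional ℚ F] : NumberField F :=
  NumberField.of_module_finite ℚ F

/-- The relative ideal norm `Nm_{L/F}` for subfields `F ⊆ L` of `ℂ`: the ideal of `𝓞 F`
generated by the field norms `Nm_{L/F}(x)` of the elements `x` of the given ideal of
`𝓞 L`. -/
noncomputable def idealNorm (F L : IntermediateField ℚ ℂ) (h : F ≤ L)
    (I : Ideal (𝓞 L)) : Ideal (𝓞 F) :=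
  letI : Algebra F L := (IntermediateField.inclusion h).toRingHom.toAlgebra
  Ideal.span {y : 𝓞 F | ∃ x ∈ I, (y : F) = Algebra.norm F (x : L)}

namespace CMNorm
open MeasureTheory Complex
open scoped Real BigOperators

section Poisson
variable {ι : Type*} [Fintype ι]

/-- unit box -/
def box (ι : Type*) : Set (ι → ℝ) := {x | ∀ i, x i ∈ Set.Ioc (0:ℝ) ((0:ℝ) + 1)}

/-- integer vector as a real vector -/
def icast (m : ι → ℤ) : ι → ℝ := fun i => (m i : ℝ)

lemma measurableSet_box : MeasurableSet (box ι) := by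
  have : box ι = Set.pi Set.univ (fun _ => Set.Ioc (0:ℝ) (0+1)) := by ext; simp [box]
  rw [this]
  exact MeasurableSet.univ_pi (fun _ => measurableSet_Ioc)

lemma hasSum_box {E : Type*} [NormedAddCommGroup E] [NormedSpace ℝ E]
    (f : (ι → ℝ) → E) (hf : Integrable f) :
    HasSum (fun m : ι → ℤ => ∫ x in box ι, f (x + icast m)) (∫ x, f x) := by
  have key : ∀ m : ι → ℤ, ∫ x in box ι, f (x + icast m)
      = ∫ x in (fun x => x - icast m) ⁻¹' (box ι), f x := by
    intro m
    have := (measurePreserving_sub_right (volume : Measure (ι → ℝ)) (icast m)).setIntegral_preimage_emb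
      (measurableEmbedding_subRight (icast m)) (fun x => f (x + icast m)) (box ι)
    rw [← this]
    simp
  simp_rw [key]
  have hU : (⋃ m : ι → ℤ, (fun x => x - icast m) ⁻¹' (box ι)) = Set.univ := by
    apply Set.eq_univ_of_forall
    intro x
    refine Set.mem_iUnion.2 ⟨fun i => ⌈x i⌉ - 1, ?_⟩
    intro i
    simp only [Pi.sub_apply, icast, Set.mem_Ioc]
    push_cast
    constructor
    · have := Int.ceil_lt_add_one (x i); linarith
    · have := Int.le_ceil (x i); linarith
  have h := hasSum_integral_iUnion (μ := (volume : Measure (ι → ℝ))) (f := f)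
    (s := fun m : ι → ℤ => (fun x => x - icast m) ⁻¹' (box ι)) ?_ ?_ ?_
  · rw [hU, setIntegral_univ] at h
    exact h
  · intro m
    exact measurableSet_box.preimage (measurable_id.sub_const _)
  · intro m n hmn
    rw [Function.onFun, Set.disjoint_left]
    intro x hx hy
    apply hmn
    ext i
    have h1 := hx i
    have h2 := hy i
    simp only [Pi.sub_apply, icast, Set.mem_Ioc] at h1 h2
    have a1 : (m i : ℝ) < n i + 1 := by linarith
    have a2 : (n i : ℝ) < m i + 1 := by linarith
    have a1' : m i < n i + 1 := by exact_mod_cast a1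
    have a2' : n i < m i + 1 := by exact_mod_cast a2
    omega
  · exact hf.integrableOn

/-- the additive character -/
noncomputable def ec (k : ι → ℤ) (x : ι → ℝ) : ℂ := cexp (2 * π * I * ∑ i, (k i : ℂ) * (x i : ℂ))

lemma mFourier_coe (k : ι → ℤ) (x : ι → ℝ) :
    UnitAddTorus.mFourier k (fun i => (x i : UnitAddCircle)) = ec k x := by
  simp only [UnitAddTorus.mFourier, ContinuousMap.coe_mk, ec]
  simp_rw [fourier_coe_apply]
  rw [← Complex.exp_sum, Finset.mul_sum]
  congr 1
  apply Finset.sum_congr rfl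
  intro i _
  simp; ring

lemma ec_add (k : ι → ℤ) (x y : ι → ℝ) : ec k (x + y) = ec k x * ec k y := by
  simp only [ec, ← Complex.exp_add]
  congr 1
  rw [← mul_add, ← Finset.sum_add_distrib]
  congr 1
  apply Finset.sum_congr rfl
  intro i _
  simp; ring

lemma ec_icast (k m : ι → ℤ) : ec k (icast m) = 1 := by
  simp only [ec]
  rw [Complex.exp_eq_one_iff]
  refine ⟨∑ i, k i * m i, ?_⟩
  push_cast
  simp [icast]; ring

lemma norm_ec (k : ι → ℤ) (x : ι → ℝ) : ‖ec k x‖ = 1 := by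
  simp only [ec]
  rw [Complex.norm_exp]
  simp [Complex.mul_re, Complex.mul_im]

lemma continuous_ec (k : ι → ℤ) : Continuous (ec k : (ι → ℝ) → ℂ) := by
  unfold ec; fun_prop

theorem poisson (g : (ι → ℝ) → ℂ) (hg : Continuous g) (hgi : Integrable g)
    (hb : ∀ R : ℝ, ∃ u : (ι → ℤ) → ℝ, Summable u ∧ ∀ x : ι → ℝ, ‖x‖ ≤ R → ∀ m, ‖g (x + icast m)‖ ≤ u m)
    (hs : Summable (fun k : ι → ℤ => ∫ x, ec (-k) x * g x)) (x : ι → ℝ) :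
    HasSum (fun k : ι → ℤ => (∫ x, ec (-k) x * g x) * ec k x) (∑' m : ι → ℤ, g (x + icast m)) := by
  classical
  set P : (ι → ℝ) → ℂ := fun x => ∑' m : ι → ℤ, g (x + icast m) with hP
  have hPc : Continuous P := by
    rw [continuous_iff_continuousAt]
    intro x
    obtain ⟨u, hu, hub⟩ := hb (‖x‖ + 1)
    have : ContinuousOn P (Metric.ball 0 (‖x‖ + 1)) := by
      apply continuousOn_tsum (u := u)
      · intro m
        exact (hg.comp (continuous_id.add continuous_const)).continuousOn
      · exact hu
      · intro m y hy
        apply hub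
        rw [mem_ball_zero_iff] at hy
        exact hy.le
    exact this.continuousAt (Metric.isOpen_ball.mem_nhds (by simp))
  have hPper : ∀ x (n : ι → ℤ), P (x + icast n) = P x := by
    intro x n
    simp only [hP]
    rw [← (Equiv.addLeft n).tsum_eq (fun m => g (x + icast m))]
    apply tsum_congr
    intro m
    congr 1
    ext i
    simp [icast]; ring
  -- quotient map
  let q : (ι → ℝ) → UnitAddTorus ι := fun x i => (x i : UnitAddCircle)
  have hq : IsOpenQuotientMap q := by
    apply IsOpenQuotientMap.piMap
    intro i
    exact QuotientAddGroup.isOpenQuotientMap_mk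
  have hfac : Function.FactorsThrough P q := by
    intro x y hxy
    have : ∀ i, ∃ n : ℤ, x i = y i + n := by
      intro i
      have h1 := congrFun hxy i
      simp only [q] at h1
      have h2 := (QuotientAddGroup.eq_iff_sub_mem (N := AddSubgroup.zmultiples (1:ℝ))).1 h1
      rw [AddSubgroup.mem_zmultiples_iff] at h2
      obtain ⟨n, hn⟩ := h2
      exact ⟨n, by simp at hn; linarith⟩
    choose n hn using this
    have : x = y + icast n := by ext i; simp [hn, icast]
    rw [this, hPper]
  have hq' : Topology.IsQuotientMap (⟨q, hq.continuous⟩ : C(ι → ℝ, UnitAddTorus ι)) := hq.isQuotientMap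
  let Pq : C(UnitAddTorus ι, ℂ) := hq'.lift ⟨P, hPc⟩ hfac
  have hPq : ∀ x : ι → ℝ, Pq (fun i => (x i : UnitAddCircle)) = P x := by
    intro x
    exact DFunLike.congr_fun (hq'.lift_comp ⟨P, hPc⟩ hfac) x
  have hcoef : UnitAddTorus.mFourierCoeff Pq = fun k : ι → ℤ => ∫ x, ec (-k) x * g x := by
    funext k
    rw [UnitAddTorus.mFourierCoeff_eq_integral Pq k 0]
    have hI : Integrable (fun x => ec (-k) x * g x) := by
      apply hgi.bdd_mul (c := 1) (continuous_ec _).aestronglyMeasurable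
      exact Filter.Eventually.of_forall (fun x => (norm_ec _ x).le)
    rw [← (hasSum_box _ hI).tsum_eq]
    have : {x : ι → ℝ | ∀ (i : ι), x i ∈ Set.Ioc ((0 : ι → ℝ) i) ((0 : ι → ℝ) i + 1)} = box ι := rfl
    rw [this]
    obtain ⟨u, hu, hub⟩ := hb 1
    have hbox : ∀ x ∈ box ι, ‖x‖ ≤ 1 := by
      intro x hx
      rw [pi_norm_le_iff_of_nonneg zero_le_one]
      intro i
      have := hx i
      rw [Real.norm_eq_abs, abs_of_pos this.1]
      linarith [this.2]
    rw [integral_tsum_of_summable_integral_norm (E := ℂ) (μ := volume.restrict (box ι)) (F := fun (m : ι → ℤ) x => ec (-k) (x + icast m) * g (x + icast m))]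
    · apply setIntegral_congr_fun measurableSet_box
      intro x hx
      simp only
      rw [mFourier_coe, hPq, smul_eq_mul, hP]
      simp only
      rw [← tsum_mul_left]
      apply tsum_congr
      intro m
      rw [ec_add, ec_icast, mul_one]
    · intro m
      exact (hI.comp_add_right (icast m)).integrableOn
    · apply Summable.of_nonneg_of_le (f := fun m => u m * (volume (box ι)).toReal)
      · intro m; positivity
      · intro m
        have hfin : volume (box ι) < ⊤ := by
          apply (Metric.isBounded_closedBall (x := (0 : ι → ℝ)) (r := 1)).subset ?_ |>.measure_lt_top
          intro x hx
          simpa using hbox x hx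
        have := norm_setIntegral_le_of_norm_le_const (μ := volume) (s := box ι) hfin
          (f := fun x => ‖ec (-k) (x + icast m) * g (x + icast m)‖) (C := u m) ?_
        · exact (le_abs_self _).trans this
        · intro x hx
          rw [norm_norm, norm_mul, norm_ec, one_mul]
          exact hub x (hbox x hx) m
      · exact hu.mul_right _
  have := UnitAddTorus.hasSum_mFourier_series_apply_of_summable (f := Pq) (by rw [hcoef]; exact hs)
    (fun i => (x i : UnitAddCircle))
  rw [hPq, hcoef] at this
  simpa [mFourier_coe, smul_eq_mul] using this

end Poisson
end CMNorm

namespace CMNorm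
open MeasureTheory Complex
open scoped Real BigOperators
set_option linter.unusedSectionVars false

section Gauss
variable {ι V : Type*} [Fintype ι] [Fintype V]

lemma box_norm_le {x : ι → ℝ} (hx : x ∈ box ι) : ‖x‖ ≤ 1 := by
  rw [pi_norm_le_iff_of_nonneg zero_le_one]
  intro i
  have := hx i
  rw [Real.norm_eq_abs, abs_of_pos this.1]
  linarith [this.2]

lemma volume_box : volume (box ι) = 1 := by
  have : box ι = Set.pi Set.univ (fun _ => Set.Ioc (0:ℝ) (0+1)) := by ext; simp [box]
  rw [this, volume_pi, Measure.pi_pi]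
  simp

lemma summable_one_add_norm {r : ℝ} (hr : (Fintype.card ι : ℝ) < r) :
    Summable (fun m : ι → ℤ => (1 + ‖icast m‖) ^ (-r)) := by
  have hr0 : 0 < r := lt_of_le_of_lt (by positivity) hr
  have hI : Integrable (fun x : ι → ℝ => (1 + ‖x‖) ^ (-r)) := by
    apply integrable_one_add_norm
    simpa using hr
  have h := ((hasSum_box _ hI).summable.mul_left ((2:ℝ) ^ r))
  refine Summable.of_nonneg_of_le (fun m => by positivity) (fun m => ?_) h
  have h1 : ∀ x ∈ box ι, (2:ℝ) ^ (-r) * (1 + ‖icast m‖) ^ (-r) ≤ (1 + ‖x + icast m‖) ^ (-r) := by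
    intro x hx
    rw [← Real.mul_rpow (by norm_num) (by positivity)]
    apply Real.rpow_le_rpow_of_nonpos (by positivity) _ (by linarith)
    have := norm_add_le x (icast m)
    have := box_norm_le hx
    nlinarith [norm_nonneg (icast m)]
  have h2 : (2:ℝ) ^ (-r) * (1 + ‖icast m‖) ^ (-r) ≤ ∫ x in box ι, (1 + ‖x + icast m‖) ^ (-r) := by
    have h3 := setIntegral_mono_on (μ := volume) (s := box ι)
      (f := fun _ => (2:ℝ) ^ (-r) * (1 + ‖icast m‖) ^ (-r))
      (g := fun x => (1 + ‖x + icast m‖) ^ (-r)) ?_ ?_ measurableSet_box h1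
    · simpa [Measure.real, volume_box] using h3
    · exact integrableOn_const (by simp [volume_box])
    · exact (hI.comp_add_right (icast m)).integrableOn
  have h4 : (2:ℝ) ^ r * (2:ℝ) ^ (-r) = 1 := by
    rw [← Real.rpow_add (by norm_num)]; simp
  calc (1 + ‖icast m‖) ^ (-r) = (2:ℝ) ^ r * ((2:ℝ) ^ (-r) * (1 + ‖icast m‖) ^ (-r)) := by
        rw [← mul_assoc, h4, one_mul]
    _ ≤ _ := by gcongr

lemma exp_bound {c : ℝ} (hc : 0 < c) (k : ℕ) {t : ℝ} (ht : 0 ≤ t) :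
    Real.exp (-c * t ^ 2) ≤ (Real.exp c * k.factorial * (2 / c) ^ k) * (1 + t) ^ (-(2 * k : ℝ)) := by
  have h1 : (c * (1 + t ^ 2)) ^ k / k.factorial ≤ Real.exp (c * (1 + t ^ 2)) :=
    Real.pow_div_factorial_le_exp _ (by positivity) k
  have h2 : ((1 + t) ^ 2) ^ k ≤ (2 * (1 + t ^ 2)) ^ k := by
    gcongr
    nlinarith [sq_nonneg (1 - t)]
  have h3 : (1 + t) ^ (-(2 * k : ℝ)) = (((1 + t) ^ 2) ^ k)⁻¹ := by
    rw [Real.rpow_neg (by positivity), ← pow_mul]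
    congr 1
    rw [← Real.rpow_natCast]; push_cast; rfl
  rw [h3]
  have h4 : Real.exp (-c * t ^ 2) = Real.exp c * (Real.exp (c * (1 + t ^ 2)))⁻¹ := by
    rw [← Real.exp_neg, ← Real.exp_add]; congr 1; ring
  rw [h4, mul_assoc, mul_assoc]
  gcongr
  have h5 : (k.factorial : ℝ) * ((2 / c) ^ k * (((1 + t) ^ 2) ^ k)⁻¹) =
     ((((1 + t) ^ 2) ^ k) / ((2/c)^k * k.factorial))⁻¹ := by
    field_simp
  rw [h5]
  gcongr
  refine le_trans ?_ h1
  rw [div_le_div_iff₀ (by positivity) (by positivity)]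
  have h6 : (c * (1 + t ^ 2)) ^ k * ((2 / c) ^ k * k.factorial) = (2 * (1 + t ^ 2)) ^ k * k.factorial := by
    rw [← mul_assoc, ← mul_pow]; congr 2; field_simp
  rw [h6]
  gcongr

lemma summable_exp_norm {c : ℝ} (hc : 0 < c) :
    Summable (fun m : ι → ℤ => Real.exp (-c * ‖icast m‖ ^ 2)) := by
  have h := summable_one_add_norm (ι := ι) (r := 2 * (Fintype.card ι + 1 : ℕ)) (by push_cast; linarith)
  refine Summable.of_nonneg_of_le (fun m => by positivity) (fun m => ?_)
    (h.mul_left (Real.exp c * (Fintype.card ι + 1).factorial * (2 / c) ^ (Fintype.card ι + 1)))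
  exact exp_bound hc _ (norm_nonneg _)

variable (B : (ι → ℝ) ≃L[ℝ] (V → ℝ))

/-- Gaussian -/
noncomputable def gau (w : V → ℂ) (x : ι → ℝ) : ℂ := cexp (-∑ v, (π * w v) * ((B x v : ℝ) : ℂ) ^ 2)

lemma norm_gau (w : V → ℂ) (x : ι → ℝ) :
    ‖gau B w x‖ = Real.exp (-∑ v, π * (w v).re * (B x v) ^ 2) := by
  rw [gau, Complex.norm_exp]
  congr 1
  simp only [neg_re, re_sum]
  congr 1
  apply Finset.sum_congr rfl
  intro v _
  have : (π * w v) * ((B x v : ℝ) : ℂ) ^ 2 = ((π * (B x v) ^ 2 : ℝ) : ℂ) * w v := by push_cast; ring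
  rw [this, re_ofReal_mul]; ring

lemma continuous_gau (w : V → ℂ) : Continuous (gau B w) := by
  unfold gau
  have : ∀ v, Continuous (fun x => B x v) := fun v => (continuous_apply v).comp B.continuous
  fun_prop

lemma exists_lower {w : V → ℝ} (hw : ∀ v, 0 < w v) :
    ∃ c > 0, ∀ y : V → ℝ, c * ‖y‖ ^ 2 ≤ ∑ v, w v * y v ^ 2 := by
  have : ∃ c > 0, ∀ v, c ≤ w v := by
    rcases isEmpty_or_nonempty V with h | h
    · exact ⟨1, one_pos, fun v => (h.false v).elim⟩
    · obtain ⟨v, hv⟩ := Finite.exists_min w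
      exact ⟨w v, hw v, hv⟩
  obtain ⟨c, hc, hcw⟩ := this
  refine ⟨c, hc, fun y => ?_⟩
  rcases isEmpty_or_nonempty V with h | h
  · have : y = 0 := Subsingleton.elim _ _
    simp [this]
  · have ⟨v, hv⟩ : ∃ v, ‖y‖ = ‖y v‖ := by
      obtain ⟨v, hv⟩ := Finite.exists_max (fun v => ‖y v‖)
      exact ⟨v, le_antisymm ((pi_norm_le_iff_of_nonneg (norm_nonneg _)).2 hv) (norm_le_pi_norm y v)⟩
    rw [hv, Real.norm_eq_abs, sq_abs]
    calc c * y v ^ 2 ≤ w v * y v ^ 2 := by gcongr; exact hcw v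
      _ ≤ _ := Finset.single_le_sum (f := fun v => w v * y v ^ 2) (fun v _ => by have := hw v; positivity) (Finset.mem_univ v)

lemma exists_gau_bound {w : V → ℂ} (hw : ∀ v, 0 < (w v).re) :
    ∃ c > 0, ∀ x, ‖gau B w x‖ ≤ Real.exp (-c * ‖x‖ ^ 2) := by
  obtain ⟨c, hc, h⟩ := exists_lower (w := fun v => π * (w v).re) (fun v => mul_pos Real.pi_pos (hw v))
  obtain ⟨K, hK, hB⟩ := B.symm.toContinuousLinearMap.isBoundedLinearMap.bound
  refine ⟨c / K ^ 2, by positivity, fun x => ?_⟩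
  rw [norm_gau]
  apply Real.exp_le_exp.2
  have h1 := h (B x)
  have h2 := hB (B x)
  simp at h2
  have h3 : ‖x‖ ^ 2 / K ^ 2 ≤ ‖B x‖ ^ 2 := by
    rw [div_le_iff₀ (by positivity)]
    calc ‖x‖ ^ 2 ≤ (K * ‖B x‖) ^ 2 := by gcongr
      _ = _ := by ring
  have h4 : c * (‖x‖ ^ 2 / K ^ 2) ≤ c * ‖B x‖ ^ 2 := by gcongr
  have h5 : -(c / K ^ 2) * ‖x‖ ^ 2 = - (c * (‖x‖ ^ 2 / K ^ 2)) := by ring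
  rw [h5]
  exact neg_le_neg (h4.trans h1)

lemma gau_local_bound {w : V → ℂ} (hw : ∀ v, 0 < (w v).re) (R : ℝ) :
    ∃ u : (ι → ℤ) → ℝ, Summable u ∧ ∀ x : ι → ℝ, ‖x‖ ≤ R → ∀ m, ‖gau B w (x + icast m)‖ ≤ u m := by
  obtain ⟨c, hc, h⟩ := exists_gau_bound B hw
  refine ⟨fun m => Real.exp (c * R ^ 2) * Real.exp (-(c / 2) * ‖icast m‖ ^ 2),
    (summable_exp_norm (by positivity)).mul_left _, fun x hx m => ?_⟩
  refine (h _).trans ?_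
  simp only
  rw [← Real.exp_add]
  apply Real.exp_le_exp.2
  have h1 : ‖icast m‖ ≤ ‖x + icast m‖ + ‖x‖ := by
    have := norm_sub_le (x + icast m) x
    simpa using this
  have h0 := norm_nonneg x
  have h2 : ‖icast m‖ ^ 2 ≤ 2 * ‖x + icast m‖ ^ 2 + 2 * R ^ 2 := by
    have : ‖icast m‖ ^ 2 ≤ (‖x + icast m‖ + ‖x‖) ^ 2 := by gcongr
    nlinarith [sq_nonneg (‖x + icast m‖ - ‖x‖)]
  nlinarith

lemma gau_summable {w : V → ℂ} (hw : ∀ v, 0 < (w v).re) (ξ : ι → ℝ) :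
    Summable (fun m : ι → ℤ => gau B w (ξ + icast m)) := by
  obtain ⟨u, hu, h⟩ := gau_local_bound B hw ‖ξ‖
  exact hu.of_norm_bounded (fun m => h ξ le_rfl m)

lemma exists_measure_const : ∃ C : ℝ, C ≠ 0 ∧ ∀ f : (V → ℝ) → ℂ,
    ∫ x : ι → ℝ, f (B x) = C * ∫ y, f y := by
  have h1 : (volume.map B : Measure (V → ℝ)).IsAddHaarMeasure := B.isAddHaarMeasure_map volume
  have h2 := Measure.isAddLeftInvariant_eq_smul (volume.map B : Measure (V → ℝ)) volume
  set c := Measure.addHaarScalarFactor (volume.map B : Measure (V → ℝ)) volume with hc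
  have hc0 : c ≠ 0 := (Measure.addHaarScalarFactor_pos_of_isAddHaarMeasure _ _).ne'
  refine ⟨c, by exact_mod_cast hc0, fun f => ?_⟩
  have h3 : ∫ y, f y ∂(volume.map B) = ∫ x : ι → ℝ, f (B x) :=
    (B.toHomeomorph.measurableEmbedding).integral_map f
  rw [← h3, h2, integral_smul_nnreal_measure]
  simp [NNReal.smul_def]

lemma norm_sq_le_sum (y : V → ℝ) : ‖y‖ ^ 2 ≤ ∑ v, y v ^ 2 := by
  rcases isEmpty_or_nonempty V with h | h
  · have : y = 0 := Subsingleton.elim _ _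
    simp [this]
  · have ⟨v, hv⟩ : ∃ v, ‖y‖ = ‖y v‖ := by
      obtain ⟨v, hv⟩ := Finite.exists_max (fun v => ‖y v‖)
      exact ⟨v, le_antisymm ((pi_norm_le_iff_of_nonneg (norm_nonneg _)).2 hv) (norm_le_pi_norm y v)⟩
    rw [hv, Real.norm_eq_abs, sq_abs]
    exact Finset.single_le_sum (f := fun v => y v ^ 2) (fun v _ => by positivity) (Finset.mem_univ v)

lemma dual_lower (κ : (ι → ℤ) → V → ℝ)
    (hκ : ∀ k x, ∑ i, (k i : ℝ) * x i = ∑ v, κ k v * B x v) :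
    ∃ b > 0, ∀ k, b * ‖icast k‖ ≤ ‖κ k‖ := by
  obtain ⟨K, hK, hB⟩ := B.toContinuousLinearMap.isBoundedLinearMap.bound
  refine ⟨1 / ((Fintype.card V + 1) * K), by positivity, fun k => ?_⟩
  rw [one_div_mul_eq_div, div_le_iff₀ (by positivity)]
  have h1 := hκ k (icast k)
  obtain h0 | h0 := eq_or_ne (icast k) 0
  · simp [h0]; positivity
  have hpos : 0 < ‖icast k‖ := norm_pos_iff.2 h0
  have hl := norm_sq_le_sum (icast k)
  have h2 : ∑ v, κ k v * B (icast k) v ≤ ∑ _v : V, ‖κ k‖ * (K * ‖icast k‖) := by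
    apply Finset.sum_le_sum
    intro v _
    calc κ k v * B (icast k) v ≤ ‖κ k v‖ * ‖B (icast k) v‖ := by
          rw [← norm_mul]; exact le_abs_self _
      _ ≤ _ := by
        gcongr
        · exact norm_le_pi_norm _ v
        · exact (norm_le_pi_norm _ v).trans (hB _)
  rw [Finset.sum_const, Finset.card_univ, nsmul_eq_mul] at h2
  have h3 : ‖icast k‖ ^ 2 ≤ Fintype.card V * (‖κ k‖ * (K * ‖icast k‖)) := by
    refine hl.trans (le_trans (le_of_eq ?_) h2)
    rw [← h1]
    apply Finset.sum_congr rfl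
    intro i _
    simp [icast, sq]
  have h4 : ‖icast k‖ ≤ Fintype.card V * (‖κ k‖ * K) := by
    have : ‖icast k‖ * ‖icast k‖ ≤ (Fintype.card V * (‖κ k‖ * K)) * ‖icast k‖ := by
      calc _ = ‖icast k‖ ^ 2 := by ring
        _ ≤ _ := h3
        _ = _ := by ring
    exact le_of_mul_le_mul_right this hpos
  have : 0 ≤ ‖κ k‖ * K := by positivity
  nlinarith

lemma dual_summable (κ : (ι → ℤ) → V → ℝ)
    (hκ : ∀ k x, ∑ i, (k i : ℝ) * x i = ∑ v, κ k v * B x v) {w : V → ℝ} (hw : ∀ v, 0 < w v) :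
    Summable (fun k => Real.exp (-∑ v, w v * κ k v ^ 2)) := by
  obtain ⟨c, hc, h⟩ := exists_lower hw
  obtain ⟨b, hb, h'⟩ := dual_lower B κ hκ
  refine Summable.of_nonneg_of_le (fun k => by positivity) (fun k => ?_)
    (summable_exp_norm (ι := ι) (c := c * b ^ 2) (by positivity))
  apply Real.exp_le_exp.2
  have h1 := h (κ k)
  have h2 : (b * ‖icast k‖) ^ 2 ≤ ‖κ k‖ ^ 2 := by
    gcongr
    exact h' k
  nlinarith

/-- dual gaussian term -/
noncomputable def dgau (κ : (ι → ℤ) → V → ℝ) (w : V → ℂ) (k : ι → ℤ) : ℂ :=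
  cexp (-∑ v, (π * w v) * ((κ k v : ℝ) : ℂ) ^ 2)

lemma norm_dgau (κ : (ι → ℤ) → V → ℝ) (w : V → ℂ) (k : ι → ℤ) :
    ‖dgau κ w k‖ = Real.exp (-∑ v, π * (w v).re * (κ k v) ^ 2) := by
  rw [dgau, Complex.norm_exp]
  congr 1
  simp only [neg_re, re_sum]
  congr 1
  apply Finset.sum_congr rfl
  intro v _
  have : (π * w v) * ((κ k v : ℝ) : ℂ) ^ 2 = ((π * (κ k v) ^ 2 : ℝ) : ℂ) * w v := by push_cast; ring
  rw [this, re_ofReal_mul]; ring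

lemma dgau_summable (κ : (ι → ℤ) → V → ℝ)
    (hκ : ∀ k x, ∑ i, (k i : ℝ) * x i = ∑ v, κ k v * B x v) {w : V → ℂ} (hw : ∀ v, 0 < (w v).re) :
    Summable (fun k => ‖dgau κ w k‖) := by
  simp_rw [norm_dgau]
  exact dual_summable B κ hκ (fun v => mul_pos Real.pi_pos (hw v))

lemma gau_integrable {w : V → ℂ} (hw : ∀ v, 0 < (w v).re) : Integrable (gau B w) := by
  have h1 : (volume.map B : Measure (V → ℝ)).IsAddHaarMeasure := B.isAddHaarMeasure_map volume
  have h2 := Measure.isAddLeftInvariant_eq_smul (volume.map B : Measure (V → ℝ)) volume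
  have h3 := GaussianFourier.integrable_cexp_neg_sum_mul_add (b := fun v => π * w v)
    (fun v => by rw [re_ofReal_mul]; exact mul_pos Real.pi_pos (hw v)) 0
  simp only [Pi.zero_apply, zero_mul, Finset.sum_const_zero, add_zero] at h3
  have h4 := h3.smul_measure_nnreal (c := Measure.addHaarScalarFactor (volume.map B : Measure (V → ℝ)) volume)
  rw [← h2] at h4
  exact (B.toHomeomorph.measurableEmbedding.integrable_map_iff).1 h4

theorem gauss_poisson : ∃ C : ℂ, C ≠ 0 ∧ ∀ (κ : (ι → ℤ) → V → ℝ)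
    (_ : ∀ k x, ∑ i, (k i : ℝ) * x i = ∑ v, κ k v * B x v) (w : V → ℂ) (_ : ∀ v, 0 < (w v).re)
    (ξ : ι → ℝ), ∑' m : ι → ℤ, gau B w (ξ + icast m) =
      C * (∏ v, (1 / w v) ^ (1 / 2 : ℂ)) * ∑' k, ec k ξ * dgau κ (fun v => 1 / w v) k := by
  obtain ⟨C, hC, hCm⟩ := exists_measure_const B
  refine ⟨C, by exact_mod_cast hC, fun κ hκ w hw ξ => ?_⟩
  have hw0 : ∀ v, w v ≠ 0 := fun v h => by have := hw v; simp [h] at this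
  have hFT : ∀ k : ι → ℤ, ∫ x, ec (-k) x * gau B w x =
      C * (∏ v, (1 / w v) ^ (1 / 2 : ℂ)) * dgau κ (fun v => 1 / w v) k := by
    intro k
    have h1 := GaussianFourier.integral_cexp_neg_sum_mul_add (b := fun v => π * w v)
      (fun v => by rw [re_ofReal_mul]; exact mul_pos Real.pi_pos (hw v))
      (fun v => -(2 * π * I) * κ k v)
    have h2 := hCm (fun y => cexp (-∑ v, (π * w v) * (y v : ℂ) ^ 2 + ∑ v, -(2 * π * I) * κ k v * y v))
    rw [h1] at h2
    rw [mul_assoc]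
    convert h2 using 2
    · ext x
      rw [ec, gau, ← Complex.exp_add, add_comm]
      congr 2
      have := hκ k x
      have h3 : (∑ i, ((-k) i : ℂ) * (x i : ℂ)) = -((∑ v, κ k v * B x v : ℝ) : ℂ) := by
        rw [← this]; push_cast; simp
      have h4 : (∑ i, (((-k) i : ℤ) : ℂ) * (x i : ℂ)) = -((∑ v, κ k v * B x v : ℝ) : ℂ) := by
        rw [← this]; push_cast; simp
      rw [h4]
      push_cast
      rw [mul_neg, Finset.mul_sum, ← Finset.sum_neg_distrib]
      apply Finset.sum_congr rfl
      intro v _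
      ring
    · rw [Finset.prod_mul_distrib, dgau, ← Complex.exp_sum, ← Finset.sum_neg_distrib]
      congr 1
      · apply Finset.prod_congr rfl
        intro v _
        congr 1
        have : (π : ℂ) ≠ 0 := by exact_mod_cast Real.pi_ne_zero
        field_simp
      · congr 1
        apply Finset.sum_congr rfl
        intro v _
        have : (π : ℂ) ≠ 0 := by exact_mod_cast Real.pi_ne_zero
        have := hw0 v
        have hI : I ^ 2 = -1 := I_sq
        field_simp
        rw [hI]
        ring
  have hinv : ∀ v, 0 < (1 / w v).re := by
    intro v
    rw [one_div, inv_re]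
    have := hw v
    have h2 := normSq_pos.2 (hw0 v)
    positivity
  have hp := poisson (gau B w) (continuous_gau B w) (gau_integrable B hw) (gau_local_bound B hw) ?_ ξ
  · rw [← hp.tsum_eq, ← tsum_mul_left]
    apply tsum_congr
    intro k
    rw [hFT]; ring
  · simp_rw [hFT]
    exact ((dgau_summable B κ hκ hinv).of_norm).mul_left _

end Gauss
end CMNorm

namespace CMNorm
open MeasureTheory Complex NumberField
open scoped Real BigOperators
set_option linter.unusedSectionVars false

section Field
variable (F : Type*) [Field F] [NumberField F] [IsTotallyReal F]

variable {F} in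
/-- real embedding attached to a place -/
noncomputable def rv (v : InfinitePlace F) : F →+* ℝ :=
  InfinitePlace.embedding_of_isReal (IsTotallyReal.isReal v)

variable {F} in
lemma rv_coe (v : InfinitePlace F) (x : F) : ((rv v x : ℝ) : ℂ) = v.embedding x :=
  InfinitePlace.embedding_of_isReal_apply _ x

/-- places are the complex embeddings -/
noncomputable def placeEquiv : InfinitePlace F ≃ (F →ₐ[ℚ] ℂ) :=
  Equiv.ofBijective (fun v => v.embedding.toRatAlgHom) <| by
    constructor
    · intro v w h
      have : v.embedding = w.embedding := by
        ext x
        exact DFunLike.congr_fun h x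
      rw [← InfinitePlace.mk_embedding v, this, InfinitePlace.mk_embedding]
    · intro φ
      refine ⟨InfinitePlace.mk φ.toRingHom, ?_⟩
      have := InfinitePlace.embedding_mk_eq_of_isReal (φ := φ.toRingHom)
        (IsTotallyReal.complexEmbedding_isReal _)
      ext x
      exact DFunLike.congr_fun this x

variable {F} in
lemma trace_eq (x : F) : ((Algebra.trace ℚ F x : ℚ) : ℝ) = ∑ v, rv v x := by
  have h := trace_eq_sum_embeddings (K := ℚ) (L := F) ℂ (x := x)
  rw [← (placeEquiv F).sum_comp] at h
  have h2 : ((Algebra.trace ℚ F x : ℚ) : ℂ) = ∑ v : InfinitePlace F, ((rv v x : ℝ) : ℂ) := by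
    simp_rw [rv_coe]
    rw [eq_ratCast] at h
    exact h
  exact_mod_cast h2

variable {F} in
lemma norm_eq (x : F) : ((Algebra.norm ℚ x : ℚ) : ℝ) = ∏ v, rv v x := by
  have h := Algebra.norm_eq_prod_embeddings ℚ (L := F) ℂ x
  rw [← (placeEquiv F).prod_comp] at h
  have h2 : ((Algebra.norm ℚ x : ℚ) : ℂ) = ∏ v : InfinitePlace F, ((rv v x : ℝ) : ℂ) := by
    simp_rw [rv_coe]
    rw [eq_ratCast] at h
    exact h
  exact_mod_cast h2

/-- index type of an integral basis -/
abbrev Idx := Module.Free.ChooseBasisIndex ℤ (𝓞 F)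

/-- the linear map of the lattice -/
noncomputable def Blin : (Idx F → ℝ) →ₗ[ℝ] (InfinitePlace F → ℝ) where
  toFun x v := ∑ i, x i * rv v (integralBasis F i)
  map_add' x y := by ext v; simp [add_mul, Finset.sum_add_distrib]
  map_smul' c x := by ext v; simp [Finset.mul_sum, mul_assoc]

/-- dual lattice element -/
noncomputable def del (k : Idx F → ℤ) : F := ∑ j, (k j : F) * (integralBasis F).traceDual j

lemma dual_pairing (k : Idx F → ℤ) (x : Idx F → ℝ) :
    ∑ i, (k i : ℝ) * x i = ∑ v, rv v (del F k) * Blin F x v := by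
  classical
  have h1 : ∀ i, ∑ v, rv v (del F k) * rv v (integralBasis F i) = k i := by
    intro i
    simp_rw [← map_mul]
    rw [← trace_eq]
    simp only [del, Finset.sum_mul, map_sum]
    have : ∀ j, Algebra.trace ℚ F ((k j : F) * (integralBasis F).traceDual j * integralBasis F i)
        = k j * if i = j then 1 else 0 := by
      intro j
      have h2 : (k j : F) * (integralBasis F).traceDual j * integralBasis F i =
        (k j : ℚ) • ((integralBasis F).traceDual j * integralBasis F i) := by
        rw [Algebra.smul_def, mul_assoc]; simp
      rw [h2, map_smul, Module.Basis.trace_traceDual_mul]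
      simp [eq_comm]
    simp_rw [this]
    simp
  simp only [Blin, LinearMap.coe_mk, AddHom.coe_mk, Finset.mul_sum]
  rw [Finset.sum_comm]
  apply Finset.sum_congr rfl
  intro i _
  rw [← h1 i, Finset.sum_mul]
  apply Finset.sum_congr rfl
  intro v _
  ring

lemma Blin_injective : Function.Injective (Blin F) := by
  classical
  rw [← LinearMap.ker_eq_bot, LinearMap.ker_eq_bot']
  intro x hx
  ext i
  have := dual_pairing F (Pi.single i 1) x
  rw [hx] at this
  simpa [Pi.single_apply] using this

lemma card_eq : Fintype.card (Idx F) = Fintype.card (InfinitePlace F) := by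
  have h1 : Module.finrank ℚ F = Fintype.card (Idx F) :=
    Module.finrank_eq_card_basis (integralBasis F)
  have h2 := Fintype.card_congr (placeEquiv F)
  rw [h2, AlgHom.card, h1]

/-- the lattice isomorphism -/
noncomputable def Beq : (Idx F → ℝ) ≃L[ℝ] (InfinitePlace F → ℝ) :=
  (LinearEquiv.ofInjectiveOfFinrankEq (Blin F) (Blin_injective F)
    (by simp [card_eq F])).toContinuousLinearEquiv

lemma Beq_apply (x : Idx F → ℝ) : Beq F x = Blin F x := rfl

/-- The basis of `𝓞 F` as an equivalence -/
noncomputable def basEquiv : 𝓞 F ≃ (Idx F → ℤ) := (RingOfIntegers.basis F).equivFun.toEquiv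

lemma Beq_bas (x : 𝓞 F) (y : F) (v : InfinitePlace F) :
    Beq F ((fun i => (((integralBasis F).repr y i : ℚ) : ℝ)) + icast (basEquiv F x)) v = rv v (x + y) := by
  have h1 : ∀ z : F, rv v z = ∑ i, (((integralBasis F).repr z i : ℚ) : ℝ) * rv v (integralBasis F i) := by
    intro z
    conv_lhs => rw [← (integralBasis F).sum_repr z]
    rw [map_sum]
    apply Finset.sum_congr rfl
    intro i _
    rw [Algebra.smul_def, map_mul]
    simp
  rw [Beq_apply, h1]
  change ∑ i, _ = _
  apply Finset.sum_congr rfl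
  intro i _
  have : (integralBasis F).repr (x : F) i = (basEquiv F x i : ℚ) := by
    rw [integralBasis_repr_apply]; rfl
  rw [map_add, Finsupp.add_apply, this]
  simp [icast, add_comm]

variable {F} in
/-- Gaussian on `F` -/
noncomputable def Gs (w : InfinitePlace F → ℂ) (y : F) : ℂ := cexp (-∑ v, (π * w v) * ((rv v y : ℝ) : ℂ) ^ 2)

lemma Gs_summable {w : InfinitePlace F → ℂ} (hw : ∀ v, 0 < (w v).re) (y : F) :
    Summable (fun x : 𝓞 F => Gs w (x + y)) := by
  have := gau_summable (Beq F) hw (fun i => (((integralBasis F).repr y i : ℚ) : ℝ))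
  rw [← (basEquiv F).summable_iff] at this
  convert this using 2 with x
  simp only [Gs, gau, Function.comp, Beq_bas]

lemma del_summable {w : InfinitePlace F → ℂ} (hw : ∀ v, 0 < (w v).re) :
    Summable (fun k => ‖Gs w (del F k)‖) :=
  dgau_summable (Beq F) (fun k v => rv v (del F k)) (dual_pairing F) hw

theorem theta : ∃ C : ℂ, C ≠ 0 ∧ ∀ w : InfinitePlace F → ℂ, (∀ v, 0 < (w v).re) → 
    ∀ y : F, ∃ e : (Idx F → ℤ) → ℂ, (∀ k, ‖e k‖ ≤ 1) ∧ e 0 = 1 ∧ (y = 0 → ∀ k, e k = 1) ∧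
     ∑' x : 𝓞 F, Gs w (x + y) = 
      C * (∏ v, (1 / w v) ^ (1 / 2 : ℂ)) * ∑' k, e k * Gs (fun v => 1 / w v) (del F k) := by
  obtain ⟨C, hC, h⟩ := gauss_poisson (Beq F)
  refine ⟨C, hC, fun w hw y => ?_⟩
  set ξ : Idx F → ℝ := fun i => (((integralBasis F).repr y i : ℚ) : ℝ) with hξ
  refine ⟨fun k => ec k ξ, fun k => (norm_ec _ _).le, by simp [ec], ?_, ?_⟩
  · rintro rfl k
    simp [hξ, ec]
  · have h1 := h (fun k v => rv v (del F k)) (dual_pairing F) w hw ξ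
    rw [← (basEquiv F).tsum_eq] at h1
    simp only [gau, hξ, Beq_bas] at h1
    exact h1

lemma exists_denom : ∃ M : ℕ, 0 < M ∧ ∀ k, ∃ z : 𝓞 F, (M : F) * del F k = z := by
  have : ∀ j, ∃ m : ℕ, 0 < m ∧ ∃ z : 𝓞 F, (m : F) * (integralBasis F).traceDual j = z := by
    intro j
    have halg : IsAlgebraic ℤ ((integralBasis F).traceDual j) :=
      (IsFractionRing.isAlgebraic_iff ℤ ℚ F).2 (Algebra.IsAlgebraic.isAlgebraic _)
    obtain ⟨m, hm0, hm⟩ := halg.exists_integral_multiple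
    refine ⟨m.natAbs, Int.natAbs_pos.2 hm0, ?_⟩
    have h2 : IsIntegral ℤ ((m.natAbs : F) * (integralBasis F).traceDual j) := by
      rcases Int.natAbs_eq m with h | h
      · rw [h] at hm
        simpa [Algebra.smul_def] using hm
      · rw [h] at hm
        have := hm.neg
        simpa [Algebra.smul_def] using this
    exact ⟨⟨_, h2⟩, rfl⟩
  choose m hm z hz using this
  refine ⟨∏ j, m j, Finset.prod_pos (fun j _ => hm j), fun k => ?_⟩
  classical
  refine ⟨∑ j, (k j : 𝓞 F) * (∏ i ∈ Finset.univ.erase j, (m i : 𝓞 F)) * z j, ?_⟩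
  simp only [del, Finset.mul_sum, map_sum, map_mul]
  apply Finset.sum_congr rfl
  intro j _
  have h2 : (algebraMap (𝓞 F) F) (z j) = _ := (hz j).symm
  rw [h2, ← Finset.mul_prod_erase _ _ (Finset.mem_univ j)]
  simp
  ring

end Field
end CMNorm

namespace CMNorm
open MeasureTheory Complex NumberField Filter Topology
open scoped Real BigOperators
set_option linter.unusedSectionVars false

section Recip
variable {F : Type*} [Field F] [NumberField F]

/-- the standard additive character -/
noncomputable def Etr (y : F) : ℂ := cexp (2 * π * I * ((Algebra.trace ℚ F y : ℚ) : ℂ))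

lemma Etr_add (x y : F) : Etr (x + y) = Etr x * Etr y := by
  simp only [Etr, map_add, ← Complex.exp_add]
  congr 1; push_cast; ring

lemma Etr_int (x : 𝓞 F) : Etr (x : F) = 1 := by
  rw [Etr, Complex.exp_eq_one_iff]
  refine ⟨Algebra.trace ℤ (𝓞 F) x, ?_⟩
  have := Algebra.trace_localization ℤ (Rₘ := ℚ) (Sₘ := F) (nonZeroDivisors ℤ) x
  rw [show ((x : F)) = algebraMap (𝓞 F) F x from rfl, this]
  simp; ring

/-- quadratic Gauss sum -/
noncomputable def Gsum (y : F) (𝔞 : Ideal (𝓞 F)) : ℂ := ∑ᶠ q : 𝓞 F ⧸ 𝔞, Etr (y * ((q.out : 𝓞 F) : F) ^ 2)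

variable [IsTotallyReal F]

noncomputable def uA (c a : F) (ε : ℝ) (v : InfinitePlace F) : ℂ :=
  (ε + I * (rv v a : ℝ)) / (2 * (rv v c : ℝ))
noncomputable def uB (c a : F) (ε : ℝ) (v : InfinitePlace F) : ℂ :=
  ((rv v a : ℝ) - I * ε) / (2 * ε * (rv v c : ℝ) * (rv v a : ℝ))

lemma uA_re (c a : F) (ε : ℝ) (v : InfinitePlace F) : (uA c a ε v).re = ε / (2 * rv v c) := by
  have : uA c a ε v = ((2 * rv v c : ℝ)⁻¹ : ℝ) * (ε + I * (rv v a : ℝ)) := by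
    rw [uA]; push_cast; rw [div_eq_inv_mul]
  rw [this, re_ofReal_mul]; simp [div_eq_inv_mul]

lemma uB_re {c a : F} (ha : a ≠ 0) (ε : ℝ) (v : InfinitePlace F) : (uB c a ε v).re = ε⁻¹ * (1 / (2 * rv v c)) := by
  have h0 : rv v a ≠ 0 := by simpa using ha
  have : uB c a ε v = ((2 * ε * rv v c * rv v a : ℝ)⁻¹ : ℝ) * ((rv v a : ℝ) - I * ε) := by
    rw [uB]; push_cast; rw [div_eq_inv_mul]
  rw [this, re_ofReal_mul]; simp
  field_simp

lemma inv_re_pos {z : ℂ} (hz : 0 < z.re) : 0 < (1 / z).re := by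
  rw [one_div, inv_re]
  have h2 := normSq_pos.2 (show z ≠ 0 by rintro rfl; simp at hz)
  positivity

lemma Gs_split {c a : F} (hc : ∀ v : InfinitePlace F, 0 < rv v c) (ha : a ≠ 0) {ε : ℝ} (hε : 0 < ε) (r m : F) :
    Gs (fun v => 1 / uA c a ε v) (r + a * m) =
     Etr (c * (r + a * m) ^ 2 / a) * Gs (fun v => 1 / uB c a ε v) (m + r / a) := by
  rw [Gs, Gs, Etr, ← Complex.exp_add]
  congr 1
  have h1 : ((Algebra.trace ℚ F (c * (r + a * m) ^ 2 / a) : ℚ) : ℂ) =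
     (((∑ v, rv v (c * (r + a * m) ^ 2 / a)) : ℝ) : ℂ) := by
    rw [← trace_eq]; simp
  rw [h1]
  push_cast
  rw [← Finset.sum_neg_distrib, ← Finset.sum_neg_distrib, Finset.mul_sum, ← Finset.sum_add_distrib]
  apply Finset.sum_congr rfl
  intro v _
  have ha0 : ((rv v a : ℝ) : ℂ) ≠ 0 := by exact_mod_cast (by simpa using ha : rv v a ≠ 0)
  have hc0 : ((rv v c : ℝ) : ℂ) ≠ 0 := by exact_mod_cast (hc v).ne'
  have he0 : (ε : ℂ) ≠ 0 := by exact_mod_cast hε.ne'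
  have hA : (ε : ℂ) + I * (rv v a : ℝ) ≠ 0 := by
    intro h; have := congrArg re h; simp at this; exact hε.ne' this
  have hB : ((rv v a : ℝ) : ℂ) - I * ε ≠ 0 := by
    intro h; have := congrArg im h; simp at this; exact hε.ne' this
  have hAB : ((rv v a : ℝ) : ℂ) - I * ε = -I * ((ε : ℂ) + I * (rv v a : ℝ)) := by
    ring_nf; rw [I_sq]; ring
  simp only [map_mul, map_div₀, map_add, map_pow]
  push_cast
  simp only [uA, uB]
  rw [hAB] at hB ⊢
  have hI : I ≠ 0 := I_ne_zero
  field_simp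
  generalize ((rv v a : ℝ) : ℂ) = A at *
  generalize ((rv v c : ℝ) : ℂ) = c at *
  generalize ((rv v r : ℝ) : ℂ) = r at *
  generalize ((rv v m : ℝ) : ℂ) = m at *
  have hI2 : I ^ 2 = -1 := I_sq
  linear_combination (-(r + A * m) ^ 2 * (ε + I * A)) * hI2


lemma del_ne_zero {k : Idx F → ℤ} (hk : k ≠ 0) : del F k ≠ 0 := by
  intro h
  apply hk
  obtain ⟨b, hb, h2⟩ := dual_lower (Beq F) (fun k v => rv v (del F k)) (dual_pairing F)
  have h3 := h2 k
  have h4 : (fun v => rv v (del F k)) = 0 := by ext v; simp [h]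
  rw [h4, norm_zero] at h3
  have h5 : ‖icast k‖ = 0 := by nlinarith [norm_nonneg (icast k)]
  rw [norm_eq_zero] at h5
  ext i
  have := congrFun h5 i
  simpa [icast] using this

lemma norm_Gs (w : InfinitePlace F → ℂ) (y : F) :
    ‖Gs w y‖ = Real.exp (-∑ v, π * (w v).re * (rv v y) ^ 2) := by
  have := norm_dgau (ι := Unit) (fun _ v => rv v y) w 0
  exact this

lemma limit_dual {c a : F} (hc : ∀ v : InfinitePlace F, 0 < rv v c) (ha : a ≠ 0)
    (e : ℝ → (Idx F → ℤ) → ℂ) (he : ∀ ε, 0 < ε → (∀ k, ‖e ε k‖ ≤ 1) ∧ e ε 0 = 1) :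
    Tendsto (fun ε : ℝ => ∑' k, e ε k * Gs (uB c a ε) (del F k)) (𝓝[>] 0) (𝓝 1) := by
  classical
  have h1 : ∑' k : Idx F → ℤ, (if k = 0 then (1:ℂ) else 0) = 1 := by simp
  rw [← h1]
  have hS : ∀ k, 0 ≤ ∑ v, π * (1 / (2 * rv v c)) * (rv v (del F k)) ^ 2 := fun k =>
    Finset.sum_nonneg (fun v _ => by have := hc v; positivity)
  have hn : ∀ (ε : ℝ) k, ‖Gs (uB c a ε) (del F k)‖ =
      Real.exp (-(ε⁻¹ * ∑ v, π * (1 / (2 * rv v c)) * (rv v (del F k)) ^ 2)) := by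
    intro ε k
    rw [norm_Gs]
    simp_rw [uB_re ha]
    rw [Finset.mul_sum]
    congr 2
    apply Finset.sum_congr rfl
    intro v _
    ring
  apply tendsto_tsum_of_dominated_convergence
    (bound := fun k => Real.exp (-(∑ v, π * (1 / (2 * rv v c)) * (rv v (del F k)) ^ 2)))
  · exact dual_summable (Beq F) (fun k v => rv v (del F k)) (dual_pairing F)
      (fun v => by have := hc v; positivity)
  · intro k
    split_ifs with hk
    · subst hk
      apply tendsto_const_nhds.congr'
      filter_upwards [self_mem_nhdsWithin] with ε hε
      rw [(he ε hε).2]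
      simp [Gs, del]
    · rw [tendsto_zero_iff_norm_tendsto_zero]
      have hpos : 0 < ∑ v, π * (1 / (2 * rv v c)) * (rv v (del F k)) ^ 2 := by
        have hne := del_ne_zero hk
        apply Finset.sum_pos
        · intro v _
          have := hc v
          have : rv v (del F k) ≠ 0 := by simpa using hne
          positivity
        · exact Finset.univ_nonempty
      apply squeeze_zero' (g := fun ε : ℝ => Real.exp (-(ε⁻¹ * ∑ v, π * (1 / (2 * rv v c)) * (rv v (del F k)) ^ 2)))
      · exact Eventually.of_forall (fun _ => norm_nonneg _)
      · filter_upwards [self_mem_nhdsWithin] with ε hε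
        rw [norm_mul, hn]
        exact mul_le_of_le_one_left (by positivity) ((he ε hε).1 k)
      · apply Real.tendsto_exp_neg_atTop_nhds_zero.comp
        exact tendsto_inv_nhdsGT_zero.atTop_mul_const hpos
  · have : ∀ᶠ ε : ℝ in 𝓝[>] 0, ε < 1 := by
      apply nhdsWithin_le_nhds
      exact Iio_mem_nhds one_pos
    filter_upwards [self_mem_nhdsWithin, this] with ε hε hε1 k
    rw [norm_mul, hn]
    refine (mul_le_of_le_one_left (by positivity) ((he ε hε).1 k)).trans ?_
    apply Real.exp_le_exp.2
    have hε' : (0:ℝ) < ε := hε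
    have h3 : 1 ≤ ε⁻¹ := (one_le_inv₀ hε').2 hε1.le
    nlinarith [hS k]

/-- decomposition of integers modulo `a` -/
lemma decomp_bij {a : 𝓞 F} (ha : a ≠ 0) :
    Function.Bijective (fun p : (𝓞 F ⧸ Ideal.span {a}) × 𝓞 F => p.1.out + a * p.2) := by
  constructor
  · rintro ⟨q, m⟩ ⟨q', m'⟩ h
    simp only at h
    have hq : q = q' := by
      rw [← Ideal.Quotient.mk_out q, ← Ideal.Quotient.mk_out q', Ideal.Quotient.eq, Ideal.mem_span_singleton]
      exact ⟨m' - m, by linear_combination h⟩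
    subst hq
    simp only [add_right_inj, mul_eq_mul_left_iff] at h
    simp [h.resolve_right ha]
  · intro x
    have : Ideal.Quotient.mk (Ideal.span {a}) x = Ideal.Quotient.mk _ (Ideal.Quotient.mk (Ideal.span {a}) x).out := by
      rw [Ideal.Quotient.mk_out]
    rw [Ideal.Quotient.eq, Ideal.mem_span_singleton] at this
    obtain ⟨m, hm⟩ := this
    exact ⟨⟨Ideal.Quotient.mk _ x, m⟩, by simp only; linear_combination -hm⟩

lemma sum_decomp {c a : 𝓞 F} (hc : ∀ v : InfinitePlace F, 0 < rv v (c : F)) (ha : a ≠ 0) {ε : ℝ} (hε : 0 < ε) :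
    ∑' x : 𝓞 F, Gs (fun v => 1 / uA (c : F) a ε v) (x + 0 : F) =
     ∑ᶠ q : 𝓞 F ⧸ Ideal.span {a}, Etr ((c : F) / a * ((q.out : 𝓞 F) : F) ^ 2) *
       ∑' m : 𝓞 F, Gs (fun v => 1 / uB (c : F) a ε v) (m + (q.out : 𝓞 F) / a : F) := by
  have : Finite (𝓞 F ⧸ Ideal.span {a}) := Ideal.finiteQuotientOfFreeOfNeBot _ (by simpa using ha)
  have := Fintype.ofFinite (𝓞 F ⧸ Ideal.span {a})
  have ha' : (a : F) ≠ 0 := by simpa using ha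
  have hs := Gs_summable F (w := fun v => 1 / uA (c : F) a ε v) (fun v => inv_re_pos (by
    rw [uA_re]; have := hc v; positivity)) 0
  rw [finsum_eq_sum_of_fintype, ← (Equiv.ofBijective _ (decomp_bij ha)).tsum_eq]
  rw [← (Equiv.ofBijective _ (decomp_bij ha)).summable_iff] at hs
  have hs' := hs.tsum_prod
  simp only [Function.comp_def] at hs'
  rw [hs', tsum_fintype]
  apply Finset.sum_congr rfl
  intro q _
  rw [← tsum_mul_left]
  apply tsum_congr
  intro m
  simp only [Equiv.ofBijective_apply, add_zero]
  push_cast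
  rw [Gs_split hc ha' hε]
  congr 1
  have : (c : F) * ((q.out : 𝓞 F) + a * m : F) ^ 2 / a =
     (c : F) / a * ((q.out : 𝓞 F) : F) ^ 2 + ((c * q.out * m + c * q.out * m + c * a * m ^ 2 : 𝓞 F) : F) := by
    push_cast
    field_simp
    ring
  rw [this, Etr_add, Etr_int, mul_one]


/-- ratio of square roots -/
noncomputable def Rr (c a : F) (ε : ℝ) : ℂ :=
  ∏ v, (uA c a ε v ^ (1 / 2 : ℂ) / uB c a ε v ^ (1 / 2 : ℂ))

lemma key_limit {c a : 𝓞 F} (hc : ∀ v : InfinitePlace F, 0 < rv v (c : F)) (ha : a ≠ 0) :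
    Tendsto (fun ε : ℝ => Rr (c : F) a ε * ∑' k, Gs (uA (c : F) a ε) (del F k)) (𝓝[>] 0)
      (𝓝 (Gsum ((c : F) / a) (Ideal.span {a}))) := by
  have : Finite (𝓞 F ⧸ Ideal.span {a}) := Ideal.finiteQuotientOfFreeOfNeBot _ (by simpa using ha)
  have := Fintype.ofFinite (𝓞 F ⧸ Ideal.span {a})
  have ha' : (a : F) ≠ 0 := by simpa using ha
  obtain ⟨C, hC, hth⟩ := theta F
  have hA : ∀ ε : ℝ, 0 < ε → ∀ v, 0 < (uA (c : F) a ε v).re := fun ε hε v => by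
    rw [uA_re]; have := hc v; positivity
  have hB : ∀ ε : ℝ, 0 < ε → ∀ v, 0 < (uB (c : F) a ε v).re := fun ε hε v => by
    rw [uB_re ha']; have := hc v; positivity
  have hthB : ∀ (q : 𝓞 F ⧸ Ideal.span {a}) (ε : ℝ), ∃ e : (Idx F → ℤ) → ℂ, 0 < ε →
     ((∀ k, ‖e k‖ ≤ 1) ∧ e 0 = 1 ∧ 
     ∑' x : 𝓞 F, Gs (fun v => 1 / uB (c : F) a ε v) (x + (q.out : 𝓞 F) / a) = 
      C * (∏ v, (uB (c : F) a ε v) ^ (1 / 2 : ℂ)) * ∑' k, e k * Gs (uB (c : F) a ε) (del F k)) := by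
    intro q ε
    by_cases hε : 0 < ε
    · obtain ⟨e, h1, h2, -, h3⟩ := hth (fun v => 1 / uB (c : F) a ε v)
        (fun v => inv_re_pos (hB ε hε v)) ((q.out : 𝓞 F) / a)
      refine ⟨e, fun _ => ⟨h1, h2, ?_⟩⟩
      rw [h3]
      simp only [one_div_one_div]
    · exact ⟨0, fun h => (hε h).elim⟩
  choose e he using hthB
  have hlim : Tendsto (fun ε : ℝ => ∑ q : 𝓞 F ⧸ Ideal.span {a}, Etr ((c : F) / a * ((q.out : 𝓞 F) : F) ^ 2) *
      ∑' k, e q ε k * Gs (uB (c : F) a ε) (del F k)) (𝓝[>] 0)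
      (𝓝 (∑ q : 𝓞 F ⧸ Ideal.span {a}, Etr ((c : F) / a * ((q.out : 𝓞 F) : F) ^ 2) * 1)) := by
    apply tendsto_finsetSum
    intro q _
    apply Tendsto.const_mul
    exact limit_dual hc ha' (e q) (fun ε hε => ⟨(he q ε hε).1, (he q ε hε).2.1⟩)
  rw [Gsum, finsum_eq_sum_of_fintype]
  simp only [mul_one] at hlim
  refine hlim.congr' ?_
  filter_upwards [self_mem_nhdsWithin] with ε hε
  have hε' : 0 < ε := hε
  obtain ⟨e0, -, -, h1, h2⟩ := hth (fun v => 1 / uA (c : F) a ε v)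
        (fun v => inv_re_pos (hA ε hε' v)) 0
  rw [sum_decomp hc ha hε', finsum_eq_sum_of_fintype] at h2
  simp only [one_div_one_div, h1 rfl, one_mul] at h2
  have hBne : (∏ v, (uB (c : F) a ε v) ^ (1 / 2 : ℂ)) ≠ 0 := by
    apply Finset.prod_ne_zero_iff.2
    intro v _
    have := hB ε hε' v
    intro h0
    rw [Complex.cpow_eq_zero_iff] at h0
    rw [h0.1] at this
    simp at this
  have h3 : (∑ q : 𝓞 F ⧸ Ideal.span {a}, Etr ((c : F) / a * ((q.out : 𝓞 F) : F) ^ 2) *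
      ∑' k, e q ε k * Gs (uB (c : F) a ε) (del F k)) * (C * (∏ v, (uB (c : F) a ε v) ^ (1 / 2 : ℂ))) =
      C * (∏ v, (uA (c : F) a ε v) ^ (1 / 2 : ℂ)) * ∑' k, Gs (uA (c : F) a ε) (del F k) := by
    have h2' := h2
    rw [← h2', Finset.sum_mul]
    apply Finset.sum_congr rfl
    intro q _
    rw [(he q ε hε').2.2]
    ring
  rw [Rr, Finset.prod_div_distrib]
  rw [div_mul_eq_mul_div, eq_div_iff hBne]
  apply mul_left_cancel₀ hC
  linear_combination h3

lemma cpow_pos_div {c : ℝ} (hc : 0 < c) {z : ℂ} (hz : z ≠ 0) :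
    (z / c) ^ (1 / 2 : ℂ) = z ^ (1 / 2 : ℂ) * ((c⁻¹ : ℝ) : ℂ) ^ (1 / 2 : ℂ) := by
  have h1 : z / c = ((c⁻¹ : ℝ) : ℂ) * z := by push_cast; field_simp
  have hc' : 0 < c⁻¹ := by positivity
  have hc'' : ((c⁻¹ : ℝ) : ℂ) ≠ 0 := by exact_mod_cast hc'.ne'
  rw [h1, cpow_def_of_ne_zero (mul_ne_zero hc'' hz), cpow_def_of_ne_zero hz, cpow_def_of_ne_zero hc'',
    log_ofReal_mul hc' hz, ← Complex.exp_add, ← ofReal_log hc'.le]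
  congr 1; ring

lemma sqrt_sq (z : ℂ) : z ^ (1 / 2 : ℂ) * z ^ (1 / 2 : ℂ) = z := by
  have := Complex.cpow_nat_inv_pow z (n := 2) (by norm_num)
  rw [sq] at this
  simpa using this

lemma Rr_mul {c a : F} (hc : ∀ v : InfinitePlace F, 0 < rv v c) (ha : a ≠ 0) {ε : ℝ} (hε : 0 < ε) :
    Rr 1 a ε * Rr c a ε = ∏ v, (I * ε * (rv v a : ℝ)) := by
  rw [Rr, Rr, ← Finset.prod_mul_distrib]
  apply Finset.prod_congr rfl
  intro v _
  have h1 : uA c a ε v = uA 1 a ε v / (rv v c : ℝ) := by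
    simp [uA]; field_simp
  have h2 : uB c a ε v = uB 1 a ε v / (rv v c : ℝ) := by
    simp [uB]; field_simp
  have hA : uA 1 a ε v ≠ 0 := by
    intro h; have := uA_re 1 a ε v; rw [h] at this; simp at this; linarith
  have hB : uB 1 a ε v ≠ 0 := by
    intro h; have := uB_re (c := 1) ha ε v; rw [h] at this; simp at this; exact hε.ne' this
  have hc2 : (((rv v c)⁻¹ : ℝ) : ℂ) ^ (1 / 2 : ℂ) ≠ 0 := by
    rw [Ne, Complex.cpow_eq_zero_iff]
    have := (hc v).ne'
    simp [this]
  have hB2 : uB 1 a ε v ^ (1 / 2 : ℂ) ≠ 0 := by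
    rw [Ne, Complex.cpow_eq_zero_iff]; simp [hB]
  rw [h1, h2, cpow_pos_div (hc v) hA, cpow_pos_div (hc v) hB, mul_div_mul_right _ _ hc2, div_mul_div_comm,
    sqrt_sq, sqrt_sq, div_eq_iff hB]
  have ha0 : ((rv v a : ℝ) : ℂ) ≠ 0 := by exact_mod_cast (by simpa using ha : rv v a ≠ 0)
  have he0 : (ε : ℂ) ≠ 0 := by exact_mod_cast hε.ne'
  simp only [uA, uB, map_one, ofReal_one]
  field_simp
  linear_combination (ε : ℂ) * I_sq

lemma Gs_congr {c a z : F} (hc : c ≠ 0) {t : 𝓞 F} (h : (a - 1) * z ^ 2 / (4 * c) = t) (ε : ℝ) :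
    Gs (uA c a ε) z = Gs (uA c 1 ε) z := by
  have h1 : Gs (uA c a ε) z = Gs (uA c 1 ε) z * Etr (-(t : F)) := by
    rw [Gs, Gs, Etr, ← Complex.exp_add]
    congr 1
    have h1 : ((Algebra.trace ℚ F (-(t : F)) : ℚ) : ℂ) = (((∑ v, rv v (-(t : F))) : ℝ) : ℂ) := by
      rw [← trace_eq]; simp
    rw [h1, ← h]
    push_cast
    rw [← Finset.sum_neg_distrib, ← Finset.sum_neg_distrib, Finset.mul_sum, ← Finset.sum_add_distrib]
    apply Finset.sum_congr rfl
    intro v _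
    have hc0 : ((rv v c : ℝ) : ℂ) ≠ 0 := by exact_mod_cast (by simpa using hc : rv v c ≠ 0)
    simp only [uA, map_neg, map_div₀, map_mul, map_sub, map_one, map_pow, map_ofNat]
    push_cast
    field_simp
    ring
  rw [h1, ← map_neg, Etr_int, mul_one]

lemma Gsum_one (y : 𝓞 F) : Gsum ((y : F) / (1 : 𝓞 F)) (Ideal.span {(1 : 𝓞 F)}) = 1 := by
  have : Unique (𝓞 F ⧸ Ideal.span {(1 : 𝓞 F)}) := by
    have : Subsingleton (𝓞 F ⧸ Ideal.span {(1 : 𝓞 F)}) := by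
      rw [Ideal.Quotient.subsingleton_iff]; simp
    exact uniqueOfSubsingleton 0
  have h11 : ((1 : 𝓞 F) : F) = 1 := by push_cast; rfl
  have key : ∀ q : 𝓞 F ⧸ Ideal.span {(1 : 𝓞 F)},
      Etr (((y : F) / (1 : 𝓞 F)) * ((q.out : 𝓞 F) : F) ^ 2) = 1 := by
    intro q
    rw [← Etr_int (y * (Quotient.out q) ^ 2)]
    congr 1
    rw [h11, div_one]
    push_cast
    rfl
  rw [Gsum, finsum_eq_sum_of_fintype, Fintype.sum_unique]
  exact key _

variable (F) in
theorem gauss_reciprocity : ∃ M : ℕ, 0 < M ∧ ∀ c a : 𝓞 F, (∀ v : InfinitePlace F, 0 < rv v (c : F)) →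
    a ≠ 0 → (4 * M ^ 2 * c) ∣ a - 1 →
    Gsum (1 / a : F) (Ideal.span {a}) * Gsum ((c : F) / a) (Ideal.span {a}) =
      ((Algebra.norm ℚ (a : F) : ℚ) : ℂ) := by
  obtain ⟨M, hM, hMz⟩ := exists_denom F
  refine ⟨M, hM, fun c a hc ha ⟨t, ht⟩ => ?_⟩
  have hM0 : (M : F) ≠ 0 := by exact_mod_cast hM.ne'
  have ha' : (a : F) ≠ 0 := by simpa using ha
  have hc0 : (c : F) ≠ 0 := by
    intro h
    obtain ⟨v⟩ : Nonempty (InfinitePlace F) := inferInstance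
    have := hc v
    simp [h] at this
  have h1pos : ∀ v : InfinitePlace F, 0 < rv v ((1 : 𝓞 F) : F) := fun v => by simp
  have ht' : (a : F) - 1 = 4 * M ^ 2 * c * t := by
    have := congrArg (fun x : 𝓞 F => (x : F)) ht
    push_cast at this
    exact this
  have h11 : ((1 : 𝓞 F) : F) = 1 := by push_cast; rfl
  have P : ∀ b : 𝓞 F, b ≠ 0 → Tendsto (fun ε : ℝ => (∏ v, (I * ε * (rv v (b : F) : ℝ))) *
      ((∑' k, Gs (uA 1 (b : F) ε) (del F k)) * (∑' k, Gs (uA (c : F) b ε) (del F k)))) (𝓝[>] 0)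
      (𝓝 (Gsum ((1 : 𝓞 F) / b : F) (Ideal.span {b}) * Gsum ((c : F) / b) (Ideal.span {b}))) := by
    intro b hb
    refine ((key_limit h1pos hb).mul (key_limit hc hb)).congr' ?_
    filter_upwards [self_mem_nhdsWithin] with ε hε
    rw [← Rr_mul hc (by simpa using hb) hε, h11]
    ring
  have Pa := P a ha
  have P1 := P 1 one_ne_zero
  rw [Gsum_one, Gsum_one] at P1
  have hS1 : ∀ (ε : ℝ) k, Gs (uA 1 (a : F) ε) (del F k) = Gs (uA 1 ((1 : 𝓞 F) : F) ε) (del F k) := by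
    intro ε k
    obtain ⟨z, hz⟩ := hMz k
    rw [h11]
    apply Gs_congr one_ne_zero (t := c * t * z ^ 2)
    have hz2 : ((z : 𝓞 F) : F) = (M : F) * del F k := hz.symm
    have e : ((c * t * z ^ 2 : 𝓞 F) : F) = (c : F) * t * (z : F) ^ 2 := rfl
    rw [e, hz2, ht']
    field_simp
  have hSc : ∀ (ε : ℝ) k, Gs (uA (c : F) (a : F) ε) (del F k) = Gs (uA (c : F) ((1 : 𝓞 F) : F) ε) (del F k) := by
    intro ε k
    obtain ⟨z, hz⟩ := hMz k
    rw [h11]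
    apply Gs_congr hc0 (t := t * z ^ 2)
    have hz2 : ((z : 𝓞 F) : F) = (M : F) * del F k := hz.symm
    have e : ((t * z ^ 2 : 𝓞 F) : F) = (t : F) * (z : F) ^ 2 := rfl
    rw [e, hz2, ht']
    field_simp
  simp_rw [hS1, hSc] at Pa
  have P2 := P1.const_mul ((Algebra.norm ℚ (a : F) : ℚ) : ℂ)
  have := tendsto_nhds_unique (Pa.congr ?_) P2
  · simpa using this
  · intro ε
    have hN : ((Algebra.norm ℚ (a : F) : ℚ) : ℂ) = ∏ v, ((rv v (a : F) : ℝ) : ℂ) := by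
      have := norm_eq (a : F)
      exact_mod_cast congrArg (fun x : ℝ => (x : ℂ)) this
    have hP : (∏ v, (I * ε * (rv v (a : F) : ℝ))) = (∏ v, ((rv v (a : F) : ℝ) : ℂ)) *
        ∏ v, (I * ε * (rv v ((1 : 𝓞 F) : F) : ℝ)) := by
      rw [← Finset.prod_mul_distrib]
      apply Finset.prod_congr rfl
      intro v _
      rw [h11, map_one]; push_cast; ring
    rw [hN, hP, mul_assoc]

end Recip
end CMNorm

namespace CMNorm
open MeasureTheory Complex NumberField Filter Topology
open scoped Real BigOperators
set_option linter.unusedSectionVars false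

section LocalGauss
variable {R : Type*} [CommRing R] [IsDedekindDomain R] [Module.Free ℤ R] [Module.Finite ℤ R]

lemma finq {𝔞 : Ideal R} (h : 𝔞 ≠ ⊥) : Finite (R ⧸ 𝔞) := 𝔞.finiteQuotientOfFreeOfNeBot h

/-- sum over residues -/
noncomputable def SS (𝔞 : Ideal R) (g : R → ℂ) : ℂ := ∑ᶠ q : R ⧸ 𝔞, g q.out

/-- quadratic Gauss sum -/
noncomputable def GG (e : AddChar R ℂ) (𝔞 : Ideal R) : ℂ := SS 𝔞 (fun x => e (x ^ 2))

lemma mk_out {𝔞 : Ideal R} (q : R ⧸ 𝔞) : Ideal.Quotient.mk 𝔞 q.out = q := Quotient.out_eq' q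

lemma out_sub_mem {𝔞 : Ideal R} (x : R) : x - (Ideal.Quotient.mk 𝔞 x).out ∈ 𝔞 := by
  rw [← Ideal.Quotient.eq, mk_out]

lemma SS_bij {ι : Type*} [Fintype ι] {𝔞 : Ideal R} {g : R → ℂ} (hg : ∀ x y, x - y ∈ 𝔞 → g x = g y)
    {φ : ι → R} (hφ : Function.Bijective (fun i => Ideal.Quotient.mk 𝔞 (φ i))) :
    SS 𝔞 g = ∑ i, g (φ i) := by
  have : Fintype (R ⧸ 𝔞) := Fintype.ofBijective _ hφ
  rw [SS, finsum_eq_sum_of_fintype]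
  refine (Fintype.sum_bijective _ hφ _ _ fun i => ?_).symm
  exact hg _ _ (out_sub_mem _)

lemma mem_of_gen {𝔞 𝔭 𝔠 : Ideal R} (hc : 𝔠 ≠ ⊥) (ha : 𝔞 = 𝔭 * 𝔠) {γ : R} (hγ : 𝔞 ⊔ Ideal.span {γ} = 𝔠)
    (w : R) : γ * w ∈ 𝔞 ↔ w ∈ 𝔭 := by
  constructor
  · intro h
    have h1 : Ideal.span {w} * 𝔠 ≤ 𝔭 * 𝔠 := by
      rw [← ha, ← hγ, Ideal.mul_sup, sup_le_iff]
      refine ⟨Ideal.mul_le_right, ?_⟩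
      rw [Ideal.span_singleton_mul_span_singleton, Ideal.span_singleton_le_iff_mem, mul_comm]
      exact h
    have h2 : Ideal.span {w} ≤ 𝔭 := by
      rw [mul_comm _ 𝔠, mul_comm _ 𝔠] at h1
      exact Ideal.dvd_iff_le.mp ((mul_dvd_mul_iff_left (by simpa using hc)).mp (Ideal.dvd_iff_le.mpr h1))
    exact h2 (Ideal.mem_span_singleton_self w)
  · intro h
    rw [ha, mul_comm γ]
    refine Ideal.mul_mem_mul h ?_
    rw [← hγ]
    exact Ideal.mem_sup_right (Ideal.mem_span_singleton_self γ)

lemma decomp {𝔞 𝔭 𝔠 : Ideal R} (hc : 𝔠 ≠ ⊥) (ha : 𝔞 = 𝔭 * 𝔠) {γ : R} (hγ : 𝔞 ⊔ Ideal.span {γ} = 𝔠)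
    {s : R ⧸ 𝔠 → R} (hs : ∀ q, Ideal.Quotient.mk 𝔠 (s q) = q) :
    Function.Bijective (fun i : (R ⧸ 𝔠) × (R ⧸ 𝔭) => Ideal.Quotient.mk 𝔞 (s i.1 + γ * i.2.out)) := by
  have hac : 𝔞 ≤ 𝔠 := by rw [ha]; exact Ideal.mul_le_right
  have hγc : γ ∈ 𝔠 := by rw [← hγ]; exact Ideal.mem_sup_right (Ideal.mem_span_singleton_self γ)
  constructor
  · rintro ⟨w, v⟩ ⟨w', v'⟩ h
    simp only at h
    rw [Ideal.Quotient.eq] at h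
    have hw : w = w' := by
      rw [← hs w, ← hs w', Ideal.Quotient.eq]
      have h2 := 𝔠.sub_mem (hac h) (𝔠.mul_mem_right (v.out - v'.out) hγc)
      convert h2 using 1
      ring
    subst hw
    have hv : v.out - v'.out ∈ 𝔭 := by
      rw [← mem_of_gen hc ha hγ]
      convert h using 1; ring
    rw [← Ideal.Quotient.eq, mk_out, mk_out] at hv
    rw [hv]
  · intro q
    obtain ⟨x, rfl⟩ := Ideal.Quotient.mk_surjective q
    have h1 : x - s (Ideal.Quotient.mk 𝔠 x) ∈ 𝔠 := by rw [← Ideal.Quotient.eq, hs]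
    have h1 := hγ.ge h1
    obtain ⟨y, hy, z, hz, hyz⟩ := Submodule.mem_sup.mp h1
    obtain ⟨t, rfl⟩ := Ideal.mem_span_singleton'.mp hz
    refine ⟨(Ideal.Quotient.mk 𝔠 x, Ideal.Quotient.mk 𝔭 t), ?_⟩
    simp only
    rw [Ideal.Quotient.eq]
    have h3 := (mem_of_gen hc ha hγ _).mpr (out_sub_mem (𝔞 := 𝔭) t)
    have : s (Ideal.Quotient.mk 𝔠 x) + γ * (Ideal.Quotient.mk 𝔭 t).out - x
      = - (γ * (t - (Ideal.Quotient.mk 𝔭 t).out)) - y := by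
      linear_combination hyz
    rw [this]
    exact 𝔞.sub_mem (𝔞.neg_mem h3) hy

/-- exact conductor -/
def Cond (e : AddChar R ℂ) (𝔞 : Ideal R) : Prop := ∀ x, (∀ r, e (r * x) = 1) ↔ x ∈ 𝔞

lemma Cond.one {e : AddChar R ℂ} {𝔞 : Ideal R} (h : Cond e 𝔞) {x : R} (hx : x ∈ 𝔞) : e x = 1 := by
  have := (h x).mpr hx 1
  rwa [one_mul] at this

lemma Cond.congr {e : AddChar R ℂ} {𝔞 : Ideal R} (h : Cond e 𝔞) {x y : R} (hx : x - y ∈ 𝔞) : e x = e y := by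
  have := h.one hx
  rw [show x = (x - y) + y by ring, AddChar.map_add_eq_mul, this, one_mul]

lemma Cond.shift {e : AddChar R ℂ} {𝔞 𝔟 : Ideal R} (h : Cond e 𝔞) {u : R} (hu : ∀ x, u * x ∈ 𝔞 ↔ x ∈ 𝔟) :
    Cond (e.mulShift u) 𝔟 := by
  intro x
  rw [← hu, ← h]
  simp only [AddChar.mulShift_apply]
  constructor
  · intro H r
    rw [mul_left_comm]; exact H r
  · intro H r
    rw [mul_left_comm]; exact H r

lemma Cond.sq {e : AddChar R ℂ} {𝔞 : Ideal R} (h : Cond e 𝔞) (x y : R) (hx : x - y ∈ 𝔞) :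
    e (x ^ 2) = e (y ^ 2) := by
  apply h.congr
  rw [show x ^ 2 - y ^ 2 = (x - y) * (x + y) by ring]
  exact 𝔞.mul_mem_right _ hx

open Classical in
/-- sum of an additive character over a quotient -/
lemma sum_addChar {𝔭 : Ideal R} [Fintype (R ⧸ 𝔭)] (f : AddChar R ℂ) (hf : ∀ x ∈ 𝔭, f x = 1) :
    (∑ q : R ⧸ 𝔭, f q.out) = if (∀ x, f x = 1) then (Fintype.card (R ⧸ 𝔭) : ℂ) else 0 := by
  split_ifs with h
  · simp [h]
  · push Not at h
    obtain ⟨y, hy⟩ := h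
    have hper : ∀ x z, x - z ∈ 𝔭 → f x = f z := by
      intro x z hxz
      rw [show x = (x - z) + z by ring, AddChar.map_add_eq_mul, hf _ hxz, one_mul]
    have h1 : (∑ q : R ⧸ 𝔭, f q.out) = f y * ∑ q : R ⧸ 𝔭, f q.out := by
      rw [Finset.mul_sum]
      refine Fintype.sum_bijective (fun q => q - Ideal.Quotient.mk 𝔭 y)
        (Equiv.subRight (Ideal.Quotient.mk 𝔭 y)).bijective _ _ fun q => ?_
      rw [← AddChar.map_add_eq_mul]
      apply hper
      rw [← Ideal.Quotient.eq, map_add, mk_out, mk_out]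
      ring
    have h2 : (1 - f y) * (∑ q : R ⧸ 𝔭, f q.out) = 0 := by linear_combination h1
    rcases mul_eq_zero.mp h2 with h3 | h3
    · exact absurd (by linear_combination -h3) hy
    · exact h3

/-- square step -/
lemma GG_sq {e : AddChar R ℂ} {𝔞 𝔭 𝔟 : Ideal R} (hp : 𝔭 ≠ ⊥) (hb : 𝔟 ≠ ⊥) (ha : 𝔞 = 𝔭 * (𝔟 * 𝔭))
    (h2 : ∀ x, 2 * x ∈ 𝔭 → x ∈ 𝔭)
    (h : Cond e 𝔞) {ϖ : R} (hϖ : 𝔟 * 𝔭 ⊔ Ideal.span {ϖ} = 𝔭) :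
    GG e 𝔞 = Nat.card (R ⧸ 𝔭) * GG (e.mulShift (ϖ ^ 2)) 𝔟 := by
  classical
  have hc : 𝔟 * 𝔭 ≠ ⊥ := mul_ne_zero hb hp
  have ha0 : 𝔞 ≠ ⊥ := by rw [ha]; exact mul_ne_zero hp hc
  have := finq hc
  have := finq hp
  have := finq hb
  have := Fintype.ofFinite (R ⧸ 𝔟 * 𝔭)
  have := Fintype.ofFinite (R ⧸ 𝔭)
  have := Fintype.ofFinite (R ⧸ 𝔟)
  obtain ⟨γ, hγ⟩ := IsDedekindDomain.exists_sup_span_eq (I := 𝔞) (J := 𝔟 * 𝔭)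
    (by rw [ha]; exact Ideal.mul_le_right) ha0
  have hγc : γ ∈ 𝔟 * 𝔭 := by rw [← hγ]; exact Ideal.mem_sup_right (Ideal.mem_span_singleton_self γ)
  have hcp : 𝔟 * 𝔭 ≤ 𝔭 := Ideal.mul_le_right
  have hϖp : ϖ ∈ 𝔭 := by rw [← hϖ]; exact Ideal.mem_sup_right (Ideal.mem_span_singleton_self ϖ)
  -- step 1
  have step1 : GG e 𝔞 = Nat.card (R ⧸ 𝔭) * SS (𝔟 * 𝔭) (fun w => if w ∈ 𝔭 then e (w ^ 2) else 0) := by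
    rw [GG, SS_bij h.sq (decomp hc ha hγ mk_out), Fintype.sum_prod_type, SS, finsum_eq_sum_of_fintype,
      Finset.mul_sum]
    apply Finset.sum_congr rfl
    intro w _
    have e1 : ∀ v : R ⧸ 𝔭, e ((w.out + γ * v.out) ^ 2) = e (w.out ^ 2) * (e.mulShift (2 * γ * w.out)) v.out := by
      intro v
      rw [AddChar.mulShift_apply, ← AddChar.map_add_eq_mul]
      apply h.congr
      rw [show (w.out + γ * v.out) ^ 2 - (w.out ^ 2 + 2 * γ * w.out * v.out) = (γ * γ) * v.out ^ 2 by ring]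
      apply Ideal.mul_mem_right
      rw [ha]
      exact Ideal.mul_mem_mul (hcp hγc) hγc
    simp only [e1]
    rw [← Finset.mul_sum, sum_addChar]
    · have hiff : (∀ x, (e.mulShift (2 * γ * w.out)) x = 1) ↔ w.out ∈ 𝔭 := by
        simp only [AddChar.mulShift_apply]
        have := h (2 * γ * w.out)
        simp only [mul_comm _ (2 * γ * w.out)] at this
        rw [this, show 2 * γ * w.out = γ * (2 * w.out) by ring, mem_of_gen hc ha hγ]
        exact ⟨h2 _, fun h => Ideal.mul_mem_left _ _ h⟩
      simp only [hiff, Nat.card_eq_fintype_card]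
      split_ifs
      · rw [mul_comm]
      · simp
    · intro x hx
      rw [AddChar.mulShift_apply]
      apply h.one
      rw [show 2 * γ * w.out * x = x * γ * (2 * w.out) by ring, ha]
      exact Ideal.mul_mem_right _ _ (Ideal.mul_mem_mul hx hγc)
  rw [step1]
  congr 1
  have hs : ∀ q : R ⧸ 𝔭, Ideal.Quotient.mk 𝔭 (if q = 0 then 0 else q.out) = q := by
    intro q
    split_ifs with h
    · rw [h, map_zero]
    · exact mk_out q
  rw [SS_bij _ (decomp hp rfl hϖ hs), Fintype.sum_prod_type, Finset.sum_eq_single 0, GG, SS,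
    finsum_eq_sum_of_fintype]
  · apply Finset.sum_congr rfl
    intro u _
    simp only [if_true, zero_add]
    rw [if_pos (Ideal.mul_mem_right _ _ hϖp), mul_pow, AddChar.mulShift_apply]
  · intro q _ hq
    apply Finset.sum_eq_zero
    intro u _
    rw [if_neg]
    simp only [if_neg hq]
    rw [Ideal.add_mem_iff_left _ (Ideal.mul_mem_right _ _ hϖp), ← Ideal.Quotient.eq_zero_iff_mem, mk_out]
    exact hq
  · simp
  · intro x y hxy
    have hxyp := hcp hxy
    have hiff : x ∈ 𝔭 ↔ y ∈ 𝔭 := by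
      rw [show x = (x - y) + y by ring]
      exact Ideal.add_mem_iff_right _ hxyp
    rw [hiff]
    split_ifs with hy
    · apply h.congr
      rw [show x ^ 2 - y ^ 2 = (x + y) * (x - y) by ring, ha]
      exact Ideal.mul_mem_mul (𝔭.add_mem (hiff.mpr hy) hy) hxy
    · rfl

lemma Cond_sq {e : AddChar R ℂ} {𝔞 𝔭 𝔟 : Ideal R} (hp : 𝔭 ≠ ⊥) (ha : 𝔞 = 𝔭 * (𝔟 * 𝔭))
    (h : Cond e 𝔞) {ϖ : R} (hϖ : 𝔟 * 𝔭 ⊔ Ideal.span {ϖ} = 𝔭) : Cond (e.mulShift (ϖ ^ 2)) 𝔟 := by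
  apply h.shift
  intro x
  have hϖp : ϖ ∈ 𝔭 := by rw [← hϖ]; exact Ideal.mem_sup_right (Ideal.mem_span_singleton_self ϖ)
  constructor
  · intro hx
    have h1 : ∀ z ∈ 𝔭, x * ϖ * z ∈ 𝔞 := by
      intro z hz
      obtain ⟨y, hy, z', hz', rfl⟩ := Submodule.mem_sup.mp (hϖ.ge hz)
      obtain ⟨t, rfl⟩ := Ideal.mem_span_singleton'.mp hz'
      rw [show x * ϖ * (y + t * ϖ) = x * (ϖ * y) + t * (ϖ ^ 2 * x) by ring]
      refine 𝔞.add_mem ?_ (𝔞.mul_mem_left _ hx)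
      apply 𝔞.mul_mem_left
      rw [ha]
      exact Ideal.mul_mem_mul hϖp hy
    have h2 : x * ϖ ∈ 𝔟 * 𝔭 := by
      have : Ideal.span {x * ϖ} * 𝔭 ≤ (𝔟 * 𝔭) * 𝔭 := by
        rw [Ideal.span_singleton_mul_le_iff]
        intro z hz
        rw [mul_comm _ 𝔭, ← ha]
        exact h1 z hz
      rw [mul_comm _ 𝔭, mul_comm _ 𝔭] at this
      have := Ideal.dvd_iff_le.mp ((mul_dvd_mul_iff_left (by simpa using hp)).mp (Ideal.dvd_iff_le.mpr this))
      exact this (Ideal.mem_span_singleton_self _)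
    rw [mul_comm x] at h2
    exact (mem_of_gen hp rfl hϖ x).mp h2
  · intro hx
    rw [ha, show ϖ ^ 2 * x = ϖ * (x * ϖ) by ring]
    exact Ideal.mul_mem_mul hϖp (Ideal.mul_mem_mul hx hϖp)

/-- coprime step -/
lemma coprime_mem {𝔭 𝔟 : Ideal R} {f g : R} (hf : f ∈ 𝔟) (hg : g ∈ 𝔭) (hfg : f + g = 1) (x : R) :
    f ^ 2 * x ∈ 𝔭 * 𝔟 ↔ x ∈ 𝔭 := by
  constructor
  · intro h
    have h1 : f ^ 2 * x ∈ 𝔭 := Ideal.mul_le_left h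
    have : x = f ^ 2 * x + g * ((1 + f) * x) := by
      have : g = 1 - f := by linear_combination hfg
      rw [this]; ring
    rw [this]
    exact 𝔭.add_mem h1 (𝔭.mul_mem_right _ hg)
  · intro h
    rw [show f ^ 2 * x = x * f * f by ring]
    exact Ideal.mul_mem_right _ _ (Ideal.mul_mem_mul h hf)

lemma GG_coprime {e : AddChar R ℂ} {𝔭 𝔟 : Ideal R} (hp : 𝔭 ≠ ⊥) (hb : 𝔟 ≠ ⊥)
    (h : Cond e (𝔭 * 𝔟)) {f g : R} (hf : f ∈ 𝔟) (hg : g ∈ 𝔭) (hfg : f + g = 1) :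
    GG e (𝔭 * 𝔟) = GG (e.mulShift (f ^ 2)) 𝔭 * GG (e.mulShift (g ^ 2)) 𝔟 := by
  have := finq hp
  have := finq hb
  have := Fintype.ofFinite (R ⧸ 𝔭)
  have := Fintype.ofFinite (R ⧸ 𝔟)
  have hbij : Function.Bijective (fun i : (R ⧸ 𝔭) × (R ⧸ 𝔟) =>
      Ideal.Quotient.mk (𝔭 * 𝔟) (f * i.1.out + g * i.2.out)) := by
    have hinf : 𝔭 * 𝔟 = 𝔭 ⊓ 𝔟 := by
      apply Ideal.mul_eq_inf_of_isCoprime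
      rw [Ideal.isCoprime_iff_exists]
      exact ⟨g, hg, f, hf, by rw [add_comm]; exact hfg⟩
    constructor
    · rintro ⟨u, v⟩ ⟨u', v'⟩ H
      simp only at H
      rw [Ideal.Quotient.eq, hinf] at H
      have h1 : u.out - u'.out ∈ 𝔭 := by
        have := 𝔭.add_mem H.1 (𝔭.mul_mem_right ((u.out - u'.out) - (v.out - v'.out)) hg)
        convert this using 1
        linear_combination - (u.out - u'.out) * hfg
      have h2 : v.out - v'.out ∈ 𝔟 := by
        have := 𝔟.add_mem H.2 (𝔟.mul_mem_right ((v.out - v'.out) - (u.out - u'.out)) hf)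
        convert this using 1
        linear_combination - (v.out - v'.out) * hfg
      rw [← Ideal.Quotient.eq, mk_out, mk_out] at h1 h2
      rw [h1, h2]
    · intro q
      obtain ⟨x, rfl⟩ := Ideal.Quotient.mk_surjective q
      refine ⟨(Ideal.Quotient.mk 𝔭 x, Ideal.Quotient.mk 𝔟 x), ?_⟩
      simp only
      rw [eq_comm, Ideal.Quotient.eq]
      have h1 := Ideal.mul_mem_mul (out_sub_mem (𝔞 := 𝔭) x) hf
      have h2 := Ideal.mul_mem_mul hg (out_sub_mem (𝔞 := 𝔟) x)
      convert (𝔭 * 𝔟).add_mem h1 h2 using 1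
      linear_combination - x * hfg
  rw [GG, SS_bij h.sq hbij, GG, GG, SS, SS, finsum_eq_sum_of_fintype, finsum_eq_sum_of_fintype,
    Finset.sum_mul_sum, Fintype.sum_prod_type]
  apply Finset.sum_congr rfl
  intro u _
  apply Finset.sum_congr rfl
  intro v _
  rw [AddChar.mulShift_apply, AddChar.mulShift_apply, ← AddChar.map_add_eq_mul]
  apply h.congr
  rw [show (f * u.out + g * v.out) ^ 2 - (f ^ 2 * u.out ^ 2 + g ^ 2 * v.out ^ 2) = g * f * (2 * u.out * v.out) by ring]
  exact Ideal.mul_mem_right _ _ (Ideal.mul_mem_mul hg hf)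

/-- the local symbol -/
noncomputable def sym (d : R) (𝔭 : Ideal R) : ℂ := by
  classical exact if ∃ r, r ^ 2 - d ∈ 𝔭 then 1 else -1

/-- prime step -/
lemma GG_prime {e : AddChar R ℂ} {𝔭 : Ideal R} [hm : 𝔭.IsMaximal] (hp : 𝔭 ≠ ⊥) (h2 : (2 : R) ∉ 𝔭)
    {c : R} (hc : c ∉ 𝔭) (h : Cond e 𝔭) :
    GG e 𝔭 * GG (e.mulShift c) 𝔭 = sym (-c) 𝔭 * Nat.card (R ⧸ 𝔭) := by
  classical
  let k := R ⧸ 𝔭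
  let _ : Field k := Ideal.Quotient.field 𝔭
  have := finq hp
  let _ : Fintype k := Fintype.ofFinite (R ⧸ 𝔭)
  have hchar : ringChar k ≠ 2 := by
    intro hh
    apply h2
    rw [← Ideal.Quotient.eq_zero_iff_mem]
    have : ((2 : ℕ) : k) = 0 := by rw [ringChar.spec, hh]
    exact_mod_cast this
  let E : AddChar k ℂ :=
    { toFun := fun q => e q.out
      map_zero_eq_one' := by
        apply h.one
        rw [← Ideal.Quotient.eq_zero_iff_mem]; exact mk_out _
      map_add_eq_mul' := by
        intro a b
        rw [← AddChar.map_add_eq_mul]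
        apply h.congr
        rw [← Ideal.Quotient.eq, map_add]
        erw [mk_out, mk_out, mk_out] }
  have hE : ∀ x : R, E (Ideal.Quotient.mk 𝔭 x) = e x := by
    intro x
    exact (h.congr (out_sub_mem x)).symm
  have hprim : E.IsPrimitive := by
    apply AddChar.IsPrimitive.of_ne_one
    intro H
    have : (1 : R) ∈ 𝔭 := by
      rw [← h]
      intro r
      rw [← hE, H]; rfl
    exact hm.ne_top (Ideal.eq_top_iff_one _ |>.mpr this)
  let χ : MulChar k ℂ := (quadraticChar k).ringHomComp (Int.castRingHom ℂ)
  have hχ1 : χ ≠ 1 := by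
    obtain ⟨a, ha⟩ := quadraticChar_exists_neg_one' hchar
    intro H
    have h3 := congrArg (fun f : MulChar k ℂ => f (a : k)) H
    simp only [χ, MulChar.ringHomComp_apply, ha, MulChar.one_apply_coe] at h3
    norm_num at h3
  have hχ2 : χ.IsQuadratic := by
    intro a
    rcases quadraticChar_isQuadratic k a with h | h | h <;> simp [χ, MulChar.ringHomComp_apply, h]
  have key : ∀ f : AddChar k ℂ, f ≠ 0 → (∑ x : k, f (x ^ 2)) = gaussSum χ f := by
    intro f hf
    rw [gaussSum]
    have h1 : (∑ x : k, f (x ^ 2)) = ∑ t : k, ((χ t + 1) * f t) := by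
      rw [← Finset.sum_fiberwise Finset.univ (fun x : k => x ^ 2)]
      apply Finset.sum_congr rfl
      intro t _
      rw [Finset.sum_congr rfl (g := fun _ => f t)]
      · rw [Finset.sum_const, nsmul_eq_mul]
        congr 1
        have := quadraticChar_card_sqrts hchar t
        have h4 := congrArg (fun z : ℤ => (z : ℂ)) this
        simp only [χ, MulChar.ringHomComp_apply]
        push_cast at h4 ⊢
        refine Eq.trans ?_ h4
        congr 2
        ext; simp
      · intro x hx
        rw [(Finset.mem_filter.mp hx).2]
    rw [h1]
    simp only [add_mul, one_mul, Finset.sum_add_distrib]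
    rw [AddChar.sum_eq_zero_iff_ne_zero.mpr hf, add_zero]
  have hG1 : GG e 𝔭 = gaussSum χ E := by
    rw [← key, GG, SS, finsum_eq_sum_of_fintype]
    · apply Finset.sum_congr rfl
      intro q _
      rw [← hE, map_pow, mk_out]
    · intro H
      exact hprim one_ne_zero (by rw [AddChar.mulShift_one]; exact H)
  have hcu : (Ideal.Quotient.mk 𝔭 c : k) ≠ 0 := by
    rw [Ne, Ideal.Quotient.eq_zero_iff_mem]; exact hc
  have hG2 : GG (e.mulShift c) 𝔭 = gaussSum χ (E.mulShift (Ideal.Quotient.mk 𝔭 c)) := by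
    rw [← key, GG, SS, finsum_eq_sum_of_fintype]
    · apply Finset.sum_congr rfl
      intro q _
      rw [AddChar.mulShift_apply, AddChar.mulShift_apply, ← hE, map_mul, map_pow, mk_out]
    · exact hprim hcu
  have hshift := gaussSum_mulShift χ E (Units.mk0 (Ideal.Quotient.mk 𝔭 c : k) hcu)
  have hsq := gaussSum_sq hχ1 hχ2 hprim
  have hcc : χ (Ideal.Quotient.mk 𝔭 c) * χ (Ideal.Quotient.mk 𝔭 c) = 1 := by
    rw [← map_mul, ← pow_two]
    simp only [χ, MulChar.ringHomComp_apply]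
    rw [quadraticChar_sq_one' hcu]; simp
  rw [hG1, hG2]
  have h5 : gaussSum χ (E.mulShift (Ideal.Quotient.mk 𝔭 c)) = χ (Ideal.Quotient.mk 𝔭 c) * gaussSum χ E := by
    rw [← hshift]
    rw [← mul_assoc]
    erw [hcc]
    rw [one_mul]; rfl
  rw [h5, show gaussSum χ E * (χ (Ideal.Quotient.mk 𝔭 c) * gaussSum χ E) =
    χ (Ideal.Quotient.mk 𝔭 c) * gaussSum χ E ^ 2 by ring, hsq, ← mul_assoc, ← map_mul, Nat.card_eq_fintype_card]
  congr 1
  have h6 : (Ideal.Quotient.mk 𝔭 c : k) * -1 = Ideal.Quotient.mk 𝔭 (-c) := by simp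
  have h7 : (Ideal.Quotient.mk 𝔭 (-c) : k) ≠ 0 := by simpa using hcu
  rw [h6]
  simp only [χ, MulChar.ringHomComp_apply, quadraticChar_apply, quadraticCharFun, h7, if_false]
  rw [sym]
  have hiff : IsSquare (Ideal.Quotient.mk 𝔭 (-c) : k) ↔ ∃ r, r ^ 2 - (-c) ∈ 𝔭 := by
    constructor
    · rintro ⟨z, hz⟩
      obtain ⟨r, rfl⟩ := Ideal.Quotient.mk_surjective z
      refine ⟨r, ?_⟩
      rw [← Ideal.Quotient.eq, map_pow, hz, pow_two]
    · rintro ⟨r, hr⟩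
      refine ⟨Ideal.Quotient.mk 𝔭 r, ?_⟩
      rw [← Ideal.Quotient.eq] at hr
      rw [← hr, map_pow, pow_two]
  by_cases hh : IsSquare (Ideal.Quotient.mk 𝔭 (-c) : k)
  · rw [if_pos hh, if_pos (hiff.mp hh)]; simp
  · rw [if_neg hh, if_neg (fun H => hh (hiff.mpr H))]; simp

open UniqueFactorizationMonoid in
/-- quadratic character on ideals, zero at primes containing `N` -/
noncomputable def psi (N d : R) : Ideal R →*₀ ℂ := by
  classical exact
  { toFun := fun 𝔞 => if 𝔞 = 0 then 0 else
      ((normalizedFactors 𝔞).map (fun 𝔭 => if N ∈ 𝔭 then 0 else sym d 𝔭)).prod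
    map_zero' := if_pos rfl
    map_one' := by rw [if_neg one_ne_zero, normalizedFactors_one]; simp
    map_mul' := by
      intro 𝔞 𝔟
      by_cases ha : 𝔞 = 0
      · simp [ha]
      by_cases hb : 𝔟 = 0
      · simp [hb]
      simp only [if_neg ha, if_neg hb, if_neg (mul_ne_zero ha hb)]
      rw [normalizedFactors_mul ha hb, Multiset.map_add, Multiset.prod_add] }

lemma psi_prime (N d : R) {𝔭 : Ideal R} [hm : 𝔭.IsMaximal] (hp : 𝔭 ≠ ⊥) (hN : N ∉ 𝔭) :
    psi N d 𝔭 = sym d 𝔭 := by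
  classical
  have hirr : Irreducible 𝔭 := (Ideal.prime_of_isPrime hp hm.isPrime).irreducible
  have : psi N d 𝔭 = if 𝔭 = 0 then 0 else
      ((UniqueFactorizationMonoid.normalizedFactors 𝔭).map (fun 𝔭 => if N ∈ 𝔭 then 0 else sym d 𝔭)).prod := by
    simp only [psi]; rfl
  rw [this, if_neg (show 𝔭 ≠ 0 from hp), UniqueFactorizationMonoid.normalizedFactors_irreducible hirr]
  simp [hN]

lemma psi_bad (N d : R) {𝔭 : Ideal R} [hm : 𝔭.IsMaximal] (hp : 𝔭 ≠ ⊥) (hN : N ∈ 𝔭) :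
    psi N d 𝔭 = 0 := by
  classical
  have hirr : Irreducible 𝔭 := (Ideal.prime_of_isPrime hp hm.isPrime).irreducible
  have : psi N d 𝔭 = if 𝔭 = 0 then 0 else
      ((UniqueFactorizationMonoid.normalizedFactors 𝔭).map (fun 𝔭 => if N ∈ 𝔭 then 0 else sym d 𝔭)).prod := by
    simp only [psi]; rfl
  rw [this, if_neg (show 𝔭 ≠ 0 from hp), UniqueFactorizationMonoid.normalizedFactors_irreducible hirr]
  simp [hN]

lemma sym_sq (d : R) (𝔭 : Ideal R) : sym d 𝔭 * sym d 𝔭 = 1 := by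
  rw [sym]; split_ifs <;> norm_num

lemma mulShift_comm' (e : AddChar R ℂ) (a b : R) : (e.mulShift a).mulShift b = (e.mulShift b).mulShift a := by
  ext x
  simp only [AddChar.mulShift_apply]
  congr 1; ring

lemma card_mul (𝔞 𝔟 : Ideal R) : Nat.card (R ⧸ 𝔞 * 𝔟) = Nat.card (R ⧸ 𝔞) * Nat.card (R ⧸ 𝔟) := by
  have := Ideal.absNorm.map_mul 𝔞 𝔟
  exact this

theorem GG_main {c N : R} (hcN : 2 * c ∣ N) (𝔞 : Ideal R) (ha0 : 𝔞 ≠ ⊥) (hN : ∃ t, N * t - 1 ∈ 𝔞)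
    (e : AddChar R ℂ) (he : Cond e 𝔞) :
    GG e 𝔞 * GG (e.mulShift c) 𝔞 = psi N (-c) 𝔞 * Nat.card (R ⧸ 𝔞) := by
  induction 𝔞 using WellFoundedGT.induction generalizing e with
  | ind 𝔞 ih =>
  obtain ⟨m, hm⟩ := hcN
  obtain ⟨t, ht⟩ := hN
  have hinv : ∀ {z : R} {w : R}, z * w = N → ∀ {𝔟 : Ideal R}, 𝔞 ≤ 𝔟 → ∀ x, z * x ∈ 𝔟 → x ∈ 𝔟 := by
    intro z w hz 𝔟 hb x hx
    have : x = w * t * (z * x) - (N * t - 1) * x := by rw [← hz]; ring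
    rw [this]
    exact 𝔟.sub_mem (𝔟.mul_mem_left _ hx) (𝔟.mul_mem_right _ (hb ht))
  have h2inv : ∀ {𝔟 : Ideal R}, 𝔞 ≤ 𝔟 → ∀ x, 2 * x ∈ 𝔟 → x ∈ 𝔟 :=
    hinv (w := c * m) (by rw [hm]; ring)
  have hcinv : ∀ {𝔟 : Ideal R}, 𝔞 ≤ 𝔟 → ∀ x, c * x ∈ 𝔟 ↔ x ∈ 𝔟 := fun hb x =>
    ⟨hinv (w := 2 * m) (by rw [hm]; ring) hb x, fun h => Ideal.mul_mem_left _ _ h⟩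
  by_cases htop : 𝔞 = ⊤
  · subst htop
    have hG : ∀ f : AddChar R ℂ, Cond f ⊤ → GG f ⊤ = 1 := by
      intro f hf
      have h1 : ∀ x, f x = 1 := fun x => hf.one trivial
      have hs : Subsingleton (R ⧸ (⊤ : Ideal R)) := Ideal.Quotient.subsingleton_iff.mpr rfl
      let _ : Unique (R ⧸ (⊤ : Ideal R)) := ⟨⟨0⟩, fun _ => Subsingleton.elim _ _⟩
      rw [GG, SS, finsum_unique, h1]
    rw [hG e he, hG _ (he.shift (hcinv le_rfl))]
    have hs : Subsingleton (R ⧸ (⊤ : Ideal R)) := Ideal.Quotient.subsingleton_iff.mpr rfl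
    rw [Nat.card_unique, ← Ideal.one_eq_top, map_one]; simp
  obtain ⟨𝔭, hpm, hap⟩ := Ideal.exists_le_maximal 𝔞 htop
  have hp0 : 𝔭 ≠ ⊥ := fun h => ha0 (le_bot_iff.mp (h ▸ hap))
  have hNp : N ∉ 𝔭 := by
    intro h
    apply hpm.ne_top
    rw [Ideal.eq_top_iff_one]
    have := 𝔭.sub_mem (𝔭.mul_mem_right t h) (hap ht)
    simpa using this
  have h2p : (2 : R) ∉ 𝔭 := by
    intro h
    apply hNp
    rw [hm, mul_assoc]
    exact Ideal.mul_mem_right _ _ h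
  have hcp : c ∉ 𝔭 := by
    intro h
    apply hNp
    rw [hm, show 2 * c * m = c * (2 * m) by ring]
    exact Ideal.mul_mem_right _ _ h
  obtain ⟨𝔠, hc⟩ := Ideal.dvd_iff_le.mpr hap
  have hc0 : 𝔠 ≠ ⊥ := by
    rintro rfl
    apply ha0; rw [hc]; simp
  have hac : 𝔞 ≤ 𝔠 := by rw [hc]; exact Ideal.mul_le_right
  have hlt : ∀ 𝔟 : Ideal R, 𝔠 ≤ 𝔟 → 𝔞 < 𝔟 := by
    intro 𝔟 hb
    refine lt_of_lt_of_le (lt_of_le_of_ne hac ?_) hb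
    intro h
    rw [h] at hc
    have h1 : 1 * 𝔠 = 𝔭 * 𝔠 := by rw [one_mul]; exact hc
    have := mul_right_cancel₀ (by simpa using hc0) h1
    exact hpm.ne_top (by rw [← this]; exact Ideal.one_eq_top)
  by_cases hcp2 : 𝔠 ≤ 𝔭
  · obtain ⟨𝔟, hb⟩ := Ideal.dvd_iff_le.mpr hcp2
    rw [mul_comm] at hb
    have hb0 : 𝔟 ≠ ⊥ := by
      rintro rfl
      apply hc0; rw [hb]; simp
    have hcb : 𝔠 ≤ 𝔟 := by rw [hb]; exact Ideal.mul_le_left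
    have ha : 𝔞 = 𝔭 * (𝔟 * 𝔭) := by rw [← hb]; exact hc
    obtain ⟨ϖ, hϖ⟩ := IsDedekindDomain.exists_sup_span_eq (I := 𝔟 * 𝔭) (J := 𝔭) Ideal.mul_le_right
      (mul_ne_zero hb0 hp0)
    have h1 := GG_sq hp0 hb0 ha (h2inv hap) he hϖ
    have h2 := GG_sq hp0 hb0 ha (h2inv hap) (he.shift (hcinv le_rfl)) hϖ
    have h3 := ih 𝔟 (hlt 𝔟 hcb) hb0 ⟨t, hcb (hac ht)⟩ _ (Cond_sq hp0 ha he hϖ)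
    rw [h1, h2, mulShift_comm', mul_mul_mul_comm, h3, ha, card_mul, card_mul, map_mul, map_mul, psi_prime _ _ hp0 hNp]
    push_cast
    linear_combination (-(psi N (-c) 𝔟) * (Nat.card (R ⧸ 𝔭)) ^ 2 * Nat.card (R ⧸ 𝔟)) * (sym_sq (-c) 𝔭)
  · have hcop : 𝔠 ⊔ 𝔭 = ⊤ := by
      refine hpm.1.2 (𝔠 ⊔ 𝔭) (lt_of_le_of_ne le_sup_right ?_)
      intro h
      exact hcp2 (h ▸ le_sup_left)
    obtain ⟨f, hf, g, hg, hfg⟩ := Submodule.mem_sup.mp ((Ideal.eq_top_iff_one _).mp hcop)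
    have he' : Cond e (𝔭 * 𝔠) := hc ▸ he
    have hec' : Cond (e.mulShift c) (𝔭 * 𝔠) := hc ▸ (he.shift (hcinv le_rfl))
    have h1 := GG_coprime hp0 hc0 he' hf hg hfg
    have h2 := GG_coprime hp0 hc0 hec' hf hg hfg
    have c1 : Cond (e.mulShift (f ^ 2)) 𝔭 := he'.shift (coprime_mem hf hg hfg)
    have c2 : Cond (e.mulShift (g ^ 2)) 𝔠 := by
      apply he'.shift
      rw [mul_comm 𝔭]
      exact coprime_mem hg hf (by rw [add_comm]; exact hfg)
    have h3 := ih 𝔠 (hlt 𝔠 le_rfl) hc0 ⟨t, hac ht⟩ _ c2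
    have h4 := GG_prime hp0 h2p hcp c1
    rw [hc, h1, h2, mulShift_comm' e c, mulShift_comm' e c, mul_mul_mul_comm, h3, h4, card_mul, map_mul,
      psi_prime _ _ hp0 hNp]
    push_cast
    ring

end LocalGauss
end CMNorm

namespace CMNorm
open MeasureTheory Complex NumberField Filter Topology
open scoped Real BigOperators
set_option linter.unusedSectionVars false

section PsiSign
variable {F : Type*} [Field F] [NumberField F]

/-- additive character of the ring of integers -/
noncomputable def Ech (y : F) : AddChar (𝓞 F) ℂ where
  toFun x := Etr (y * (x : F))
  map_zero_eq_one' := by simp [Etr]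
  map_add_eq_mul' := by
    intro a b
    rw [← Etr_add]; congr 1; push_cast; ring

lemma Ech_apply (y : F) (x : 𝓞 F) : Ech y x = Etr (y * (x : F)) := rfl

lemma GG_Ech (y : F) (𝔞 : Ideal (𝓞 F)) : GG (Ech y) 𝔞 = Gsum y 𝔞 := by
  rw [GG, SS, Gsum]
  rfl

lemma Ech_shift (y : F) (c : 𝓞 F) : (Ech y).mulShift c = Ech ((c : F) * y) := by
  ext x
  rw [AddChar.mulShift_apply, Ech_apply, Ech_apply]
  congr 1
  push_cast
  ring

lemma Etr_eq_one {y : F} (h : Etr y = 1) : ∃ n : ℤ, Algebra.trace ℚ F y = n := by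
  rw [Etr, Complex.exp_eq_one_iff] at h
  obtain ⟨n, hn⟩ := h
  refine ⟨n, ?_⟩
  have h2 : (2 * π * I : ℂ) ≠ 0 := Complex.two_pi_I_ne_zero
  have : ((Algebra.trace ℚ F y : ℚ) : ℂ) = n := by
    have h3 : (2 * π * I : ℂ) * ((Algebra.trace ℚ F y : ℚ) : ℂ) = (2 * π * I) * n := by rw [hn]; ring
    exact mul_left_cancel₀ h2 h3
  exact_mod_cast this

variable (F) in
lemma exists_diff : ∃ δ : 𝓞 F, δ ≠ 0 ∧ ∀ y : F, (∀ r : 𝓞 F, ∃ n : ℤ, Algebra.trace ℚ F (r * y) = n) →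
    ∃ z : 𝓞 F, (δ : F) * y = z := by
  refine ⟨(NumberField.discr F : ℤ), ?_, fun y hy => ?_⟩
  · exact_mod_cast NumberField.discr_ne_zero F
  have h1 : (1 : F) ∈ (1 : Submodule (𝓞 F) F) := Submodule.one_le.mp le_rfl
  have h2 : y ∈ Submodule.traceDual ℤ ℚ (1 : Submodule (𝓞 F) F) := by
    rw [Submodule.mem_traceDual]
    intro a ha
    rw [Submodule.mem_one] at ha
    obtain ⟨r, rfl⟩ := ha
    obtain ⟨n, hn⟩ := hy r
    refine ⟨n, ?_⟩
    rw [Algebra.traceForm_apply, mul_comm]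
    exact hn.symm
  have h3 := isIntegral_discr_mul_of_mem_traceDual (A := ℤ) (K := ℚ) (1 : Submodule (𝓞 F) F)
    (b := NumberField.integralBasis F) (fun i => by
      rw [NumberField.integralBasis_apply]; exact NumberField.RingOfIntegers.isIntegral_coe _) h1 h2
  rw [← NumberField.coe_discr] at h3
  refine ⟨⟨_, h3⟩, ?_⟩
  show _ = ((NumberField.discr F : ℤ) : ℚ) • (1 : F) * y
  rw [Algebra.smul_def]
  simp

lemma Cond_Ech {δ : 𝓞 F} (hδ : ∀ y : F, (∀ r : 𝓞 F, ∃ n : ℤ, Algebra.trace ℚ F (r * y) = n) →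
    ∃ z : 𝓞 F, (δ : F) * y = z) {a : 𝓞 F} (ha : a ≠ 0) (haδ : δ ∣ a - 1) :
    Cond (Ech (1 / (a : F))) (Ideal.span {a}) := by
  have ha' : (a : F) ≠ 0 := by simpa using ha
  intro x
  constructor
  · intro h
    obtain ⟨z, hz⟩ := hδ (x / a) (by
      intro r
      apply Etr_eq_one
      rw [← h r, Ech_apply]
      congr 1
      push_cast
      field_simp)
    obtain ⟨t, ht⟩ := haδ
    have h2 : δ * x = a * z := by
      have : (δ : F) * x = a * z := by rw [← hz]; field_simp
      exact_mod_cast this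
    rw [Ideal.mem_span_singleton]
    refine ⟨x - t * z, ?_⟩
    linear_combination (-x) * ht - t * h2
  · intro h r
    obtain ⟨z, rfl⟩ := Ideal.mem_span_singleton.mp h
    rw [Ech_apply, ← Etr_int (r * z)]
    congr 1
    push_cast
    field_simp

variable [IsTotallyReal F]

theorem psi_sign {c : 𝓞 F} (hc : ∀ v : InfinitePlace F, 0 < rv v (c : F)) :
    ∃ N : 𝓞 F, N ≠ 0 ∧ 2 * c ∣ N ∧ ∀ a : 𝓞 F, a ≠ 0 → N ∣ a - 1 →
      psi N (-c) (Ideal.span {a}) * ((|Algebra.norm ℚ (a : F)| : ℚ) : ℂ) = ((Algebra.norm ℚ (a : F) : ℚ) : ℂ) := by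
  obtain ⟨M, hM, hrec⟩ := gauss_reciprocity F
  obtain ⟨δ, hδ0, hδ⟩ := exists_diff F
  have hc0 : c ≠ 0 := by
    rintro rfl
    obtain ⟨v⟩ : Nonempty (InfinitePlace F) := inferInstance
    have := hc v
    simp at this
  have hM0 : (M : 𝓞 F) ≠ 0 := by exact_mod_cast hM.ne'
  refine ⟨4 * M ^ 2 * c * δ, ?_, ⟨2 * M ^ 2 * δ, by ring⟩, ?_⟩
  · have h4 : (4 : 𝓞 F) ≠ 0 := by exact_mod_cast (by norm_num : (4 : ℕ) ≠ 0)
    exact mul_ne_zero (mul_ne_zero (mul_ne_zero h4 (pow_ne_zero _ hM0)) hc0) hδ0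
  intro a ha haN
  have h1 := hrec c a hc ha ((dvd_mul_right _ _).trans haN)
  have h2 := Cond_Ech hδ ha ((dvd_mul_left _ _).trans haN)
  have ha0 : Ideal.span {a} ≠ ⊥ := by simpa using ha
  obtain ⟨t, ht⟩ := haN
  have h3 := GG_main (c := c) (N := 4 * M ^ 2 * c * δ) ⟨2 * M ^ 2 * δ, by ring⟩ _ ha0
    ⟨-t, by rw [Ideal.mem_span_singleton]; exact ⟨-1, by linear_combination ht⟩⟩ _ h2
  rw [Ech_shift, GG_Ech, GG_Ech, mul_one_div, h1] at h3
  rw [h3]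
  congr 1
  have h4 : Nat.card (𝓞 F ⧸ Ideal.span {a}) = Ideal.absNorm (Ideal.span {a}) := rfl
  rw [h4, Ideal.absNorm_span_singleton]
  have h5 : Algebra.norm ℚ (a : F) = ((Algebra.norm ℤ a : ℤ) : ℚ) := by
    have := Algebra.norm_localization ℤ (nonZeroDivisors ℤ) (Rₘ := ℚ) (Sₘ := F) a
    exact this
  rw [h5]
  rw [Nat.cast_natAbs, ← Int.cast_abs, Rat.cast_intCast]

end PsiSign
end CMNorm

namespace CMNorm
open MeasureTheory Complex NumberField Filter Topology
open scoped Real BigOperators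
set_option linter.unusedSectionVars false

section Lattice
variable {V : Type*} [Fintype V]

/-- admissible weight functions -/
structure GoodW (W : (V → ℝ) → ℝ) (CW A : ℝ) : Prop where
  nonneg : ∀ z, 0 ≤ W z
  le_one : ∀ z, W z ≤ 1
  CW_nonneg : 0 ≤ CW
  A_nonneg : 0 ≤ A
  lip : ∀ z z', |W z - W z'| ≤ CW * ‖z - z'‖
  supp : ∀ z, W z ≠ 0 → ∀ v v', z v' - z v ≤ A

/-- the test function -/
noncomputable def ft (W : (V → ℝ) → ℝ) (s : ℝ) (x : V → ℝ) : ℝ :=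
  (∏ v, x v) / |∏ v, x v| * (max |∏ v, x v| 1) ^ (-s) * W (fun v => Real.log |x v|)

variable {W : (V → ℝ) → ℝ} {CW A : ℝ}

lemma ft_abs_le (hW : GoodW W CW A) (s : ℝ) (x : V → ℝ) :
    |ft W s x| ≤ (max |∏ v, x v| 1) ^ (-s) := by
  unfold ft
  rw [abs_mul, abs_mul, abs_div, abs_abs]
  have h1 : |∏ v, x v| / |∏ v, x v| ≤ 1 := div_self_le_one _
  have h2 : 0 ≤ (max |∏ v, x v| 1) ^ (-s) := by positivity
  have h3 : |W (fun v => Real.log |x v|)| ≤ 1 := by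
    rw [abs_of_nonneg (hW.nonneg _)]; exact hW.le_one _
  rw [abs_of_nonneg h2]
  have h0 : 0 ≤ |∏ v, x v| / |∏ v, x v| := by positivity
  calc _ ≤ 1 * (max |∏ v, x v| 1) ^ (-s) * 1 := by gcongr
    _ = _ := by ring

lemma ft_abs_le_one (hW : GoodW W CW A) {s : ℝ} (hs : 0 ≤ s) (x : V → ℝ) :
    |ft W s x| ≤ 1 :=
  (ft_abs_le hW s x).trans
    (Real.rpow_le_one_of_one_le_of_nonpos (le_max_right _ _) (by linarith))

lemma ft_supp (hW : GoodW W CW A) {s : ℝ} {x : V → ℝ} (h : ft W s x ≠ 0) :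
    (∀ v, x v ≠ 0) ∧ ∀ v, Real.exp (-A) * ‖x‖ ≤ |x v| := by
  unfold ft at h
  have hW0 : W (fun v => Real.log |x v|) ≠ 0 := right_ne_zero_of_mul h
  have hp : (∏ v, x v) ≠ 0 := by
    intro h0; apply h; rw [h0]; simp
  have hx : ∀ v, x v ≠ 0 := fun v => (Finset.prod_ne_zero_iff.mp hp) v (Finset.mem_univ _)
  refine ⟨hx, fun v => ?_⟩
  have hle : ‖x‖ ≤ Real.exp A * |x v| := by
    rw [pi_norm_le_iff_of_nonneg (by positivity)]
    intro v'
    have := hW.supp _ hW0 v v'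
    have h1 : 0 < |x v'| := abs_pos.mpr (hx v')
    have h2 : 0 < |x v| := abs_pos.mpr (hx v)
    rw [Real.norm_eq_abs, ← Real.exp_log h1]
    nth_rewrite 1 [← Real.exp_log h2]
    rw [← Real.exp_add]
    apply Real.exp_le_exp.mpr; linarith
  rw [Real.exp_neg, inv_mul_le_iff₀ (Real.exp_pos _)]
  exact hle

lemma ft_decay (hW : GoodW W CW A) {s : ℝ} (_hs : 0 ≤ s) (x : V → ℝ) (h : ft W s x ≠ 0) :
    (Real.exp (-A) / 2 * (1 + ‖x‖)) ^ (Fintype.card V) ≤ max |∏ v, x v| 1 := by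
  obtain ⟨hx, hx2⟩ := ft_supp hW h
  have hk : Real.exp (-A) ≤ 1 := Real.exp_le_one_iff.mpr (by linarith [hW.A_nonneg])
  have hk0 := Real.exp_pos (-A)
  by_cases hn : ‖x‖ ≤ 1
  · apply le_max_of_le_right
    apply pow_le_one₀ (by positivity)
    nlinarith [norm_nonneg x]
  · apply le_max_of_le_left
    push Not at hn
    rw [Finset.abs_prod, ← Finset.card_univ, ← Finset.prod_const]
    apply Finset.prod_le_prod
    · intro i _; positivity
    · intro i _
      refine le_trans ?_ (hx2 i)
      nlinarith

lemma ft_bound (hW : GoodW W CW A) {s : ℝ} (hs : 0 ≤ s) (x : V → ℝ) :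
    |ft W s x| ≤ (Real.exp (-A) / 2) ^ (-(Fintype.card V * s)) *
      (1 + ‖x‖) ^ (-(Fintype.card V * s)) := by
  have hk0 := Real.exp_pos (-A)
  by_cases h : ft W s x = 0
  · rw [h, abs_zero]; positivity
  · refine (ft_abs_le hW s x).trans ?_
    have h1 := ft_decay hW hs x h
    rw [← Real.mul_rpow (by positivity) (by positivity), ← mul_neg,
      Real.rpow_mul (by positivity), Real.rpow_natCast]
    exact Real.rpow_le_rpow_of_nonpos (by positivity) h1 (by linarith)

lemma ft_measurable (hW : GoodW W CW A) (s : ℝ) : Measurable (ft W s) := by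
  have hc : Continuous W := by
    have : LipschitzWith (Real.toNNReal CW) W := by
      apply LipschitzWith.of_dist_le_mul
      intro z z'
      rw [Real.dist_eq, dist_eq_norm, Real.coe_toNNReal _ hW.CW_nonneg]
      exact hW.lip z z'
    exact this.continuous
  unfold ft
  have hp : Measurable fun x : V → ℝ => ∏ v, x v := by fun_prop
  have ha : Measurable fun x : V → ℝ => |∏ v, x v| := by fun_prop
  have hl : Measurable fun x : V → ℝ => (fun v => Real.log |x v|) := by
    apply measurable_pi_lambda
    intro v
    exact Real.measurable_log.comp ((measurable_pi_apply v).norm)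
  exact ((hp.div ha).mul ((ha.max measurable_const).pow_const _)).mul (hc.measurable.comp hl)

lemma ft_integrable [Nonempty V] (hW : GoodW W CW A) {s : ℝ} (hs : 1 < s) :
    Integrable (ft W s) := by
  have hn : (0:ℝ) < Fintype.card V := by exact_mod_cast Fintype.card_pos
  have h1 : Integrable (fun x : V → ℝ => (1 + ‖x‖) ^ (-(Fintype.card V * s))) := by
    apply integrable_one_add_norm
    simp only [Module.finrank_fintype_fun_eq_card]
    nlinarith
  refine Integrable.mono' (h1.const_mul ((Real.exp (-A) / 2) ^ (-(Fintype.card V * s))))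
    (ft_measurable hW s).aestronglyMeasurable ?_
  filter_upwards with x
  exact ft_bound hW (by linarith) x

lemma ft_reflect [DecidableEq V] (s : ℝ) (v0 : V) (x : V → ℝ) :
    ft W s (fun v => if v = v0 then - x v else x v) = - ft W s x := by
  have hp : (∏ v, (if v = v0 then - x v else x v)) = - ∏ v, x v := by
    have : ∀ v, (if v = v0 then - x v else x v) = (if v = v0 then (-1:ℝ) else 1) * x v := by
      intro v; split_ifs <;> ring
    simp_rw [this]
    rw [Finset.prod_mul_distrib]
    simp
  have ha : ∀ v, |(if v = v0 then - x v else x v)| = |x v| := by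
    intro v; split_ifs <;> simp
  unfold ft
  simp_rw [hp, ha, abs_neg]
  ring

lemma ft_integral [Nonempty V] (s : ℝ) : ∫ x, ft W s x = 0 := by
  classical
  obtain ⟨v0⟩ := ‹Nonempty V›
  have hmp : MeasurePreserving
      (fun (x : V → ℝ) (v : V) => if v = v0 then - x v else x v) volume volume := by
    have := volume_preserving_pi (α' := fun _ : V => ℝ) (β' := fun _ : V => ℝ)
      (f := fun v t => if v = v0 then -t else t) (by
        intro v
        by_cases h : v = v0
        · simp only [h, if_true]
          exact Measure.measurePreserving_neg volume
        · simp only [h, if_false]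
          exact MeasurePreserving.id volume)
    exact this
  have he : MeasurableEmbedding (fun (x : V → ℝ) (v : V) => if v = v0 then - x v else x v) := by
    have hinv : Function.Involutive
        (fun (x : V → ℝ) (v : V) => if v = v0 then - x v else x v) := by
      intro x; funext v; simp only; split_ifs <;> simp
    exact (MeasurableEquiv.mk hinv.toPerm hmp.measurable hmp.measurable).measurableEmbedding
  have h := hmp.integral_comp he (ft W s)
  simp_rw [ft_reflect] at h
  rw [integral_neg] at h
  linarith

lemma log_close {a b η : ℝ} (ha : a ≠ 0) (hη : η ≤ 1/4) (h : |b - a| ≤ η * |a|) :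
    0 < b / a ∧ 3/4 * |a| ≤ |b| ∧ |(Real.log |b|) - (Real.log |a|)| ≤ 2 * η := by
  have ha0 : 0 < |a| := abs_pos.mpr ha
  have hq : |b / a - 1| ≤ η := by
    have : b / a - 1 = (b - a) / a := by field_simp
    rw [this, abs_div, div_le_iff₀ ha0]; exact h
  obtain ⟨h1, h2⟩ := abs_le.mp hq
  have hη0 : 0 ≤ η := (abs_nonneg _).trans hq
  have hpos : 0 < b / a := by linarith
  have hb : b ≠ 0 := by rintro rfl; simp at hpos
  have hlog : Real.log |b| - Real.log |a| = Real.log (b / a) := by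
    rw [← Real.log_div (abs_pos.mpr hb).ne' ha0.ne', ← abs_div, Real.log_abs]
  refine ⟨hpos, ?_, ?_⟩
  · have : |b| = (b / a) * |a| := by
      rw [← abs_of_pos hpos, ← abs_mul]; simp [ha]
    rw [this]; exact mul_le_mul_of_nonneg_right (by linarith) ha0.le
  · rw [hlog, abs_le]
    have h3 := Real.log_le_sub_one_of_pos hpos
    have h4 := Real.one_sub_inv_le_log_of_pos hpos
    have h5 : (b / a)⁻¹ ≤ 1 + 2 * η := by
      rw [inv_le_iff_one_le_mul₀ hpos]
      nlinarith
    constructor <;> linarith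

lemma ft_exp (s : ℝ) (x : V → ℝ) (h : ∀ v, 1 ≤ |x v|) :
    ft W s x = (∏ v, x v) / |∏ v, x v| * Real.exp (-s * ∑ v, Real.log |x v|)
      * W (fun v => Real.log |x v|) := by
  have h1 : 1 ≤ |∏ v, x v| := by
    rw [Finset.abs_prod]
    calc (1:ℝ) = ∏ v : V, (1:ℝ) := by simp
      _ ≤ _ := Finset.prod_le_prod (fun _ _ => zero_le_one) (fun v _ => h v)
  unfold ft
  rw [max_eq_left h1, Finset.abs_prod, Real.rpow_def_of_pos (by rw [← Finset.abs_prod]; linarith),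
    Real.log_prod (fun v _ => by have := h v; positivity)]
  congr 3
  ring

lemma ft_diff1 (hW : GoodW W CW A) {D : ℝ} (hD : 0 ≤ D) : ∃ C, 0 ≤ C ∧
    ∀ s : ℝ, 1 ≤ s → s ≤ 2 → ∀ x y : V → ℝ, ‖x - y‖ ≤ D → ft W s x ≠ 0 →
      |ft W s x - ft W s y| ≤ C / (1 + ‖x‖) ^ (Fintype.card V + 1) := by
  set n := Fintype.card V with hn
  set κ := Real.exp (-A) with hκ
  have hκ0 : 0 < κ := Real.exp_pos _
  have hκ1 : κ ≤ 1 := Real.exp_le_one_iff.mpr (by linarith [hW.A_nonneg])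
  have hCW := hW.CW_nonneg
  set T := (2 + 4 * (n + 1) * D) / κ with hT
  have hT0 : 0 ≤ T := by positivity
  have hT1 : 1 ≤ T := by
    rw [hT, le_div_iff₀ hκ0]; nlinarith [mul_nonneg (by positivity : (0:ℝ) ≤ n + 1) hD]
  refine ⟨2 * (1 + T) ^ (n + 1) +
    (κ / 2) ^ (-(n * 2 : ℝ)) * ((4 * n + CW) * (4 * D / κ)), by positivity, ?_⟩
  intro s hs1 hs2 x y hxy hx
  have hx0 := norm_nonneg x
  have hC2 : 0 ≤ (κ / 2) ^ (-(n * 2 : ℝ)) * ((4 * n + CW) * (4 * D / κ)) := by positivity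
  rw [le_div_iff₀ (by positivity)]
  by_cases hxT : ‖x‖ ≤ T
  · have h1 : |ft W s x - ft W s y| ≤ 2 := by
      have a1 := ft_abs_le_one hW (by linarith : 0 ≤ s) x
      have a2 := ft_abs_le_one hW (by linarith : 0 ≤ s) y
      rw [abs_le] at *; constructor <;> linarith
    have h2 : |ft W s x - ft W s y| * (1 + ‖x‖) ^ (n + 1) ≤ 2 * (1 + T) ^ (n + 1) := by
      gcongr
    linarith
  · push Not at hxT
    obtain ⟨hxv, hxk⟩ := ft_supp hW hx
    rw [← hκ] at hxk
    have hxpos : 0 < ‖x‖ := by linarith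
    have hbig : 2 + 4 * (n + 1) * D < κ * ‖x‖ := by
      rw [hT, div_lt_iff₀ hκ0] at hxT; linarith
    set η := D / (κ * ‖x‖) with hη
    have hη0 : 0 ≤ η := by positivity
    have hη4 : 4 * (n + 1) * η ≤ 1 := by
      rw [hη, ← mul_div_assoc, div_le_one (by positivity)]; linarith
    have hη1 : η ≤ 1 / 4 := by
      have : (0:ℝ) ≤ n * η := by positivity
      linarith
    have hnη : n * (4 * η) ≤ 1 := by linarith
    have hcl : ∀ v, 0 < y v / x v ∧ 3/4 * |x v| ≤ |y v| ∧
        |(Real.log |y v|) - (Real.log |x v|)| ≤ 2 * η := by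
      intro v
      apply log_close (hxv v) hη1
      have h1 : |y v - x v| ≤ D := by
        have := norm_le_pi_norm (x - y) v
        rw [Real.norm_eq_abs, Pi.sub_apply, abs_sub_comm] at this
        linarith
      have h2 : D = η * (κ * ‖x‖) := by rw [hη]; field_simp
      calc _ ≤ D := h1
        _ = η * (κ * ‖x‖) := h2
        _ ≤ _ := by gcongr; exact hxk v
    have hx2 : ∀ v, 2 ≤ |x v| := fun v => by
      have : 0 ≤ 4 * (n + 1) * D := by positivity
      linarith [hxk v]
    have hx1 : ∀ v, 1 ≤ |x v| := fun v => by linarith [hx2 v]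
    have hy1 : ∀ v, 1 ≤ |y v| := fun v => by linarith [hx2 v, (hcl v).2.1]
    have hpx : (∏ v, x v) ≠ 0 := Finset.prod_ne_zero_iff.mpr fun v _ => hxv v
    have hpy : 0 < (∏ v, y v) / ∏ v, x v := by
      rw [← Finset.prod_div_distrib]; exact Finset.prod_pos fun v _ => (hcl v).1
    have hsg : (∏ v, y v) / |∏ v, y v| = (∏ v, x v) / |∏ v, x v| := by
      have : (∏ v, y v) = ((∏ v, y v) / ∏ v, x v) * ∏ v, x v := by field_simp
      rw [this, abs_mul, abs_of_pos hpy, mul_div_mul_left _ _ hpy.ne']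
    have ey := ft_exp (W := W) s y hy1
    have ex := ft_exp (W := W) s x hx1
    set zx : V → ℝ := fun v => Real.log |x v|
    set zy : V → ℝ := fun v => Real.log |y v|
    rw [hsg] at ey
    have hsx : |(∏ v, x v) / (|∏ v, x v|)| = 1 := by
      rw [abs_div, abs_abs, div_self (abs_pos.mpr hpx).ne']
    set σ := (∏ v, x v) / |∏ v, x v|
    have hz : ‖zx - zy‖ ≤ 2 * η := by
      rw [pi_norm_le_iff_of_nonneg (by positivity)]
      intro v
      rw [Real.norm_eq_abs, Pi.sub_apply, abs_sub_comm]
      exact (hcl v).2.2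
    have hsum : |(∑ v, zy v) - ∑ v, zx v| ≤ n * (2 * η) := by
      rw [← Finset.sum_sub_distrib]
      refine (Finset.abs_sum_le_sum_abs _ _).trans ?_
      refine (Finset.sum_le_sum (fun v _ => (hcl v).2.2)).trans ?_
      rw [Finset.sum_const, Finset.card_univ, nsmul_eq_mul]
    set Sx := ∑ v, zx v
    set Sy := ∑ v, zy v
    have hee : Real.exp (-s * Sy) = Real.exp (-s * Sx) * Real.exp (-s * (Sy - Sx)) := by
      rw [← Real.exp_add]; congr 1; ring
    have habs : |-s * (Sy - Sx)| ≤ n * (4 * η) := by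
      rw [abs_mul, abs_neg, abs_of_nonneg (by linarith : 0 ≤ s)]
      calc s * |Sy - Sx| ≤ 2 * (n * (2 * η)) := by gcongr
        _ = _ := by ring
    have hexp : |Real.exp (-s * (Sy - Sx)) - 1| ≤ 2 * (n * (4 * η)) := by
      have := Real.abs_exp_sub_one_le (habs.trans hnη)
      linarith
    set E := Real.exp (-s * (Sy - Sx))
    have hlipW := hW.lip zx zy
    have hW1 := hW.le_one zy
    have hW0 := hW.nonneg zy
    have hlip2 : |W zx - W zy| ≤ CW * (2 * η) := hlipW.trans (by gcongr)
    have ha : Real.exp (-s * Sx) ≤ (κ / 2) ^ (-(n * 2 : ℝ)) / (1 + ‖x‖) ^ n := by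
      have hd := ft_decay hW (by linarith : 0 ≤ s) x hx
      have h1 : 1 ≤ max |∏ v, x v| 1 := le_max_right _ _
      have e1 : Real.exp (-s * Sx) = (max |∏ v, x v| 1) ^ (-s) := by
        have hp1 : 1 ≤ |∏ v, x v| := by
          rw [Finset.abs_prod]
          calc (1:ℝ) = ∏ v : V, (1:ℝ) := by simp
            _ ≤ _ := Finset.prod_le_prod (fun _ _ => zero_le_one) (fun v _ => hx1 v)
        rw [max_eq_left hp1, Finset.abs_prod,
          Real.rpow_def_of_pos (by rw [← Finset.abs_prod]; linarith),
          Real.log_prod (fun v _ => by have := hx1 v; positivity)]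
        congr 1; rw [mul_comm]
      rw [e1]
      have h2 : (max |∏ v, x v| 1) ^ (-s) ≤ ((κ / 2 * (1 + ‖x‖)) ^ n) ^ (-s) :=
        Real.rpow_le_rpow_of_nonpos (by positivity) hd (by linarith)
      refine h2.trans ?_
      rw [mul_pow, Real.mul_rpow (by positivity) (by positivity), div_eq_mul_inv]
      apply mul_le_mul _ _ (by positivity) (by positivity)
      · rw [← Real.rpow_natCast, ← Real.rpow_mul (by positivity)]
        apply Real.rpow_le_rpow_of_exponent_ge (by positivity) (by linarith)
        have : (0:ℝ) ≤ n := by positivity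
        nlinarith
      · rw [← Real.rpow_neg_one]
        apply Real.rpow_le_rpow_of_exponent_le
        · exact one_le_pow₀ (by linarith)
        · linarith
    have hdiff : |ft W s x - ft W s y| ≤ Real.exp (-s * Sx) * ((4 * n + CW) * (2 * η)) := by
      have e : ft W s x - ft W s y =
          σ * Real.exp (-s * Sx) * ((W zx - W zy) - (E - 1) * W zy) := by
        rw [ex, ey, hee]; ring
      rw [e, abs_mul, abs_mul, hsx, abs_of_pos (Real.exp_pos _), one_mul]
      gcongr
      refine (abs_sub _ _).trans ?_
      rw [abs_mul, abs_of_nonneg hW0]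
      have : |E - 1| * W zy ≤ 2 * (n * (4 * η)) * 1 := by gcongr
      linarith
    have hη5 : η * (1 + ‖x‖) ≤ 2 * D / κ := by
      rw [hη, div_mul_eq_mul_div, div_le_div_iff₀ (by positivity) hκ0]
      have : D * κ * (1 + ‖x‖) ≤ D * κ * (2 * ‖x‖) := by gcongr; linarith
      linarith
    have hfin : |ft W s x - ft W s y| * (1 + ‖x‖) ^ (n + 1) ≤
        (κ / 2) ^ (-(n * 2 : ℝ)) * ((4 * n + CW) * (4 * D / κ)) := by
      calc _ ≤ ((κ / 2) ^ (-(n * 2 : ℝ)) / (1 + ‖x‖) ^ n * ((4 * n + CW) * (2 * η)))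
            * (1 + ‖x‖) ^ (n + 1) := by
            gcongr; refine hdiff.trans ?_; gcongr
        _ = (κ / 2) ^ (-(n * 2 : ℝ)) * ((4 * n + CW) * (2 * (η * (1 + ‖x‖)))) := by
            rw [pow_succ]; field_simp
        _ ≤ (κ / 2) ^ (-(n * 2 : ℝ)) * ((4 * n + CW) * (2 * (2 * D / κ))) := by gcongr
        _ = _ := by ring
    have : 0 ≤ 2 * (1 + T) ^ (n + 1) := by positivity
    linarith

lemma ft_diff (hW : GoodW W CW A) {D : ℝ} (hD : 0 ≤ D) : ∃ C, 0 ≤ C ∧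
    ∀ s : ℝ, 1 ≤ s → s ≤ 2 → ∀ x y : V → ℝ, ‖x - y‖ ≤ D →
      |ft W s x - ft W s y| ≤ C / (1 + ‖x‖) ^ (Fintype.card V + 1) := by
  obtain ⟨C, hC, h⟩ := ft_diff1 hW hD
  refine ⟨C * (1 + D) ^ (Fintype.card V + 1), by positivity, ?_⟩
  intro s h1 h2 x y hxy
  have hD1 : 1 ≤ (1 + D) ^ (Fintype.card V + 1) := one_le_pow₀ (by linarith)
  by_cases hx : ft W s x = 0
  · by_cases hy : ft W s y = 0
    · rw [hx, hy]; simp; positivity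
    · have := h s h1 h2 y x (by rwa [norm_sub_rev]) hy
      rw [abs_sub_comm]
      refine this.trans ?_
      rw [div_le_div_iff₀ (by positivity) (by positivity), mul_assoc, ← mul_pow]
      gcongr
      have := norm_le_norm_add_norm_sub' x y
      nlinarith [norm_nonneg y]
  · refine (h s h1 h2 x y hxy hx).trans ?_
    gcongr
    exact le_mul_of_one_le_right hC hD1


variable {ι : Type*} [Fintype ι]

theorem lattice_bound [Nonempty V] (hcard : Fintype.card ι = Fintype.card V)
    (hW : GoodW W CW A) (B : (ι → ℝ) ≃L[ℝ] (V → ℝ)) (ξ : ι → ℝ) :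
    ∃ C, ∀ s : ℝ, 1 < s → s ≤ 2 → Summable (fun k : ι → ℤ => ft W s (B (ξ + icast k))) ∧
      |∑' k : ι → ℤ, ft W s (B (ξ + icast k))| ≤ C := by
  set Bc : (ι → ℝ) →L[ℝ] (V → ℝ) := B.toContinuousLinearMap with hBc
  set Bs : (V → ℝ) →L[ℝ] (ι → ℝ) := B.symm.toContinuousLinearMap with hBs
  set D := ‖Bc‖ * (‖ξ‖ + 1) with hD
  have hD0 : 0 ≤ D := by positivity
  obtain ⟨C2, hC2, hdiff⟩ := ft_diff hW hD0
  set n := Fintype.card V with hn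
  set L := 1 + ‖ξ‖ + ‖Bs‖ with hL
  have hL1 : 0 < L := by positivity
  have hlow : ∀ k : ι → ℤ, 1 + ‖icast k‖ ≤ L * (1 + ‖B (ξ + icast k)‖) := by
    intro k
    have h1 : icast k = Bs (B (ξ + icast k)) - ξ := by
      have : Bs (B (ξ + icast k)) = ξ + icast k := B.symm_apply_apply _
      rw [this]; simp
    have h2 : ‖icast k‖ ≤ ‖Bs‖ * ‖B (ξ + icast k)‖ + ‖ξ‖ := by
      conv_lhs => rw [h1]
      exact (norm_sub_le _ _).trans (by gcongr; exact Bs.le_opNorm _)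
    have h3 := norm_nonneg (B (ξ + icast k))
    have h4 := norm_nonneg ξ
    have h5 := norm_nonneg Bs
    rw [hL]
    nlinarith [mul_nonneg h4 h3]
  set u : (ι → ℤ) → ℝ := fun k => C2 * L ^ (n + 1) * (1 + ‖icast k‖) ^ (-((n:ℝ) + 1)) with hu
  have hus : Summable u := by
    apply Summable.mul_left
    apply summable_one_add_norm
    rw [hcard]; linarith
  refine ⟨∑' k, u k, fun s hs1 hs2 => ?_⟩
  have hIntg : Integrable (fun x => ft W s (B x)) := by
    have h1 : (volume.map B : Measure (V → ℝ)).IsAddHaarMeasure := B.isAddHaarMeasure_map volume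
    have h2 := Measure.isAddLeftInvariant_eq_smul (volume.map B : Measure (V → ℝ)) volume
    have h3 : Integrable (ft W s) (volume.map B : Measure (V → ℝ)) := by
      rw [h2]; exact (ft_integrable hW hs1).smul_measure_nnreal
    exact ((B.toHomeomorph.measurableEmbedding).integrable_map_iff).mp h3
  have hzero : ∫ x, ft W s (B x) = 0 := by
    obtain ⟨c, _, hc⟩ := exists_measure_const B
    have := hc (fun x => (ft W s x : ℂ))
    rw [integral_complex_ofReal, integral_complex_ofReal, ft_integral] at this
    simpa using this
  have hH := hasSum_box _ hIntg
  rw [hzero] at hH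
  set H : (ι → ℤ) → ℝ := fun m => ∫ x in box ι, ft W s (B (x + icast m)) with hHdef
  have hbound : ∀ k : ι → ℤ, ‖ft W s (B (ξ + icast k)) - H k‖ ≤ u k := by
    intro k
    have hik : Integrable (fun x => ft W s (B (x + icast k))) := hIntg.comp_add_right (icast k)
    have hvol : (volume (box ι)) = 1 := volume_box
    have e : ft W s (B (ξ + icast k)) - H k =
        ∫ x in box ι, (ft W s (B (ξ + icast k)) - ft W s (B (x + icast k))) := by
      rw [integral_sub (by
        exact integrableOn_const (by rw [hvol]; simp) (by simp)) hik.integrableOn]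
      rw [setIntegral_const, measureReal_def, hvol]
      simp [hHdef]
    rw [e]
    have hb := norm_setIntegral_le_of_norm_le_const (μ := volume) (s := box ι) (C := u k)
      (f := fun x => ft W s (B (ξ + icast k)) - ft W s (B (x + icast k))) (by rw [hvol]; simp)
      (by
        intro x hx
        have hxy : ‖B (ξ + icast k) - B (x + icast k)‖ ≤ D := by
          rw [← map_sub]
          have : ξ + icast k - (x + icast k) = ξ - x := by abel
          rw [this]
          refine (Bc.le_opNorm _).trans ?_
          rw [hD]; gcongr
          refine (norm_sub_le _ _).trans ?_
          gcongr
          exact box_norm_le hx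
        refine (hdiff s hs1.le hs2 _ _ hxy).trans ?_
        rw [hu]; simp only
        rw [Real.rpow_neg (by positivity), ← div_eq_mul_inv, div_le_div_iff₀ (by positivity) (by positivity)]
        have : ((n:ℝ) + 1) = ((n + 1 : ℕ) : ℝ) := by push_cast; rfl
        rw [this, Real.rpow_natCast, mul_assoc, ← mul_pow]
        gcongr
        exact hlow k)
    rw [measureReal_def, hvol] at hb
    simpa using hb
  have hds : Summable (fun k => ft W s (B (ξ + icast k)) - H k) := hus.of_norm_bounded hbound
  have hfs : Summable (fun k => ft W s (B (ξ + icast k))) := by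
    have := hds.add hH.summable
    simpa using this
  refine ⟨hfs, ?_⟩
  have e2 : ∑' k, ft W s (B (ξ + icast k)) = ∑' k, (ft W s (B (ξ + icast k)) - H k) := by
    rw [hfs.tsum_sub hH.summable, hH.tsum_eq, sub_zero]
  rw [e2, ← Real.norm_eq_abs]
  exact tsum_of_norm_bounded hus.hasSum hbound

end Lattice
end CMNorm

namespace CMNorm
open MeasureTheory Complex NumberField Filter Topology
open scoped Real BigOperators
set_option linter.unusedSectionVars false

section Tent

/-- tent function -/
noncomputable def tent (t : ℝ) : ℝ := max 0 (1 - |t|)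

lemma tent_nonneg (t : ℝ) : 0 ≤ tent t := le_max_left _ _
lemma tent_le_one (t : ℝ) : tent t ≤ 1 := max_le zero_le_one (by linarith [abs_nonneg t])
lemma tent_lip (t t' : ℝ) : |tent t - tent t'| ≤ |t - t'| := by
  unfold tent
  rw [max_comm 0, max_comm 0]
  refine (abs_max_sub_max_le_abs (1 - |t|) (1 - |t'|) 0).trans ?_
  have : 1 - |t| - (1 - |t'|) = |t'| - |t| := by ring
  rw [this, abs_sub_comm t]
  exact abs_abs_sub_abs_le_abs_sub _ _
lemma tent_ne_zero {t : ℝ} (h : tent t ≠ 0) : |t| < 1 := by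
  by_contra h'
  push Not at h'
  exact h (max_eq_left (by linarith))

lemma tent_sum (t : ℝ) : ∑ k ∈ ({-⌊t⌋, -⌊t⌋ - 1} : Finset ℤ), tent (t + k) = 1 := by
  rw [Finset.sum_pair (by omega)]
  have h0 := Int.floor_le t
  have h1 := Int.lt_floor_add_one t
  push_cast
  unfold tent
  rw [abs_of_nonneg (by linarith : 0 ≤ t + -(⌊t⌋:ℝ)), abs_of_neg (by linarith : t + (-(⌊t⌋:ℝ) - 1) < 0),
    max_eq_right (by linarith), max_eq_right (by linarith)]
  ring

lemma tent_supp {t : ℝ} {k : ℤ} (h : tent (t + k) ≠ 0) : k ∈ ({-⌊t⌋, -⌊t⌋ - 1} : Finset ℤ) := by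
  have h2 := abs_lt.mp (tent_ne_zero h)
  have h0 := Int.floor_le t
  have h1 := Int.lt_floor_add_one t
  have a1 : (-⌊t⌋ - 2 : ℤ) < k := by
    have : ((-⌊t⌋ - 2 : ℤ) : ℝ) < k := by push_cast; linarith
    exact_mod_cast this
  have a2 : k < (-⌊t⌋ + 1 : ℤ) := by
    have : (k : ℝ) < ((-⌊t⌋ + 1 : ℤ) : ℝ) := by push_cast; linarith
    exact_mod_cast this
  simp only [Finset.mem_insert, Finset.mem_singleton]
  omega

lemma tent_hasSum {ρ : Type*} [Fintype ρ] [DecidableEq ρ] (t : ρ → ℝ) :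
    HasSum (fun e : ρ → ℤ => ∏ i, tent (t i + e i)) 1 := by
  set S : ρ → Finset ℤ := fun i => {-⌊t i⌋, -⌊t i⌋ - 1}
  have h1 : ∑ p ∈ Fintype.piFinset S, ∏ i, tent (t i + p i) = 1 := by
    have := Finset.prod_univ_sum S (fun i (k : ℤ) => tent (t i + k))
    rw [← this]
    exact Finset.prod_eq_one fun i _ => tent_sum (t i)
  rw [← h1]
  apply hasSum_sum_of_ne_finset_zero
  intro e he
  rw [Fintype.mem_piFinset] at he
  push Not at he
  obtain ⟨i, hi⟩ := he
  apply Finset.prod_eq_zero (Finset.mem_univ i)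
  by_contra h
  exact hi (tent_supp h)

lemma prod_lip {ρ : Type*} (s : Finset ρ) (a b : ρ → ℝ) (ha0 : ∀ i, 0 ≤ a i) (ha1 : ∀ i, a i ≤ 1)
    (hb0 : ∀ i, 0 ≤ b i) (hb1 : ∀ i, b i ≤ 1) :
    |∏ i ∈ s, a i - ∏ i ∈ s, b i| ≤ ∑ i ∈ s, |a i - b i| := by
  classical
  induction s using Finset.induction_on with
  | empty => simp
  | insert j s hj ih =>
    rw [Finset.prod_insert hj, Finset.prod_insert hj, Finset.sum_insert hj]
    have e : a j * ∏ i ∈ s, a i - b j * ∏ i ∈ s, b i =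
        (a j - b j) * ∏ i ∈ s, a i + b j * (∏ i ∈ s, a i - ∏ i ∈ s, b i) := by ring
    rw [e]
    refine (abs_add_le _ _).trans ?_
    rw [abs_mul, abs_mul, abs_of_nonneg (hb0 j)]
    have h1 : |∏ i ∈ s, a i| ≤ 1 := by
      rw [abs_of_nonneg (Finset.prod_nonneg fun i _ => ha0 i)]
      exact Finset.prod_le_one (fun i _ => ha0 i) (fun i _ => ha1 i)
    have h2 := abs_nonneg (a j - b j)
    have h3 := abs_nonneg (∏ i ∈ s, a i - ∏ i ∈ s, b i)
    nlinarith [hb1 j, hb0 j]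

end Tent

section Weight
variable (F : Type*) [Field F] [NumberField F] [IsTotallyReal F]
open NumberField.Units NumberField.Units.dirichletUnitTheorem

/-- projection to the log space -/
noncomputable def Plog : (InfinitePlace F → ℝ) →ₗ[ℝ] logSpace F where
  toFun z := fun w => z w.1 - (∑ v, z v) / Fintype.card (InfinitePlace F)
  map_add' := by
    intro a b; funext w
    simp only [Pi.add_apply, Finset.sum_add_distrib]; ring
  map_smul' := by
    intro c a; funext w
    simp only [Pi.smul_apply, smul_eq_mul, RingHom.id_apply, ← Finset.mul_sum]; ring

lemma Plog_apply (z : InfinitePlace F → ℝ) (w) :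
    Plog F z w = z w.1 - (∑ v, z v) / Fintype.card (InfinitePlace F) := rfl

/-- log vector of an element -/
noncomputable def lv (x : F) : InfinitePlace F → ℝ := fun v => Real.log |rv v x|

lemma abs_rv (v : InfinitePlace F) (x : F) : |rv v x| = v x := by
  rw [← InfinitePlace.norm_embedding_eq, ← rv_coe, Complex.norm_real, Real.norm_eq_abs]

lemma lv_mul {x y : F} (hx : x ≠ 0) (hy : y ≠ 0) : lv F (x * y) = lv F x + lv F y := by
  funext v
  have h1 : rv v x ≠ 0 := by simpa using hx
  have h2 : rv v y ≠ 0 := by simpa using hy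
  simp only [lv, Pi.add_apply, map_mul, abs_mul]
  rw [Real.log_mul (by simpa using h1) (by simpa using h2)]

lemma mult_one (v : InfinitePlace F) : (v.mult : ℝ) = 1 := by
  rw [InfinitePlace.mult_isReal ⟨v, IsTotallyReal.isReal v⟩]; simp

lemma Plog_unit (u : (𝓞 F)ˣ) : Plog F (lv F (u : 𝓞 F)) = logEmbedding F (Additive.ofMul u) := by
  funext w
  rw [Plog_apply]
  have h : ∑ v, lv F (u : 𝓞 F) v = 0 := by
    have := sum_mult_mul_log (K := F) u
    simp only [lv, abs_rv]
    rw [← this]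
    apply Finset.sum_congr rfl
    intro v _
    rw [mult_one, one_mul]
  rw [h, logEmbedding_component, mult_one]
  simp [lv, abs_rv]

open scoped Classical in
/-- basis of the log space -/
noncomputable def ub : Module.Basis (Fin (rank F)) ℝ (logSpace F) :=
  (basisUnitLattice F).ofZLatticeBasis ℝ (unitLattice F)

open scoped Classical in
lemma ub_apply (i : Fin (rank F)) : ub F i = basisUnitLattice F i :=
  Module.Basis.ofZLatticeBasis_apply ℝ (unitLattice F) (basisUnitLattice F) i

/-- the coordinates of the log vector -/
noncomputable def Tlog : (InfinitePlace F → ℝ) →ₗ[ℝ] (Fin (rank F) → ℝ) :=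
  (ub F).equivFun.toLinearMap ∘ₗ Plog F

lemma Tlog_fund (i j : Fin (rank F)) :
    Tlog F (lv F (fundSystem F i : 𝓞 F)) j = if i = j then 1 else 0 := by
  unfold Tlog
  rw [LinearMap.comp_apply, Plog_unit, logEmbedding_fundSystem]
  rw [← ub_apply]
  rw [LinearEquiv.coe_coe, Module.Basis.equivFun_self]

/-- additive version of `Tlog ∘ lv` on units -/
noncomputable def Tunit : (𝓞 F)ˣ →* Multiplicative (Fin (rank F) → ℝ) where
  toFun u := Multiplicative.ofAdd (Tlog F (lv F (u : 𝓞 F)))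
  map_one' := by
    have : lv F ((1 : (𝓞 F)ˣ) : 𝓞 F) = 0 := by funext v; simp [lv]
    rw [this]; simp
  map_mul' := by
    intro a b
    have : lv F ((a * b : (𝓞 F)ˣ) : 𝓞 F) = lv F (a : 𝓞 F) + lv F (b : 𝓞 F) := by
      rw [← lv_mul F (by simp) (by simp)]
      congr 1
    rw [this, map_add]; rfl

lemma Tlog_torsion {u : (𝓞 F)ˣ} (hu : u ∈ torsion F) : Tlog F (lv F (u : 𝓞 F)) = 0 := by
  unfold Tlog
  rw [LinearMap.comp_apply, Plog_unit, logEmbedding_eq_zero_iff.mpr hu, map_zero]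

lemma Tlog_unit (ζ : torsion F) (e : Fin (rank F) → ℤ) :
    Tlog F (lv F ((ζ.1 * ∏ i, (fundSystem F i) ^ (e i) : (𝓞 F)ˣ) : 𝓞 F)) = fun i => (e i : ℝ) := by
  have h : Multiplicative.toAdd (Tunit F (ζ.1 * ∏ i, (fundSystem F i) ^ (e i))) = fun i => (e i : ℝ) := by
    rw [map_mul, map_prod, toAdd_mul, toAdd_prod]
    have h0 : Multiplicative.toAdd (Tunit F ζ.1) = 0 := Tlog_torsion F ζ.2
    rw [h0, zero_add]
    funext j
    rw [Finset.sum_apply]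
    have : ∀ i, (Multiplicative.toAdd (Tunit F (fundSystem F i ^ e i))) j = if i = j then (e i : ℝ) else 0 := by
      intro i
      rw [map_zpow, toAdd_zpow, Pi.smul_apply]
      have h1 : Multiplicative.toAdd (Tunit F (fundSystem F i)) j = if i = j then 1 else 0 :=
        Tlog_fund F i j
      rw [h1]
      split_ifs <;> simp
    simp_rw [this]
    simp
  exact h

/-- units as product -/
noncomputable def unitEquiv : torsion F × (Fin (rank F) → ℤ) ≃ (𝓞 F)ˣ :=
  Equiv.ofBijective (fun p => p.1.1 * ∏ i, (fundSystem F i) ^ (p.2 i)) <| by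
    constructor
    · intro p q h
      exact (exist_unique_eq_mul_prod F _).unique rfl h
    · intro x
      obtain ⟨p, hp, _⟩ := exist_unique_eq_mul_prod F x
      exact ⟨p, hp.symm⟩

lemma unitEquiv_apply (p : torsion F × (Fin (rank F) → ℤ)) :
    unitEquiv F p = p.1.1 * ∏ i, (fundSystem F i) ^ (p.2 i) := rfl

lemma hasSum_torsion : HasSum (fun _ : torsion F => (1:ℝ)) (torsionOrder F : ℝ) := by
  have : Fintype (torsion F) := Fintype.ofFinite _
  have := hasSum_fintype (fun _ : torsion F => (1:ℝ))
  simpa [torsionOrder, Nat.card_eq_fintype_card] using this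

lemma hasSum_prod_aux {α β : Type*} {f : β → ℝ} {a : ℝ} (h1 : HasSum (fun _ : α => (1:ℝ)) a)
    (h2 : HasSum f 1) (hf : ∀ b, 0 ≤ f b) : HasSum (fun p : α × β => f p.2) a := by
  have h3 := h1.mul h2 (h1.summable.mul_of_nonneg h2.summable (fun _ => zero_le_one) hf)
  simpa using h3

lemma unit_sum (z : InfinitePlace F → ℝ) :
    HasSum (fun u : (𝓞 F)ˣ => ∏ i, tent (Tlog F (z + lv F (u : 𝓞 F)) i)) (torsionOrder F : ℝ) := by
  have h3 := hasSum_prod_aux (hasSum_torsion F) (tent_hasSum (Tlog F z))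
    (fun e => Finset.prod_nonneg fun i _ => tent_nonneg _)
  rw [← (unitEquiv F).hasSum_iff]
  convert h3 using 1
  funext p
  simp only [Function.comp_apply]
  apply Finset.prod_congr rfl
  intro i _
  rw [unitEquiv_apply, map_add, Tlog_unit F p.1 p.2]
  rfl

open scoped Classical in
theorem exists_weight : ∃ (W : (InfinitePlace F → ℝ) → ℝ) (CW A : ℝ), GoodW W CW A ∧
    ∀ z : InfinitePlace F → ℝ,
      HasSum (fun u : (𝓞 F)ˣ => W (z + lv F (u : 𝓞 F))) (torsionOrder F : ℝ) := by
  set T := LinearMap.toContinuousLinearMap (Tlog F) with hT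
  set b := ub F with hb
  set S := LinearMap.toContinuousLinearMap b.equivFun.symm.toLinearMap with hS
  set n : ℝ := (Fintype.card (InfinitePlace F) : ℝ) with hn
  have hn0 : 0 < n := by rw [hn]; exact_mod_cast Fintype.card_pos
  refine ⟨fun z => ∏ i, tent (Tlog F z i), rank F * ‖T‖, 2 * (n * ‖S‖ + ‖S‖), ⟨?_, ?_, ?_, ?_, ?_, ?_⟩, unit_sum F⟩
  · intro z; exact Finset.prod_nonneg fun i _ => tent_nonneg _
  · intro z; exact Finset.prod_le_one (fun i _ => tent_nonneg _) (fun i _ => tent_le_one _)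
  · positivity
  · positivity
  · intro z z'
    refine (prod_lip _ _ _ (fun _ => tent_nonneg _) (fun _ => tent_le_one _) (fun _ => tent_nonneg _) (fun _ => tent_le_one _)).trans ?_
    have : ∀ i ∈ (Finset.univ : Finset (Fin (rank F))), |tent (Tlog F z i) - tent (Tlog F z' i)| ≤ ‖T‖ * ‖z - z'‖ := by
      intro i _
      refine (tent_lip _ _).trans ?_
      have h1 : Tlog F z i - Tlog F z' i = T (z - z') i := by
        rw [map_sub]; rfl
      rw [h1, ← Real.norm_eq_abs]
      exact (norm_le_pi_norm _ i).trans (T.le_opNorm _)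
    refine (Finset.sum_le_sum this).trans ?_
    simp [mul_assoc]
  · intro z hz
    have h1 : ∀ i, |Tlog F z i| < 1 := by
      intro i
      exact tent_ne_zero (Finset.prod_ne_zero_iff.mp hz i (Finset.mem_univ i))
    have h2 : ‖Tlog F z‖ ≤ 1 := by
      rw [pi_norm_le_iff_of_nonneg zero_le_one]
      intro i; exact (h1 i).le
    have h3 : Plog F z = S (Tlog F z) := by
      have : S (Tlog F z) = b.equivFun.symm (b.equivFun (Plog F z)) := rfl
      rw [this, LinearEquiv.symm_apply_apply]
    have h4 : ‖Plog F z‖ ≤ ‖S‖ := by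
      rw [h3]
      refine (S.le_opNorm _).trans ?_
      exact mul_le_of_le_one_right (norm_nonneg _) h2
    set m := (∑ v, z v) / n with hm
    have h5 : ∀ v, v ≠ w₀ → |z v - m| ≤ ‖S‖ := by
      intro v hv
      exact (norm_le_pi_norm (Plog F z) ⟨v, hv⟩).trans h4
    have hsum : ∑ v, (z v - m) = 0 := by
      rw [Finset.sum_sub_distrib, Finset.sum_const, Finset.card_univ, nsmul_eq_mul, hm, ← hn]
      field_simp; ring
    have h6 : ∀ v, |z v - m| ≤ n * ‖S‖ + ‖S‖ := by
      intro v
      by_cases hv : v = w₀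
      · subst hv
        classical
        rw [← Finset.add_sum_erase _ _ (Finset.mem_univ (w₀ (K := F)))] at hsum
        have e : z w₀ - m = - ∑ v ∈ Finset.univ.erase (w₀ (K := F)), (z v - m) := by linarith
        rw [e, abs_neg]
        refine (Finset.abs_sum_le_sum_abs _ _).trans ?_
        refine (Finset.sum_le_sum (fun v hv => h5 v (Finset.ne_of_mem_erase hv))).trans ?_
        rw [Finset.sum_const, nsmul_eq_mul]
        have hc : ((Finset.univ.erase (w₀ (K := F))).card : ℝ) ≤ n := by
          rw [hn, ← Finset.card_univ]; exact_mod_cast Finset.card_le_card (Finset.erase_subset _ _)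
        nlinarith [norm_nonneg S]
      · have := h5 v hv
        nlinarith [norm_nonneg S]
    intro v v'
    have a1 := abs_le.mp (h6 v)
    have a2 := abs_le.mp (h6 v')
    linarith

end Weight
end CMNorm

namespace CMNorm
open MeasureTheory Complex NumberField Filter Topology
open scoped Real BigOperators
set_option linter.unusedSectionVars false

section AlphaSum
variable {F : Type*} [Field F] [NumberField F] [IsTotallyReal F]

/-- the real norm -/
noncomputable def PP (α : 𝓞 F) : ℝ := ∏ v : InfinitePlace F, rv v (α : F)

lemma PP_mul (a b : 𝓞 F) : PP (a * b) = PP a * PP b := by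
  unfold PP
  rw [← Finset.prod_mul_distrib]
  apply Finset.prod_congr rfl
  intro v _
  have e : ((a * b : 𝓞 F) : F) = (a : F) * b := rfl
  rw [e, map_mul]

lemma PP_ne {a : 𝓞 F} (ha : a ≠ 0) : PP a ≠ 0 := by
  unfold PP
  apply Finset.prod_ne_zero_iff.mpr
  intro v _
  simpa using ha

lemma PP_abs (a : 𝓞 F) : |PP a| = (Ideal.absNorm (Ideal.span {a}) : ℝ) := by
  rw [Ideal.absNorm_span_singleton, PP, ← norm_eq, Nat.cast_natAbs, Int.cast_abs]
  rw [← Algebra.coe_norm_int]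
  simp

structure Psi (N : 𝓞 F) (ψ : Ideal (𝓞 F) →*₀ ℂ) : Prop where
  N_ne : N ≠ 0
  bad : ∀ 𝔭 : Ideal (𝓞 F), 𝔭.IsMaximal → 𝔭 ≠ ⊥ → N ∈ 𝔭 → ψ 𝔭 = 0
  sign : ∀ a : 𝓞 F, a ≠ 0 → N ∣ a - 1 → ψ (Ideal.span {a}) * ((|PP a| : ℝ) : ℂ) = ((PP a : ℝ) : ℂ)

variable {N : 𝓞 F} {ψ : Ideal (𝓞 F) →*₀ ℂ}

lemma exists_eta (h : Psi N ψ) (a : 𝓞 F) : ∃ η : ℂ, ∀ α : 𝓞 F, α ≠ 0 → N ∣ α - a →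
    ψ (Ideal.span {α}) = η * ((PP α / |PP α| : ℝ) : ℂ) := by
  by_cases hco : IsCoprime a N
  · obtain ⟨b, hb0, hb⟩ : ∃ b : 𝓞 F, b ≠ 0 ∧ N ∣ a * b - 1 := by
      obtain ⟨u, v, huv⟩ := hco
      by_cases hu : u = 0
      · refine ⟨1, one_ne_zero, ?_⟩
        rw [hu, zero_mul, zero_add] at huv
        exact (IsUnit.of_mul_eq_one v (by rw [mul_comm]; exact huv)).dvd
      · refine ⟨u, hu, -v, ?_⟩
        linear_combination huv
    have key : ∀ α : 𝓞 F, α ≠ 0 → N ∣ α - a → ψ (Ideal.span {α}) * ψ (Ideal.span {b}) =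
        ((PP α / |PP α| : ℝ) : ℂ) * ((PP b / |PP b| : ℝ) : ℂ) := by
      intro α hα hαa
      have h1 : N ∣ α * b - 1 := by
        have : α * b - 1 = (α - a) * b + (a * b - 1) := by ring
        rw [this]; exact dvd_add (hαa.mul_right b) hb
      have h2 := h.sign (α * b) (mul_ne_zero hα hb0) h1
      rw [PP_mul, ← Ideal.span_singleton_mul_span_singleton, map_mul, abs_mul] at h2
      have h3 : ((|PP α| : ℝ) : ℂ) ≠ 0 := by exact_mod_cast abs_ne_zero.mpr (PP_ne hα)
      have h4 : ((|PP b| : ℝ) : ℂ) ≠ 0 := by exact_mod_cast abs_ne_zero.mpr (PP_ne hb0)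
      push_cast at h2 ⊢
      field_simp
      linear_combination h2
    have hsb : ((PP b / |PP b| : ℝ) : ℂ) ≠ 0 := by
      have := PP_ne hb0
      exact_mod_cast div_ne_zero this (abs_ne_zero.mpr this)
    by_cases hψ : ψ (Ideal.span {b}) = 0
    · refine ⟨0, fun α hα hαa => ?_⟩
      have := key α hα hαa
      rw [hψ, mul_zero] at this
      have h5 : ((PP α / |PP α| : ℝ) : ℂ) ≠ 0 := by
        have := PP_ne hα
        exact_mod_cast div_ne_zero this (abs_ne_zero.mpr this)
      exact absurd this.symm (mul_ne_zero h5 hsb)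
    · refine ⟨((PP b / |PP b| : ℝ) : ℂ) / ψ (Ideal.span {b}), fun α hα hαa => ?_⟩
      have := key α hα hαa
      field_simp
      rw [this]; ring
  · refine ⟨0, fun α hα hαa => ?_⟩
    rw [zero_mul]
    have hne : Ideal.span {a, N} ≠ ⊤ := by
      intro htop
      apply hco
      rw [Ideal.eq_top_iff_one, Ideal.mem_span_pair] at htop
      exact htop
    obtain ⟨𝔭, hmax, hle⟩ := Ideal.exists_le_maximal _ hne
    have ha : a ∈ 𝔭 := hle (Ideal.subset_span (by simp))
    have hN : N ∈ 𝔭 := hle (Ideal.subset_span (by simp))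
    have hbot : 𝔭 ≠ ⊥ := by
      rintro rfl
      exact h.N_ne (by simpa using hN)
    have hα' : α ∈ 𝔭 := by
      have : α = (α - a) + a := by ring
      rw [this]
      exact 𝔭.add_mem (Ideal.mem_of_dvd _ hαa hN) ha
    obtain ⟨𝔠, hc⟩ : 𝔭 ∣ Ideal.span {α} := by
      rw [Ideal.dvd_span_singleton]; exact hα'
    rw [hc, map_mul, h.bad 𝔭 hmax hbot hN, zero_mul]

open scoped Classical in
/-- weighted summand -/
noncomputable def fa (ψ : Ideal (𝓞 F) →*₀ ℂ) (W : (InfinitePlace F → ℝ) → ℝ) (𝔟 : Ideal (𝓞 F)) (s : ℝ)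
    (α : 𝓞 F) : ℂ :=
  if α ∈ 𝔟 then
    ψ (Ideal.span {α}) * (((max |PP α| 1) ^ (-s) * W (lv F (α : F)) : ℝ) : ℂ) else 0

lemma ft_rv (W : (InfinitePlace F → ℝ) → ℝ) (s : ℝ) (α : 𝓞 F) :
    ft W s (fun v => rv v (α : F)) = PP α / |PP α| * ((max |PP α| 1) ^ (-s) * W (lv F (α : F))) := by
  rw [← mul_assoc]; rfl

lemma hasSum_congr_aux {β : Type*} {f g : β → ℂ} {a : ℂ} (h : ∀ b, f b = g b)
    (hg : HasSum g a) : HasSum f a := by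
  rw [funext h]; exact hg

theorem coset_bound {W : (InfinitePlace F → ℝ) → ℝ} {CW A : ℝ} (hW : GoodW W CW A)
    {m : ℕ} (hm : m ≠ 0) (a : 𝓞 F) :
    ∃ C : ℝ, ∀ s : ℝ, 1 < s → s ≤ 2 →
      Summable (fun x : 𝓞 F => ft W s (fun v => rv v ((a + m * x : 𝓞 F) : F))) ∧
      |∑' x : 𝓞 F, ft W s (fun v => rv v ((a + m * x : 𝓞 F) : F))| ≤ C := by
  have hm' : (m : ℝ) ≠ 0 := by exact_mod_cast hm
  have hmF : (m : F) ≠ 0 := by exact_mod_cast hm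
  set B : (Idx F → ℝ) ≃L[ℝ] (InfinitePlace F → ℝ) :=
    (Beq F).trans (ContinuousLinearEquiv.smulLeft (Units.mk0 (m:ℝ) hm')) with hB
  set ξ : Idx F → ℝ := fun i => (((integralBasis F).repr ((a : F) / m) i : ℚ) : ℝ)
  obtain ⟨C, hC⟩ := lattice_bound (card_eq F) hW B ξ
  have e : ∀ x : 𝓞 F, B (ξ + icast (basEquiv F x)) = fun v => rv v ((a + m * x : 𝓞 F) : F) := by
    intro x
    funext v
    have h1 : B (ξ + icast (basEquiv F x)) v = m * Beq F (ξ + icast (basEquiv F x)) v := rfl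
    rw [h1, Beq_bas]
    have h2 : ((a + m * x : 𝓞 F) : F) = m * ((x : F) + (a : F) / m) := by
      push_cast; field_simp; ring
    rw [h2, map_mul, map_natCast]
  refine ⟨C, fun s h1 h2 => ?_⟩
  obtain ⟨h3, h4⟩ := hC s h1 h2
  have e2 : (fun x : 𝓞 F => ft W s (fun v => rv v ((a + m * x : 𝓞 F) : F))) =
      (fun k => ft W s (B (ξ + icast k))) ∘ (basEquiv F) := by
    funext x; simp only [Function.comp_apply]; rw [e]
  rw [e2]
  refine ⟨(basEquiv F).summable_iff.mpr h3, ?_⟩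
  have := (basEquiv F).tsum_eq (fun k => ft W s (B (ξ + icast k)))
  change |∑' x, ft W s (B (ξ + icast (basEquiv F x)))| ≤ C
  rw [this]
  exact h4

theorem alpha_bound (h : Psi N ψ) {W : (InfinitePlace F → ℝ) → ℝ} {CW A : ℝ} (hW : GoodW W CW A)
    {𝔟 : Ideal (𝓞 F)} (hb : 𝔟 ≠ ⊥) :
    ∃ C : ℝ, ∀ s : ℝ, 1 < s → s ≤ 2 → Summable (fa ψ W 𝔟 s) ∧ ‖∑' α, fa ψ W 𝔟 s α‖ ≤ C := by
  classical
  set 𝔠 := Ideal.span {N} * 𝔟 with h𝔠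
  have hc0 : 𝔠 ≠ ⊥ := by
    rw [h𝔠]
    exact mul_ne_zero (by simpa using h.N_ne) (show 𝔟 ≠ 0 from hb)
  set m := Ideal.absNorm 𝔠 with hm
  have hm0 : m ≠ 0 := by rw [hm]; exact Ideal.absNorm_ne_zero_iff_mem_nonZeroDivisors.mpr (mem_nonZeroDivisors_of_ne_zero hc0)
  have hmc : (m : 𝓞 F) ∈ 𝔠 := Ideal.absNorm_mem 𝔠
  have hmN : N ∣ (m : 𝓞 F) := by
    rw [← Ideal.mem_span_singleton]; exact Ideal.mul_le_left hmc
  have hmb : (m : 𝓞 F) ∈ 𝔟 := Ideal.mul_le_right hmc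
  have hmO : (m : 𝓞 F) ≠ 0 := by exact_mod_cast hm0
  set Q := 𝓞 F ⧸ Ideal.span {(m : 𝓞 F)}
  have hQ : Finite Q := finq (by simpa using hm0)
  have : Fintype Q := Fintype.ofFinite Q
  choose η hη using exists_eta h
  choose Cq hCq using fun q : Q => coset_bound hW hm0 q.out
  have key : ∀ s : ℝ, 1 < s → s ≤ 2 → ∀ q : Q, HasSum
      (fun α : 𝓞 F => if Ideal.Quotient.mk (Ideal.span {(m : 𝓞 F)}) α = q then fa ψ W 𝔟 s α else 0)
      ((if q.out ∈ 𝔟 then η q.out else 0) * ((∑' x : 𝓞 F, ft W s (fun v => rv v ((q.out + m * x : 𝓞 F) : F)) : ℝ) : ℂ)) := by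
    intro s h1 h2 q
    have hinj : Function.Injective (fun x : 𝓞 F => q.out + (m : 𝓞 F) * x) := by
      intro x y hxy
      simpa [hmO] using hxy
    rw [← hinj.hasSum_iff]
    · have h3 := ((Complex.hasSum_ofReal.mpr (hCq q s h1 h2).1.hasSum)).mul_left (if q.out ∈ 𝔟 then η q.out else 0)
      refine (hasSum_congr_aux ?_) h3
      intro x
      simp only [Function.comp_apply]
      have hq : Ideal.Quotient.mk (Ideal.span {(m : 𝓞 F)}) (q.out + (m : 𝓞 F) * x) = q := by
        rw [map_add, mk_out, Ideal.Quotient.eq_zero_iff_mem.mpr, add_zero]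
        exact Ideal.mem_span_singleton.mpr (dvd_mul_right _ _)
      rw [if_pos hq]
      unfold fa
      have hmem : (q.out + (m : 𝓞 F) * x) ∈ 𝔟 ↔ q.out ∈ 𝔟 :=
        Ideal.add_mem_iff_left _ (𝔟.mul_mem_right x hmb)
      by_cases hqb : q.out ∈ 𝔟
      · rw [if_pos (hmem.mpr hqb), if_pos hqb, ft_rv]
        by_cases h0 : q.out + (m : 𝓞 F) * x = 0
        · rw [h0]
          simp [PP]
          left; exact map_zero ψ
        · rw [hη q.out _ h0 (by
            have : q.out + (m : 𝓞 F) * x - q.out = (m : 𝓞 F) * x := by ring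
            rw [this]; exact hmN.mul_right x)]
          push_cast
          ring
      · rw [if_neg (fun hh => hqb (hmem.mp hh)), if_neg hqb, zero_mul]
    · intro α hα
      rw [if_neg]
      intro hq
      apply hα
      have := out_sub_mem (𝔞 := Ideal.span {(m : 𝓞 F)}) α
      rw [hq] at this
      obtain ⟨t, ht⟩ := Ideal.mem_span_singleton.mp this
      exact ⟨t, by simp only; rw [← ht]; ring⟩
  refine ⟨∑ q : Q, ‖(if q.out ∈ 𝔟 then η q.out else 0)‖ * Cq q, fun s h1 h2 => ?_⟩
  have hs := hasSum_sum (s := Finset.univ) (fun q (_ : q ∈ Finset.univ) => key s h1 h2 q)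
  have e : (fun α : 𝓞 F => ∑ q : Q, if Ideal.Quotient.mk (Ideal.span {(m : 𝓞 F)}) α = q then fa ψ W 𝔟 s α else 0) =
      fa ψ W 𝔟 s := by
    funext α; simp [Q]
  rw [e] at hs
  refine ⟨hs.summable, ?_⟩
  rw [hs.tsum_eq]
  refine (norm_sum_le _ _).trans (Finset.sum_le_sum fun q _ => ?_)
  rw [norm_mul, Complex.norm_real]
  exact mul_le_mul_of_nonneg_left (hCq q s h1 h2).2 (norm_nonneg _)

end AlphaSum
end CMNorm

namespace CMNorm
open MeasureTheory Complex NumberField Filter Topology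
open scoped Real BigOperators nonZeroDivisors
set_option linter.unusedSectionVars false

section ClassSum
variable {F : Type*} [Field F] [NumberField F]

/-- ideal belongs to the class -/
def InCl (c : ClassGroup (𝓞 F)) (𝔪 : Ideal (𝓞 F)) : Prop :=
  ∃ h : 𝔪 ∈ (Ideal (𝓞 F))⁰, ClassGroup.mk0 ⟨𝔪, h⟩ = c

/-- the norm power -/
noncomputable def nn (s : ℝ) (𝔪 : Ideal (𝓞 F)) : ℂ := (((Ideal.absNorm 𝔪 : ℝ) ^ (-s) : ℝ) : ℂ)

lemma nn_mul (s : ℝ) (𝔪 𝔫 : Ideal (𝓞 F)) : nn s (𝔪 * 𝔫) = nn s 𝔪 * nn s 𝔫 := by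
  unfold nn
  rw [map_mul]
  push_cast
  rw [Real.mul_rpow (by positivity) (by positivity)]
  push_cast; rfl

lemma absNorm_ne {𝔪 : Ideal (𝓞 F)} (h : 𝔪 ≠ ⊥) : Ideal.absNorm 𝔪 ≠ 0 :=
  Ideal.absNorm_ne_zero_iff_mem_nonZeroDivisors.mpr
    (mem_nonZeroDivisors_of_ne_zero (show 𝔪 ≠ 0 from h))

lemma nn_ne (s : ℝ) {𝔪 : Ideal (𝓞 F)} (h : 𝔪 ≠ ⊥) : nn s 𝔪 ≠ 0 := by
  unfold nn
  have := absNorm_ne h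
  have h2 : (0:ℝ) < Ideal.absNorm 𝔪 := by positivity
  exact_mod_cast (Real.rpow_pos_of_pos h2 (-s)).ne'

variable [IsTotallyReal F] {N : 𝓞 F} {ψ : Ideal (𝓞 F) →*₀ ℂ}

open scoped Classical in
/-- class summand -/
noncomputable def Phi (ψ : Ideal (𝓞 F) →*₀ ℂ) (c : ClassGroup (𝓞 F)) (s : ℝ) (𝔪 : Ideal (𝓞 F)) : ℂ :=
  if InCl c 𝔪 then ψ 𝔪 * nn s 𝔪 else 0

lemma lv_unit_mul {α : 𝓞 F} (hα : α ≠ 0) (u : (𝓞 F)ˣ) :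
    lv F ((α * u : 𝓞 F) : F) = lv F (α : F) + lv F ((u : 𝓞 F) : F) := by
  have e : ((α * u : 𝓞 F) : F) = (α : F) * ((u : 𝓞 F) : F) := rfl
  rw [e, lv_mul]
  · simpa using hα
  · simp

lemma max_PP {α : 𝓞 F} (hα : α ≠ 0) : max |PP α| 1 = (Ideal.absNorm (Ideal.span {α}) : ℝ) := by
  rw [PP_abs, max_eq_left]
  have := absNorm_ne (F := F) (𝔪 := Ideal.span {α}) (by simpa using hα)
  exact_mod_cast Nat.one_le_iff_ne_zero.mpr this

open scoped Classical in
lemma fiber_sum {W : (InfinitePlace F → ℝ) → ℝ}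
    (hWs : ∀ z : InfinitePlace F → ℝ,
      HasSum (fun u : (𝓞 F)ˣ => W (z + lv F ((u : 𝓞 F) : F))) (Units.torsionOrder F : ℝ))
    (𝔟 : Ideal (𝓞 F)) (s : ℝ) (I : Ideal (𝓞 F)) :
    ∑' α : (fun α : 𝓞 F => Ideal.span {α}) ⁻¹' {I}, fa ψ W 𝔟 s α =
      if I ≤ 𝔟 ∧ Submodule.IsPrincipal I ∧ I ≠ ⊥ then ψ I * nn s I * (Units.torsionOrder F : ℂ) else 0 := by
  split_ifs with hI
  · obtain ⟨hIb, ⟨α, hα⟩, hI0⟩ := hI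
    have hα : I = Ideal.span {α} := hα
    have hα0 : α ≠ 0 := by
      rintro rfl; apply hI0; rw [hα]; simp
    have hαb : α ∈ 𝔟 := hIb (by rw [hα]; exact Ideal.mem_span_singleton_self α)
    let e : (𝓞 F)ˣ ≃ (fun α : 𝓞 F => Ideal.span {α}) ⁻¹' {I} := Equiv.ofBijective
      (fun u => ⟨α * u, by
        show Ideal.span {α * (u : 𝓞 F)} = I
        rw [hα, Ideal.span_singleton_mul_right_unit u.isUnit]⟩) (by
        constructor
        · intro u u' h
          have := congrArg Subtype.val h
          simp only at this
          exact Units.ext (mul_left_cancel₀ hα0 this)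
        · rintro ⟨β, hβ⟩
          have hβ : Ideal.span {β} = I := hβ
          rw [hα, Ideal.span_singleton_eq_span_singleton] at hβ
          obtain ⟨u, hu⟩ := hβ.symm
          exact ⟨u, Subtype.ext hu⟩)
    rw [← e.tsum_eq]
    have he : ∀ u : (𝓞 F)ˣ, fa ψ W 𝔟 s (e u) =
        ψ I * nn s I * ((W (lv F (α : F) + lv F ((u : 𝓞 F) : F)) : ℝ) : ℂ) := by
      intro u
      have h1 : ((e u) : 𝓞 F) = α * u := rfl
      have h2 : Ideal.span {α * (u : 𝓞 F)} = I := by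
        rw [hα, Ideal.span_singleton_mul_right_unit u.isUnit]
      rw [h1]
      unfold fa
      rw [if_pos (𝔟.mul_mem_right _ hαb), max_PP (mul_ne_zero hα0 u.ne_zero), h2, lv_unit_mul hα0]
      unfold nn
      push_cast
      ring
    simp_rw [he]
    have h3 := (Complex.hasSum_ofReal.mpr (hWs (lv F (α : F)))).mul_left (ψ I * nn s I)
    rw [h3.tsum_eq]
    push_cast; rfl
  · refine (tsum_congr ?_).trans tsum_zero
    rintro ⟨α, hα⟩
    have hα : Ideal.span {α} = I := hα
    unfold fa
    simp only
    by_cases hα0 : α = 0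
    · subst hα0
      have : ψ (Ideal.span {0}) = 0 := by
        have e : Ideal.span {(0 : 𝓞 F)} = 0 := by simp
        rw [e, map_zero]
      rw [this]; simp
    · rw [if_neg]
      intro hmem
      apply hI
      refine ⟨?_, ⟨α, hα.symm⟩, ?_⟩
      · rw [← hα, Ideal.span_singleton_le_iff_mem]; exact hmem
      · rw [← hα]; simpa using hα0


lemma InCl_iff {c : ClassGroup (𝓞 F)} {𝔟 𝔪 : Ideal (𝓞 F)} (hb : InCl c⁻¹ 𝔟) :
    InCl c 𝔪 ↔ Submodule.IsPrincipal (𝔪 * 𝔟) ∧ 𝔪 * 𝔟 ≠ ⊥ := by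
  obtain ⟨hb0, hbc⟩ := hb
  have hb1 : 𝔟 ≠ 0 := nonZeroDivisors.ne_zero hb0
  constructor
  · rintro ⟨hm, hmc⟩
    have h1 : ClassGroup.mk0 (⟨𝔪, hm⟩ * ⟨𝔟, hb0⟩ : (Ideal (𝓞 F))⁰) = 1 := by
      rw [map_mul, hmc, hbc, mul_inv_cancel]
    exact ⟨(ClassGroup.mk0_eq_one_iff _).mp h1, mul_ne_zero (nonZeroDivisors.ne_zero hm) hb1⟩
  · rintro ⟨hp, hne⟩
    have hm0 : 𝔪 ≠ 0 := by rintro rfl; exact hne (zero_mul _)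
    have hm : 𝔪 ∈ (Ideal (𝓞 F))⁰ := mem_nonZeroDivisors_of_ne_zero hm0
    refine ⟨hm, ?_⟩
    have h1 : ClassGroup.mk0 (⟨𝔪, hm⟩ * ⟨𝔟, hb0⟩ : (Ideal (𝓞 F))⁰) = 1 :=
      (ClassGroup.mk0_eq_one_iff _).mpr hp
    rw [map_mul, hbc] at h1
    exact mul_inv_eq_one.mp h1

theorem class_bound (h : Psi N ψ) (c : ClassGroup (𝓞 F)) :
    ∃ C : ℝ, ∀ s : ℝ, 1 < s → s ≤ 2 → ‖∑' 𝔪, Phi ψ c s 𝔪‖ ≤ C := by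
  classical
  by_cases hex : ∃ 𝔪₀, InCl c 𝔪₀ ∧ ψ 𝔪₀ ≠ 0
  swap
  · refine ⟨0, fun s _ _ => ?_⟩
    have : ∀ 𝔪, Phi ψ c s 𝔪 = 0 := by
      intro 𝔪
      unfold Phi
      split_ifs with h1
      · by_cases h2 : ψ 𝔪 = 0
        · rw [h2, zero_mul]
        · exact absurd ⟨𝔪, h1, h2⟩ hex
      · rfl
    rw [tsum_congr this]; simp
  obtain ⟨𝔪₀, ⟨hm0, hmc⟩, hψ0⟩ := hex
  set k := Fintype.card (ClassGroup (𝓞 F)) - 1 with hk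
  set 𝔟 := 𝔪₀ ^ k with h𝔟
  have hbc : InCl c⁻¹ 𝔟 := by
    refine ⟨pow_mem hm0 k, ?_⟩
    have e : (⟨𝔪₀ ^ k, pow_mem hm0 k⟩ : (Ideal (𝓞 F))⁰) = ⟨𝔪₀, hm0⟩ ^ k := rfl
    rw [e, map_pow, hmc, eq_inv_iff_mul_eq_one, ← pow_succ, hk,
      Nat.sub_add_cancel Fintype.card_pos, pow_card_eq_one]
  have hψb : ψ 𝔟 ≠ 0 := by rw [h𝔟, map_pow]; exact pow_ne_zero _ hψ0
  have hb0 : 𝔟 ≠ ⊥ := nonZeroDivisors.ne_zero hbc.1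
  obtain ⟨W, CW, A, hW, hWs⟩ := exists_weight F
  obtain ⟨C, hC⟩ := alpha_bound h hW hb0
  set w : ℝ := (Units.torsionOrder F : ℝ) with hw
  have hw0 : 0 < w := by
    rw [hw]; exact_mod_cast (Nat.pos_of_ne_zero (NeZero.ne (Units.torsionOrder F)))
  refine ⟨C * (‖ψ 𝔟‖⁻¹ * (Ideal.absNorm 𝔟 : ℝ) ^ (2:ℝ) * w⁻¹), fun s h1 h2 => ?_⟩
  obtain ⟨hsum, hbd⟩ := hC s h1 h2
  have h3 := hsum.hasSum.tsum_fiberwise (fun α : 𝓞 F => Ideal.span {α})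
  simp_rw [fiber_sum hWs] at h3
  have hinj : Function.Injective (fun 𝔪 : Ideal (𝓞 F) => 𝔪 * 𝔟) :=
    fun x y hxy => mul_right_cancel₀ (show 𝔟 ≠ 0 from hb0) hxy
  have h4 := hinj.tsum_eq (f := fun I : Ideal (𝓞 F) => if I ≤ 𝔟 ∧ Submodule.IsPrincipal I ∧ I ≠ ⊥ then
      ψ I * nn s I * (Units.torsionOrder F : ℂ) else 0) (by
    intro I hI
    rw [Function.mem_support] at hI
    have : I ≤ 𝔟 := by
      by_contra h'
      exact hI (if_neg fun h => h' h.1)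
    obtain ⟨𝔪, rfl⟩ := Ideal.dvd_iff_le.mpr this
    exact ⟨𝔪, mul_comm _ _⟩)
  rw [h3.tsum_eq] at h4
  have h5 : ∀ 𝔪 : Ideal (𝓞 F), (if 𝔪 * 𝔟 ≤ 𝔟 ∧ Submodule.IsPrincipal (𝔪 * 𝔟) ∧ 𝔪 * 𝔟 ≠ ⊥ then
      ψ (𝔪 * 𝔟) * nn s (𝔪 * 𝔟) * (Units.torsionOrder F : ℂ) else 0) =
      Phi ψ c s 𝔪 * (ψ 𝔟 * nn s 𝔟 * (w : ℂ)) := by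
    intro 𝔪
    unfold Phi
    have hle : 𝔪 * 𝔟 ≤ 𝔟 := Ideal.mul_le_right
    by_cases hin : InCl c 𝔪
    · rw [if_pos hin, if_pos ⟨hle, (InCl_iff hbc).mp hin⟩, map_mul, nn_mul, hw]
      push_cast; ring
    · rw [if_neg hin, if_neg (fun h => hin ((InCl_iff hbc).mpr h.2)), zero_mul]
  rw [tsum_congr h5, tsum_mul_right] at h4
  have hK : ψ 𝔟 * nn s 𝔟 * (w : ℂ) ≠ 0 :=
    mul_ne_zero (mul_ne_zero hψb (nn_ne s hb0)) (by exact_mod_cast hw0.ne')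
  rw [eq_div_of_mul_eq hK h4, norm_div, div_eq_mul_inv]
  have hn0 : (1:ℝ) ≤ Ideal.absNorm 𝔟 := by
    exact_mod_cast Nat.one_le_iff_ne_zero.mpr (absNorm_ne hb0)
  have hC0 : 0 ≤ C := (norm_nonneg _).trans hbd
  gcongr
  rw [norm_mul, norm_mul, mul_inv, mul_inv]
  have e1 : ‖nn s 𝔟‖⁻¹ = (Ideal.absNorm 𝔟 : ℝ) ^ s := by
    unfold nn
    rw [Complex.norm_real, Real.norm_eq_abs, abs_of_nonneg (by positivity), Real.rpow_neg (by positivity), inv_inv]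
  have e2 : ‖(w : ℂ)‖⁻¹ = w⁻¹ := by rw [Complex.norm_real, Real.norm_eq_abs, abs_of_pos hw0]
  rw [e1, e2]
  gcongr

end ClassSum
end CMNorm

namespace CMNorm
open MeasureTheory Complex NumberField Filter Topology
open scoped Real BigOperators nonZeroDivisors
set_option linter.unusedSectionVars false

section Count

lemma count_series {T : Type*} (g : T → ℕ) (hfin : ∀ n, {t | g t = n}.Finite) (hpos : ∀ t, 0 < g t)
    (l : ℝ) (hlim : Tendsto (fun x : ℝ => (Nat.card {t // (g t : ℝ) ≤ x} : ℝ) / x) atTop (𝓝 l)) :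
    (∀ s : ℝ, 1 < s → Summable (fun t => (g t : ℝ) ^ (-s))) ∧
    Tendsto (fun s : ℝ => (s - 1) * ∑' t, (g t : ℝ) ^ (-s)) (𝓝[>] 1) (𝓝 l) := by
  classical
  set a : ℕ → ℝ := fun n => (Nat.card {t // g t = n} : ℝ) with ha
  have ha0 : ∀ n, 0 ≤ a n := fun n => Nat.cast_nonneg _
  have hpart : ∀ n : ℕ, ∑ k ∈ Finset.Icc 1 n, a k = (Nat.card {t // (g t : ℝ) ≤ n} : ℝ) := by
    intro n
    simp only [ha]
    rw [← Nat.cast_sum, ← Finset.card_preimage_eq_sum_card_image_eq (fun k _ => hfin k)]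
    congr 1
    refine Nat.card_congr (Equiv.subtypeEquivRight fun t => ?_)
    simp only [Set.mem_preimage, Finset.coe_Icc, Set.mem_Icc, Nat.cast_le]
    exact ⟨fun h => h.2, fun h => ⟨hpos t, h⟩⟩
  have hl1 : Tendsto (fun n : ℕ => (∑ k ∈ Finset.Icc 1 n, a k) / n) atTop (𝓝 l) := by
    refine (hlim.comp tendsto_natCast_atTop_atTop).congr fun n => ?_
    simp only [Function.comp_apply, hpart]
  have hres := LSeries_tendsto_sub_mul_nhds_one_of_tendsto_sum_div_and_nonneg a hl1 ha0
  have hO : (fun n : ℕ => ∑ k ∈ Finset.Icc 1 n, a k) =O[atTop] fun n : ℕ => (n : ℝ) ^ (1:ℝ) := by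
    have h1 := hl1.isBigO_one ℝ
    have h2 := h1.mul (Asymptotics.isBigO_refl (fun n : ℕ => (n : ℝ)) atTop)
    refine (h2.congr' ?_ ?_)
    · filter_upwards [eventually_ne_atTop 0] with n hn
      have : (n : ℝ) ≠ 0 := by exact_mod_cast hn
      field_simp
    · exact Eventually.of_forall fun n => by simp
  have hfib : ∀ (s : ℝ) (n : ℕ), HasSum (fun y : {t // g t = n} => (g y.1 : ℝ) ^ (-s)) (a n * (n:ℝ) ^ (-s)) := by
    intro s n
    have : Finite {t // g t = n} := hfin n
    have := Fintype.ofFinite {t // g t = n}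
    have e : ∀ y : {t // g t = n}, (g y.1 : ℝ) ^ (-s) = (n:ℝ) ^ (-s) := fun y => by rw [y.2]
    simp only [e]
    convert hasSum_fintype (fun y : {t // g t = n} => (n:ℝ) ^ (-s)) using 1
    simp [ha, Nat.card_eq_fintype_card]
  have ha00 : a 0 = 0 := by
    simp only [ha, Nat.cast_eq_zero]
    have : IsEmpty {t // g t = 0} := ⟨fun t => (hpos t.1).ne' t.2⟩
    exact Nat.card_of_isEmpty
  have hterm : ∀ (s : ℝ) (n : ℕ), LSeries.term (fun n => (a n : ℂ)) (s : ℂ) n = ((a n * (n:ℝ) ^ (-s) : ℝ) : ℂ) := by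
    intro s n
    rw [LSeries.term_def]
    split_ifs with h
    · subst h; simp [ha00]
    · rw [Real.rpow_neg (by positivity)]
      push_cast
      rw [div_eq_mul_inv, Complex.ofReal_cpow (by positivity)]
      simp
  have hsum : ∀ s : ℝ, 1 < s → Summable (fun n : ℕ => a n * (n:ℝ) ^ (-s)) := by
    intro s hs
    have := LSeriesSummable_of_sum_norm_bigO_and_nonneg (s := (s:ℂ)) hO ha0 zero_le_one (by simpa using hs)
    unfold LSeriesSummable at this
    have h2 := this.congr (g := fun n : ℕ => ((a n * (n:ℝ) ^ (-s) : ℝ) : ℂ)) (fun n => hterm s n)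
    exact Complex.summable_ofReal.mp h2
  have hsig : ∀ s : ℝ, 1 < s → HasSum (fun t => (g t : ℝ) ^ (-s)) (∑' n : ℕ, a n * (n:ℝ) ^ (-s)) := by
    intro s hs
    rw [← (Equiv.sigmaFiberEquiv g).hasSum_iff]
    have hS : Summable ((fun t => (g t : ℝ) ^ (-s)) ∘ (Equiv.sigmaFiberEquiv g)) := by
      rw [summable_sigma_of_nonneg (fun x => by simp only [Function.comp_apply]; positivity)]
      refine ⟨fun n => (hfib s n).summable, ?_⟩
      refine (hsum s hs).congr fun n => ?_
      exact (hfib s n).tsum_eq.symm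
    have := hS.hasSum.sigma (fun n => hfib s n)
    rw [this.tsum_eq]
    exact hS.hasSum
  refine ⟨fun s hs => (hsig s hs).summable, ?_⟩
  rw [← tendsto_ofReal_iff]
  refine hres.congr' ?_
  filter_upwards [self_mem_nhdsWithin] with s hs
  rw [(hsig s hs).tsum_eq]
  push_cast
  rw [LSeries]
  congr 1
  refine tsum_congr fun n => ?_
  rw [hterm]; push_cast; rfl

end Count

section ClassZeta
variable {F : Type*} [Field F] [NumberField F]

open Classical in
/-- partial zeta function of a class -/
noncomputable def zt (c : ClassGroup (𝓞 F)) (s : ℝ) : ℝ :=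
  ∑' 𝔪 : Ideal (𝓞 F), if InCl c 𝔪 then (Ideal.absNorm 𝔪 : ℝ) ^ (-s) else 0

open Classical in
theorem zt_residue (F : Type*) [Field F] [NumberField F] : ∃ ρ : ℝ, 0 < ρ ∧ ∀ c : ClassGroup (𝓞 F),
    (∀ s : ℝ, 1 < s → Summable (fun 𝔪 : Ideal (𝓞 F) => if InCl c 𝔪 then (Ideal.absNorm 𝔪 : ℝ) ^ (-s) else 0)) ∧
    Tendsto (fun s : ℝ => (s - 1) * zt c s) (𝓝[>] 1) (𝓝 ρ) := by
  refine ⟨(2 ^ InfinitePlace.nrRealPlaces F * (2 * π) ^ InfinitePlace.nrComplexPlaces F * Units.regulator F) /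
            (Units.torsionOrder F * Real.sqrt |discr F|), ?_, fun c => ?_⟩
  · refine div_pos ?_ ?_
    · exact mul_pos (by positivity) (Units.regulator_pos F)
    · exact mul_pos (Nat.cast_pos.mpr (Units.torsionOrder_pos F)) <|
        Real.sqrt_pos_of_pos <| abs_pos.mpr (Int.cast_ne_zero.mpr (discr_ne_zero F))
  · let T := {𝔪 : Ideal (𝓞 F) // InCl c 𝔪}
    have hmem : ∀ t : T, (t.1 : Ideal (𝓞 F)) ∈ (Ideal (𝓞 F))⁰ := fun t => t.2.1
    have h := count_series (T := T) (fun t => Ideal.absNorm t.1) (fun n => by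
        refine Set.Finite.of_injOn (f := fun t : T => t.1) (t := {I : Ideal (𝓞 F) | Ideal.absNorm I = n}) ?_ ?_
          (Ideal.finite_setOfPred_absNorm_eq n)
        · intro t ht; exact ht
        · intro t _ t' _ e; exact Subtype.ext e)
      (fun t => Nat.pos_of_ne_zero (Ideal.absNorm_ne_zero_iff_mem_nonZeroDivisors.mpr (hmem t))) _ (by
        refine (Ideal.tendsto_norm_le_and_mk_eq_div_atTop F c).congr fun x => ?_
        congr 2
        refine Nat.card_congr
          { toFun := fun t => ⟨⟨t.1.1, t.1.2, t.2.2⟩, t.2.1⟩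
            invFun := fun t => ⟨⟨t.1.1, hmem t.1⟩, t.2, t.1.2.2⟩
            left_inv := fun t => rfl
            right_inv := fun t => rfl })
    have hind : ∀ s : ℝ, (fun 𝔪 : Ideal (𝓞 F) => if InCl c 𝔪 then (Ideal.absNorm 𝔪 : ℝ) ^ (-s) else 0) =
        Set.indicator {𝔪 | InCl c 𝔪} (fun 𝔪 : Ideal (𝓞 F) => (Ideal.absNorm 𝔪 : ℝ) ^ (-s)) := by
      intro s; ext 𝔪; simp [Set.indicator_apply]
    constructor
    · intro s hs
      rw [hind, ← summable_subtype_iff_indicator]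
      exact h.1 s hs
    · refine h.2.congr fun s => ?_
      unfold zt
      rw [hind, ← tsum_subtype]
      rfl

end ClassZeta
end CMNorm

namespace CMNorm
open MeasureTheory Complex NumberField Filter Topology
open scoped Real BigOperators nonZeroDivisors
set_option linter.unusedSectionVars false

section Euler
open IsDedekindDomain
variable {R : Type*} [CommRing R] [IsDedekindDomain R]

open Classical in
theorem euler (f : Ideal R → ℂ) (h0 : f ⊥ = 0) (h1 : f ⊤ = 1) (hm : ∀ I J, f (I * J) = f I * f J)
    (hs : Summable (fun I => ‖f I‖)) :
    Tendsto (fun S : Finset (HeightOneSpectrum R) => (∏ p ∈ S, (1 - f p.asIdeal)) * ∑' I, f I) atTop (𝓝 1) := by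
  let g : Finset (HeightOneSpectrum R) → Ideal R → ℂ :=
    fun S I => if ∀ p ∈ S, ¬ I ≤ p.asIdeal then f I else 0
  have hg : ∀ S I, ‖g S I‖ ≤ ‖f I‖ := by
    intro S I
    simp only [g]
    split_ifs
    · exact le_rfl
    · simp
  have hgs : ∀ S, Summable (g S) := fun S => hs.of_norm_bounded (hg S)
  have key : ∀ S : Finset (HeightOneSpectrum R), ∑' I, g S I = (∏ p ∈ S, (1 - f p.asIdeal)) * ∑' I, f I := by
    intro S
    induction S using Finset.induction_on with
    | empty => simp [g]
    | insert q S hq ih =>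
      rw [Finset.prod_insert hq, mul_assoc, ← ih]
      let k : Ideal R → ℂ := fun I => if I ≤ q.asIdeal then g S I else 0
      have e1 : ∀ I, g (insert q S) I = g S I - k I := by
        intro I
        simp only [g, k, Finset.forall_mem_insert]
        by_cases hI : I ≤ q.asIdeal <;> simp [hI]
      have hk : Summable k := hs.of_norm_bounded fun I => by
        simp only [k]
        split_ifs
        · exact hg S I
        · simp
      have e2 : ∑' I, k I = f q.asIdeal * ∑' I, g S I := by
        have hinj : Function.Injective (fun J : Ideal R => q.asIdeal * J) :=
          fun J J' h => mul_left_cancel₀ (show q.asIdeal ≠ 0 from q.ne_bot) h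
        rw [← hinj.tsum_eq, ← tsum_mul_left]
        · refine tsum_congr fun J => ?_
          simp only [k]
          rw [if_pos Ideal.mul_le_left]
          simp only [g, hm, mul_ite, mul_zero]
          refine if_congr ?_ rfl rfl
          refine forall₂_congr fun p hp => not_congr ?_
          rw [p.isPrime.mul_le]
          constructor
          · rintro (h | h)
            · exfalso
              have := q.isMaximal.eq_of_le p.isPrime.ne_top h
              exact hq ((HeightOneSpectrum.ext this : q = p) ▸ hp)
            · exact h
          · exact Or.inr
        · intro I hI
          have hle : I ≤ q.asIdeal := by
            by_contra h
            simp [k, h] at hI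
          obtain ⟨J, hJ⟩ := Ideal.dvd_iff_le.mpr hle
          exact ⟨J, hJ.symm⟩
      rw [tsum_congr e1, (hgs S).tsum_sub hk, e2]
      ring
  have hlim : Tendsto (fun S => ∑' I, g S I) atTop (𝓝 (∑' I, if I = ⊤ then f I else 0)) := by
    refine tendsto_tsum_of_dominated_convergence hs (fun I => ?_) (Eventually.of_forall fun S I => hg S I)
    by_cases hI : I = ⊤
    · subst hI
      refine tendsto_const_nhds.congr fun S => ?_
      simp only [g, if_true]
      rw [if_pos]
      intro p _ h
      exact p.isPrime.ne_top (top_le_iff.mp h)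
    · rw [if_neg hI]
      by_cases hb : I = ⊥
      · subst hb
        refine tendsto_const_nhds.congr fun S => ?_
        simp [g, h0]
      · obtain ⟨M, hM, hle⟩ := Ideal.exists_le_maximal I hI
        let q : HeightOneSpectrum R := ⟨M, hM.isPrime, fun h => hb (le_bot_iff.mp (h ▸ hle))⟩
        refine tendsto_const_nhds.congr' ?_
        filter_upwards [eventually_ge_atTop {q}] with S hS
        have hqS : q ∈ S := hS (Finset.mem_singleton_self q)
        simp only [g]
        rw [if_neg]
        intro h
        exact h q hqS hle
  rw [tsum_ite_eq, h1] at hlim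
  exact hlim.congr key

end Euler

section Char
variable {F : Type*} [Field F] [NumberField F]

open Classical in
/-- ideal class character as function on ideals -/
noncomputable def X (χ : ClassGroup (𝓞 F) →* ℂˣ) (𝔪 : Ideal (𝓞 F)) : ℂ :=
  if h : 𝔪 ∈ (Ideal (𝓞 F))⁰ then (χ (ClassGroup.mk0 ⟨𝔪, h⟩) : ℂ) else 0

variable (χ : ClassGroup (𝓞 F) →* ℂˣ)

lemma X_bot : X χ ⊥ = 0 := by
  unfold X
  rw [dif_neg]
  intro h
  exact nonZeroDivisors.ne_zero h rfl

lemma X_of_ne {𝔪 : Ideal (𝓞 F)} (h : 𝔪 ∈ (Ideal (𝓞 F))⁰) : X χ 𝔪 = χ (ClassGroup.mk0 ⟨𝔪, h⟩) := by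
  unfold X
  rw [dif_pos h]

lemma X_top : X χ ⊤ = 1 := by
  have h : (⊤ : Ideal (𝓞 F)) ∈ (Ideal (𝓞 F))⁰ := by
    rw [← Ideal.one_eq_top]; exact one_mem _
  rw [X_of_ne χ h]
  have : (⟨⊤, h⟩ : (Ideal (𝓞 F))⁰) = 1 := Subtype.ext Ideal.one_eq_top.symm
  rw [this]; simp

lemma X_mul (I J : Ideal (𝓞 F)) : X χ (I * J) = X χ I * X χ J := by
  by_cases hI : I = ⊥
  · subst hI; rw [Ideal.bot_mul, X_bot, zero_mul]
  by_cases hJ : J = ⊥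
  · subst hJ; rw [Ideal.mul_bot, X_bot, mul_zero]
  have hI' := mem_nonZeroDivisors_of_ne_zero (show I ≠ 0 from hI)
  have hJ' := mem_nonZeroDivisors_of_ne_zero (show J ≠ 0 from hJ)
  rw [X_of_ne χ hI', X_of_ne χ hJ', X_of_ne χ (mul_mem hI' hJ'), ← Units.val_mul, ← map_mul, ← map_mul]
  rfl

lemma chi_norm (c : ClassGroup (𝓞 F)) : ‖(χ c : ℂ)‖ = 1 := by
  have h : ((χ c : ℂˣ) : ℂ) ^ Fintype.card (ClassGroup (𝓞 F)) = 1 := by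
    rw [← Units.val_pow_eq_pow_val, ← map_pow, pow_card_eq_one]; simp
  exact norm_eq_one_of_pow_eq_one h Fintype.card_ne_zero

lemma X_norm_le (I : Ideal (𝓞 F)) : ‖X χ I‖ ≤ 1 := by
  unfold X
  split_ifs
  · rw [chi_norm]
  · simp

lemma nn_bot {s : ℝ} (hs : 1 < s) : nn s (⊥ : Ideal (𝓞 F)) = 0 := by
  unfold nn
  rw [Ideal.absNorm_bot, Nat.cast_zero, Real.zero_rpow (by linarith)]; simp

lemma nn_top (s : ℝ) : nn s (⊤ : Ideal (𝓞 F)) = 1 := by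
  unfold nn; simp

lemma nn_norm (s : ℝ) (I : Ideal (𝓞 F)) : ‖nn s I‖ = (Ideal.absNorm I : ℝ) ^ (-s) := by
  unfold nn
  rw [Complex.norm_real, Real.norm_eq_abs, abs_of_nonneg (by positivity)]

open Classical in
lemma sum_InCl {M : Type*} [AddCommMonoid M] {𝔪 : Ideal (𝓞 F)} (h : 𝔪 ∈ (Ideal (𝓞 F))⁰) (a : ClassGroup (𝓞 F) → M) :
    ∑ c, (if InCl c 𝔪 then a c else 0) = a (ClassGroup.mk0 ⟨𝔪, h⟩) := by
  rw [Finset.sum_eq_single (ClassGroup.mk0 ⟨𝔪, h⟩)]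
  · rw [if_pos ⟨h, rfl⟩]
  · rintro c - hc
    rw [if_neg]
    rintro ⟨h', e⟩
    exact hc e.symm
  · intro h'; exact absurd (Finset.mem_univ _) h'

lemma nn_summable {s : ℝ} (hs : 1 < s) : Summable (fun 𝔪 : Ideal (𝓞 F) => ‖nn s 𝔪‖) := by
  classical
  obtain ⟨ρ, -, h⟩ := zt_residue F
  have := summable_sum (s := Finset.univ) (fun (c : ClassGroup (𝓞 F)) _ => (h c).1 s hs)
  refine this.congr fun 𝔪 => ?_
  by_cases h : 𝔪 = ⊥
  · subst h
    rw [nn_bot hs, norm_zero]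
    refine Finset.sum_eq_zero fun c _ => ?_
    rw [if_neg]
    rintro ⟨h', -⟩
    exact nonZeroDivisors.ne_zero h' rfl
  · rw [sum_InCl (mem_nonZeroDivisors_of_ne_zero (show 𝔪 ≠ 0 from h)) (fun _ => (Ideal.absNorm 𝔪 : ℝ) ^ (-s)), nn_norm]

lemma Xw_summable (w : Ideal (𝓞 F) → ℂ) (hw : ∀ I, ‖w I‖ ≤ 1) {s : ℝ} (hs : 1 < s) :
    Summable (fun I => ‖X χ I * (w I * nn s I)‖) := by
  refine Summable.of_nonneg_of_le (fun _ => norm_nonneg _) (fun I => ?_) (nn_summable (F := F) hs)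
  rw [norm_mul, norm_mul]
  calc ‖X χ I‖ * (‖w I‖ * ‖nn s I‖) ≤ 1 * (1 * ‖nn s I‖) := by
        gcongr
        · exact X_norm_le χ I
        · exact hw I
    _ = _ := by ring

open Classical in
lemma Xw_tsum (w : Ideal (𝓞 F) → ℂ) (hw : ∀ I, ‖w I‖ ≤ 1) {s : ℝ} (hs : 1 < s) :
    ∑' I, X χ I * (w I * nn s I) = ∑ c, (χ c : ℂ) * ∑' I, (if InCl c I then w I * nn s I else 0) := by
  have hS : ∀ c : ClassGroup (𝓞 F), Summable (fun I => (χ c : ℂ) * (if InCl c I then w I * nn s I else 0)) := by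
    intro c
    apply Summable.mul_left
    refine (nn_summable (F := F) hs).of_norm_bounded fun I => ?_
    split_ifs
    · rw [norm_mul]
      exact mul_le_of_le_one_left (norm_nonneg _) (hw I)
    · simp
  simp_rw [← tsum_mul_left]
  rw [← Summable.tsum_finsetSum (fun c _ => hS c)]
  refine tsum_congr fun I => ?_
  simp only [mul_ite, mul_zero]
  by_cases h : I = ⊥
  · subst h
    rw [X_bot, zero_mul]
    refine (Finset.sum_eq_zero fun c _ => ?_).symm
    rw [if_neg]
    rintro ⟨h', -⟩
    exact nonZeroDivisors.ne_zero h' rfl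
  · have h' := mem_nonZeroDivisors_of_ne_zero (show I ≠ 0 from h)
    rw [sum_InCl h' (fun c => (χ c : ℂ) * (w I * nn s I)), X_of_ne χ h']

theorem L_chi_lim : ∃ ρ : ℝ, 0 < ρ ∧ ∀ χ : ClassGroup (𝓞 F) →* ℂˣ,
    Tendsto (fun s : ℝ => ((s - 1 : ℝ) : ℂ) * ∑' I, X χ I * nn s I) (𝓝[>] 1) (𝓝 (∑ c, (χ c : ℂ) * ρ)) := by
  classical
  obtain ⟨ρ, hρ, h⟩ := zt_residue F
  refine ⟨ρ, hρ, fun χ => ?_⟩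
  have h2 : Tendsto (fun s : ℝ => ∑ c, (χ c : ℂ) * (((s - 1) * zt c s : ℝ) : ℂ)) (𝓝[>] 1) (𝓝 (∑ c, (χ c : ℂ) * ρ)) :=
    tendsto_finsetSum _ fun c _ => ((Complex.continuous_ofReal.tendsto ρ).comp (h c).2).const_mul _
  refine h2.congr' ?_
  filter_upwards [self_mem_nhdsWithin] with s hs
  have := Xw_tsum χ (fun _ => 1) (fun _ => by simp) hs
  simp only [one_mul] at this
  rw [this, Finset.mul_sum]
  refine Finset.sum_congr rfl fun c _ => ?_
  have e : ∑' I : Ideal (𝓞 F), (if InCl c I then nn s I else 0) = ((zt c s : ℝ) : ℂ) := by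
    unfold zt
    rw [Complex.ofReal_tsum]
    refine tsum_congr fun I => ?_
    split_ifs <;> simp [nn]
  rw [e]
  push_cast
  ring

end Char
end CMNorm

namespace CMNorm
open MeasureTheory Complex NumberField Filter Topology
open scoped Real BigOperators nonZeroDivisors
set_option linter.unusedSectionVars false

section Local
open IsDedekindDomain
variable {F K : Type*} [Field F] [NumberField F] [Field K] [NumberField K] [Algebra F K]

instance under_lo (P : HeightOneSpectrum (𝓞 K)) :
    P.asIdeal.LiesOver (HeightOneSpectrum.under (𝓞 F) P).asIdeal := ⟨rfl⟩

variable (F) in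
lemma exists_fdeg (P : HeightOneSpectrum (𝓞 K)) :
    ∃ f : ℕ, Ideal.relNorm (𝓞 F) P.asIdeal = (HeightOneSpectrum.under (𝓞 F) P).asIdeal ^ f := by
  have := (HeightOneSpectrum.under (𝓞 F) P).isPrime
  exact Ideal.exists_relNorm_eq_pow_of_isPrime P.asIdeal _

variable (F) in
/-- residue degree -/
noncomputable def fdeg (P : HeightOneSpectrum (𝓞 K)) : ℕ := (exists_fdeg F P).choose

lemma fdeg_spec (P : HeightOneSpectrum (𝓞 K)) :
    Ideal.relNorm (𝓞 F) P.asIdeal = (HeightOneSpectrum.under (𝓞 F) P).asIdeal ^ (fdeg F P) :=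
  (exists_fdeg F P).choose_spec

lemma fdeg_pos (P : HeightOneSpectrum (𝓞 K)) : 1 ≤ fdeg F P := by
  by_contra h
  have h0 : fdeg F P = 0 := by omega
  have h1 := fdeg_spec (F := F) P
  rw [h0, pow_zero] at h1
  have h2 := Ideal.relNorm_le_comap (𝓞 F) P.asIdeal
  rw [h1, Ideal.one_eq_top, top_le_iff] at h2
  exact P.isPrime.ne_top (Ideal.comap_eq_top_iff.mp h2)

lemma absNorm_fdeg (P : HeightOneSpectrum (𝓞 K)) :
    Ideal.absNorm P.asIdeal = Ideal.absNorm (HeightOneSpectrum.under (𝓞 F) P).asIdeal ^ (fdeg F P) := by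
  rw [← map_pow, ← fdeg_spec, Ideal.absNorm_relNorm]

lemma nn_fdeg (s : ℝ) (P : HeightOneSpectrum (𝓞 K)) :
    nn s P.asIdeal = nn s (HeightOneSpectrum.under (𝓞 F) P).asIdeal ^ (fdeg F P) := by
  unfold nn
  rw [absNorm_fdeg (F := F) P]
  push_cast
  rw [← Complex.ofReal_pow]
  congr 1
  rw [← Real.rpow_natCast, ← Real.rpow_natCast, ← Real.rpow_mul (by positivity), ← Real.rpow_mul (by positivity), mul_comm]

lemma sum_fdeg_le (p : HeightOneSpectrum (𝓞 F)) (T : Finset (HeightOneSpectrum (𝓞 K)))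
    (hT : ∀ P ∈ T, HeightOneSpectrum.under (𝓞 F) P = p) : ∑ P ∈ T, fdeg F P ≤ Module.finrank F K := by
  classical
  have h1 : ∏ P ∈ T, P.asIdeal ∣ p.asIdeal.map (algebraMap (𝓞 F) (𝓞 K)) := by
    have := Finset.prod_primes_dvd (s := T.image (fun P => P.asIdeal)) (p.asIdeal.map (algebraMap (𝓞 F) (𝓞 K)))
      (by
        intro I hI
        obtain ⟨P, hP, rfl⟩ := Finset.mem_image.mp hI
        exact P.prime)
      (by
        intro I hI
        obtain ⟨P, hP, rfl⟩ := Finset.mem_image.mp hI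
        rw [Ideal.dvd_iff_le, Ideal.map_le_iff_le_comap, ← hT P hP]
        exact le_rfl)
    rwa [Finset.prod_image (fun P _ Q _ h => HeightOneSpectrum.ext h)] at this
  have h2 := map_dvd (Ideal.relNorm (𝓞 F)) h1
  rw [Ideal.relNorm_algebraMap, map_prod, ← IsFractionRing.finrank_eq (𝓞 F) F (𝓞 K) K,
    Finset.prod_congr rfl (fun P hP => by rw [fdeg_spec, hT P hP]), Finset.prod_pow_eq_pow_sum] at h2
  exact (pow_dvd_pow_iff (show p.asIdeal ≠ 0 from p.ne_bot)
    (fun h => p.isPrime.ne_top (Ideal.isUnit_iff.mp h))).mp h2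

lemma card_le (p : HeightOneSpectrum (𝓞 F)) (T : Finset (HeightOneSpectrum (𝓞 K)))
    (hT : ∀ P ∈ T, HeightOneSpectrum.under (𝓞 F) P = p) : T.card ≤ Module.finrank F K := by
  refine le_trans ?_ (sum_fdeg_le p T hT)
  rw [Finset.card_eq_sum_ones]
  exact Finset.sum_le_sum fun P _ => fdeg_pos P

variable (K) in
lemma fib_finite (p : HeightOneSpectrum (𝓞 F)) :
    {P : HeightOneSpectrum (𝓞 K) | HeightOneSpectrum.under (𝓞 F) P = p}.Finite := by
  by_contra h
  obtain ⟨T, hT, hc⟩ := Set.Infinite.exists_subset_card_eq h (Module.finrank F K + 1)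
  have := card_le p T (fun P hP => hT hP)
  omega

variable (K) in
/-- primes above -/
noncomputable def fib (p : HeightOneSpectrum (𝓞 F)) : Finset (HeightOneSpectrum (𝓞 K)) :=
  (fib_finite K p).toFinset

lemma mem_fib {p : HeightOneSpectrum (𝓞 F)} {P : HeightOneSpectrum (𝓞 K)} :
    P ∈ fib K p ↔ HeightOneSpectrum.under (𝓞 F) P = p := by
  simp [fib]

lemma fib_nonempty (p : HeightOneSpectrum (𝓞 F)) : (fib K p).Nonempty := by
  have := p.isMaximal
  obtain ⟨Q, hQ, hl⟩ := Ideal.exists_maximal_ideal_liesOver_of_isIntegral (S := 𝓞 K) p.asIdeal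
  have hQ0 : Q ≠ ⊥ := by
    rintro rfl
    apply p.ne_bot
    rw [hl.over]
    exact Ideal.comap_bot_of_injective _ (FaithfulSMul.algebraMap_injective (𝓞 F) (𝓞 K))
  refine ⟨⟨Q, hQ.isPrime, hQ0⟩, mem_fib.mpr (HeightOneSpectrum.ext ?_)⟩
  exact hl.over.symm

/-- residue degree one gives representatives -/
lemma exists_rep {P : HeightOneSpectrum (𝓞 K)} (h : fdeg F P = 1) (x : 𝓞 K) :
    ∃ r : 𝓞 F, x - algebraMap (𝓞 F) (𝓞 K) r ∈ P.asIdeal := by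
  set p := HeightOneSpectrum.under (𝓞 F) P
  have hc : Nat.card (𝓞 F ⧸ p.asIdeal) = Nat.card (𝓞 K ⧸ P.asIdeal) := by
    have := absNorm_fdeg (F := F) P
    rw [h, pow_one] at this
    exact this.symm
  have hfin : Finite (𝓞 K ⧸ P.asIdeal) := Ideal.finiteQuotientOfFreeOfNeBot _ P.ne_bot
  have hfin' : Finite (𝓞 F ⧸ p.asIdeal) := Ideal.finiteQuotientOfFreeOfNeBot _ p.ne_bot
  let g : 𝓞 F ⧸ p.asIdeal →+* 𝓞 K ⧸ P.asIdeal :=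
    Ideal.quotientMap P.asIdeal (algebraMap (𝓞 F) (𝓞 K)) le_rfl
  have hinj : Function.Injective g := Ideal.quotientMap_injective
  have hsurj := ((Nat.bijective_iff_injective_and_card g).mpr ⟨hinj, hc⟩).2
  obtain ⟨y, hy⟩ := hsurj (Ideal.Quotient.mk _ x)
  obtain ⟨r, rfl⟩ := Ideal.Quotient.mk_surjective y
  refine ⟨r, ?_⟩
  rw [← Ideal.Quotient.eq, ← hy]
  rfl

lemma mem_under {P : HeightOneSpectrum (𝓞 K)} {p : HeightOneSpectrum (𝓞 F)} (h : HeightOneSpectrum.under (𝓞 F) P = p)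
    (x : 𝓞 F) : x ∈ p.asIdeal ↔ algebraMap (𝓞 F) (𝓞 K) x ∈ P.asIdeal := by
  rw [← h]; rfl

theorem inert_case (h2 : Module.finrank F K = 2) {δ : 𝓞 K} {d : 𝓞 F} (hδ : δ ^ 2 = algebraMap (𝓞 F) (𝓞 K) d)
    (p : HeightOneSpectrum (𝓞 F)) (hns : ¬ ∃ r, r ^ 2 - d ∈ p.asIdeal) :
    ∃ P, fib K p = {P} ∧ fdeg F P = 2 := by
  classical
  have hf : ∀ P ∈ fib K p, 2 ≤ fdeg F P := by
    intro P hP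
    by_contra hlt
    have h1 : fdeg F P = 1 := by have := fdeg_pos (F := F) P; omega
    obtain ⟨r, hr⟩ := exists_rep h1 δ
    apply hns
    refine ⟨r, ?_⟩
    rw [mem_under (mem_fib.mp hP), map_sub, map_pow, ← hδ]
    have : algebraMap (𝓞 F) (𝓞 K) r ^ 2 - δ ^ 2 = -(δ + algebraMap (𝓞 F) (𝓞 K) r) * (δ - algebraMap (𝓞 F) (𝓞 K) r) := by ring
    rw [this]
    exact Ideal.mul_mem_left _ _ hr
  obtain ⟨P, hP⟩ := fib_nonempty (K := K) p
  have hs := sum_fdeg_le p (fib K p) (fun P hP => mem_fib.mp hP)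
  rw [h2] at hs
  have hle : (fib K p).card * 2 ≤ 2 := by
    refine le_trans ?_ hs
    rw [← smul_eq_mul]
    exact Finset.card_nsmul_le_sum _ _ _ hf
  have hcard : (fib K p).card = 1 := by
    have := Finset.card_pos.mpr ⟨P, hP⟩
    omega
  obtain ⟨Q, hQ⟩ := Finset.card_eq_one.mp hcard
  refine ⟨Q, hQ, ?_⟩
  rw [hQ, Finset.sum_singleton] at hs
  have := hf Q (by rw [hQ]; exact Finset.mem_singleton_self _)
  omega

open Classical in
theorem split_case (h2 : Module.finrank F K = 2) {δ : 𝓞 K} {d : 𝓞 F} (hδ : δ ^ 2 = algebraMap (𝓞 F) (𝓞 K) d)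
    (τ : 𝓞 K →ₐ[𝓞 F] 𝓞 K) (hτ : τ δ = -δ) (hτ2 : ∀ x, τ (τ x) = x)
    (p : HeightOneSpectrum (𝓞 F)) (hN : 2 * d ∉ p.asIdeal) (hns : ∃ r, r ^ 2 - d ∈ p.asIdeal) :
    ∃ P Q, P ≠ Q ∧ fib K p = {P, Q} ∧ fdeg F P = 1 ∧ fdeg F Q = 1 := by
  obtain ⟨r, hr⟩ := hns
  obtain ⟨P, hP⟩ := fib_nonempty (K := K) p
  have hPp := mem_fib.mp hP
  have hprod : (algebraMap (𝓞 F) (𝓞 K) r - δ) * (algebraMap (𝓞 F) (𝓞 K) r + δ) ∈ P.asIdeal := by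
    have := (mem_under hPp _).mp hr
    rw [map_sub, map_pow, ← hδ] at this
    convert this using 1; ring
  have hex : ∃ r' : 𝓞 F, r' ^ 2 - d ∈ p.asIdeal ∧ algebraMap (𝓞 F) (𝓞 K) r' - δ ∈ P.asIdeal := by
    rcases P.isPrime.mem_or_mem hprod with h | h
    · exact ⟨r, hr, h⟩
    · refine ⟨-r, by simpa using hr, ?_⟩
      rw [map_neg, ← neg_mem_iff]
      convert h using 1; ring
  obtain ⟨r', hr', hm⟩ := hex
  have hinj : Function.Surjective τ := fun x => ⟨τ x, hτ2 x⟩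
  have hprime : (P.asIdeal.comap τ).IsPrime := P.isPrime.comap τ
  have hcom : ∀ x : 𝓞 F, algebraMap (𝓞 F) (𝓞 K) x ∈ P.asIdeal.comap τ ↔ x ∈ p.asIdeal := by
    intro x
    rw [Ideal.mem_comap, AlgHom.commutes, mem_under hPp]
  have hne : P.asIdeal.comap τ ≠ ⊥ := by
    intro hb
    apply p.ne_bot
    rw [eq_bot_iff]
    intro x hx
    have := (hcom x).mpr hx
    rw [hb, Ideal.mem_bot] at this
    exact (FaithfulSMul.algebraMap_injective (𝓞 F) (𝓞 K)) (by rw [this, map_zero])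
  let Q : HeightOneSpectrum (𝓞 K) := ⟨P.asIdeal.comap τ, hprime, hne⟩
  have hQp : HeightOneSpectrum.under (𝓞 F) Q = p := by
    refine HeightOneSpectrum.ext (Ideal.ext fun x => ?_)
    exact hcom x
  have hPQ : P ≠ Q := by
    intro h
    have h1 : algebraMap (𝓞 F) (𝓞 K) r' - δ ∈ Q.asIdeal := h ▸ hm
    have h3 : algebraMap (𝓞 F) (𝓞 K) r' + δ ∈ P.asIdeal := by
      have : τ (algebraMap (𝓞 F) (𝓞 K) r' - δ) ∈ P.asIdeal := h1
      rw [map_sub, AlgHom.commutes, hτ, sub_neg_eq_add] at this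
      exact this
    have h4 : 2 * r' ∈ p.asIdeal := by
      rw [mem_under hPp]
      have := P.asIdeal.add_mem hm h3
      convert this using 1
      rw [map_mul, map_ofNat]; ring
    apply hN
    have h5 : 2 * d = (2 * r') * r' - 2 * (r' ^ 2 - d) := by ring
    rw [h5]
    exact p.asIdeal.sub_mem (Ideal.mul_mem_right _ _ h4) (Ideal.mul_mem_left _ _ hr')
  have hsub : {P, Q} ⊆ fib K p := by
    intro R hR
    rw [Finset.mem_insert, Finset.mem_singleton] at hR
    rcases hR with rfl | rfl
    · exact hP
    · exact mem_fib.mpr hQp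
  have hcard := card_le p (fib K p) (fun P hP => mem_fib.mp hP)
  have hs := sum_fdeg_le p (fib K p) (fun P hP => mem_fib.mp hP)
  have heq : fib K p = {P, Q} := by
    refine (Finset.eq_of_subset_of_card_le hsub ?_).symm
    rw [Finset.card_pair hPQ]; exact hcard.trans h2.le
  rw [heq, Finset.sum_pair hPQ, h2] at hs
  have a1 := fdeg_pos (F := F) P
  have a2 := fdeg_pos (F := F) Q
  exact ⟨P, Q, hPQ, heq, by omega, by omega⟩

theorem local_factor (h2 : Module.finrank F K = 2) {δ : 𝓞 K} {d : 𝓞 F} (hδ : δ ^ 2 = algebraMap (𝓞 F) (𝓞 K) d)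
    (τ : 𝓞 K →ₐ[𝓞 F] 𝓞 K) (hτ : τ δ = -δ) (hτ2 : ∀ x, τ (τ x) = x)
    (χ : ClassGroup (𝓞 F) →* ℂˣ)
    (hχ : ∀ P : HeightOneSpectrum (𝓞 K), X χ (Ideal.relNorm (𝓞 F) P.asIdeal) = 1)
    (p : HeightOneSpectrum (𝓞 F)) (hN : 2 * d ∉ p.asIdeal) (s : ℝ) :
    ∏ P ∈ fib K p, (1 - nn s P.asIdeal) =
      (1 - X χ p.asIdeal * nn s p.asIdeal) * (1 - X χ p.asIdeal * (sym d p.asIdeal * nn s p.asIdeal)) := by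
  classical
  have hpow : ∀ P ∈ fib K p, X χ p.asIdeal ^ fdeg F P = 1 := by
    intro P hP
    have h := hχ P
    rw [fdeg_spec, mem_fib.mp hP] at h
    have hX : ∀ n : ℕ, X χ (p.asIdeal ^ n) = X χ p.asIdeal ^ n := by
      intro n
      induction n with
      | zero => rw [pow_zero, pow_zero, Ideal.one_eq_top, X_top]
      | succ n ih => rw [pow_succ, X_mul, ih, pow_succ]
    rwa [hX] at h
  have hnn : ∀ P ∈ fib K p, nn s P.asIdeal = nn s p.asIdeal ^ fdeg F P := by
    intro P hP
    rw [nn_fdeg (F := F), mem_fib.mp hP]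
  by_cases hns : ∃ r, r ^ 2 - d ∈ p.asIdeal
  · obtain ⟨P, Q, hPQ, hf, hP1, hQ1⟩ := split_case h2 hδ τ hτ hτ2 p hN hns
    have hPm : P ∈ fib K p := by rw [hf]; simp
    have hQm : Q ∈ fib K p := by rw [hf]; simp
    have hX := hpow P hPm
    rw [hP1, pow_one] at hX
    rw [hf, Finset.prod_pair hPQ, hnn P hPm, hnn Q hQm, hP1, hQ1, hX]
    simp [sym, hns]
  · obtain ⟨P, hf, hP2⟩ := inert_case h2 hδ p hns
    have hPm : P ∈ fib K p := by rw [hf]; simp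
    have hX := hpow P hPm
    rw [hP2] at hX
    rw [hf, Finset.prod_singleton, hnn P hPm, hP2]
    simp only [sym, hns, if_false]
    linear_combination (nn s p.asIdeal ^ 2) * hX

end Local
end CMNorm

namespace CMNorm
open MeasureTheory Complex NumberField Filter Topology
open scoped Real BigOperators nonZeroDivisors
set_option linter.unusedSectionVars false

section Main
open IsDedekindDomain
variable {F K : Type*} [Field F] [NumberField F] [Field K] [NumberField K] [Algebra F K]

lemma nn_prime_le {s : ℝ} (hs : 1 < s) (P : HeightOneSpectrum (𝓞 F)) : ‖nn s P.asIdeal‖ ≤ 1 / 2 := by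
  rw [nn_norm]
  have h2 : 2 ≤ Ideal.absNorm P.asIdeal := by
    have h0 := absNorm_ne P.ne_bot
    have h1 : Ideal.absNorm P.asIdeal ≠ 1 := fun h => P.isPrime.ne_top (Ideal.absNorm_eq_one_iff.mp h)
    omega
  have h2' : (2:ℝ) ≤ Ideal.absNorm P.asIdeal := by exact_mod_cast h2
  calc (Ideal.absNorm P.asIdeal : ℝ) ^ (-s) ≤ (Ideal.absNorm P.asIdeal : ℝ) ^ (-1:ℝ) :=
        Real.rpow_le_rpow_of_exponent_le (by linarith) (by linarith)
    _ = (Ideal.absNorm P.asIdeal : ℝ)⁻¹ := Real.rpow_neg_one _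
    _ ≤ 2⁻¹ := by gcongr
    _ = 1 / 2 := by norm_num

lemma X_one {I : Ideal (𝓞 F)} (h : I ≠ ⊥) : X (1 : ClassGroup (𝓞 F) →* ℂˣ) I = 1 := by
  rw [X_of_ne _ (mem_nonZeroDivisors_of_ne_zero (show I ≠ 0 from h))]; simp

lemma psi_le (N d : 𝓞 F) (I : Ideal (𝓞 F)) : ‖psi N d I‖ ≤ 1 := by
  classical
  induction I using UniqueFactorizationMonoid.induction_on_prime with
  | h₁ => rw [map_zero]; simp
  | h₂ x hx =>
    rw [Ideal.isUnit_iff] at hx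
    rw [hx, ← Ideal.one_eq_top, map_one]; simp
  | h₃ a p ha hp ih =>
    have hp0 : p ≠ ⊥ := hp.ne_zero
    have hpm : p.IsMaximal := (Ideal.isPrime_of_prime hp).isMaximal hp0
    rw [map_mul, norm_mul]
    have h1 : ‖psi N d p‖ ≤ 1 := by
      by_cases hN : N ∈ p
      · rw [psi_bad N d hp0 hN]; simp
      · rw [psi_prime N d hp0 hN]
        unfold sym
        split_ifs <;> simp
    exact mul_le_one₀ h1 (norm_nonneg _) ih

lemma tendsto_biUnion [DecidableEq (HeightOneSpectrum (𝓞 K))] :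
    Tendsto (fun S : Finset (HeightOneSpectrum (𝓞 F)) => S.biUnion (fib K)) atTop atTop := by
  refine tendsto_atTop_finset_of_monotone ?_ ?_
  · intro S T h
    exact Finset.biUnion_subset_biUnion_of_subset_left _ h
  · intro P
    exact ⟨{HeightOneSpectrum.under (𝓞 F) P}, by simp [mem_fib]⟩

theorem zeta_le (h2 : Module.finrank F K = 2) {δ : 𝓞 K} {d : 𝓞 F} (hδ : δ ^ 2 = algebraMap (𝓞 F) (𝓞 K) d)
    (τ : 𝓞 K →ₐ[𝓞 F] 𝓞 K) (hτ : τ δ = -δ) (hτ2 : ∀ x, τ (τ x) = x)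
    (χ : ClassGroup (𝓞 F) →* ℂˣ)
    (hχ : ∀ P : HeightOneSpectrum (𝓞 K), X χ (Ideal.relNorm (𝓞 F) P.asIdeal) = 1)
    (N : 𝓞 F) (hN0 : N ≠ 0) (hN : 2 * d ∣ N) :
    ∃ B : ℝ, 0 ≤ B ∧ ∀ s : ℝ, 1 < s →
      ‖∑' I, X (1 : ClassGroup (𝓞 K) →* ℂˣ) I * nn s I‖ ≤
        B * (‖∑' I, X χ I * nn s I‖ * ‖∑' I, X χ I * (psi N d I * nn s I)‖) := by
  classical
  have hbadfin : {p : HeightOneSpectrum (𝓞 F) | N ∈ p.asIdeal}.Finite := by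
    have := Ideal.finite_factors (R := 𝓞 F) (I := Ideal.span {N}) (by simpa using hN0)
    refine this.subset fun p hp => ?_
    simpa [Ideal.dvd_span_singleton] using hp
  set Bad := hbadfin.toFinset with hBad
  have hmem : ∀ p, p ∈ Bad ↔ N ∈ p.asIdeal := fun p => by simp [hBad]
  refine ⟨8 ^ Bad.card, by positivity, fun s hs => ?_⟩
  set Z := ∑' I, X (1 : ClassGroup (𝓞 K) →* ℂˣ) I * nn s I
  set L := ∑' I, X χ I * nn s I
  set L' := ∑' I, X χ I * (psi N d I * nn s I)
  have E1 := euler (fun I => X χ I * nn s I) (by simp [X_bot]) (by simp [X_top, nn_top])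
    (fun I J => by simp only [X_mul, nn_mul]; ring)
    (by simpa using Xw_summable χ (fun _ => 1) (fun _ => by simp) hs)
  have E2 := euler (fun I => X χ I * (psi N d I * nn s I)) (by simp [X_bot])
    (by rw [X_top, nn_top, ← Ideal.one_eq_top, map_one]; norm_num)
    (fun I J => by simp only [X_mul, nn_mul, map_mul]; ring)
    (Xw_summable χ (psi N d) (psi_le N d) hs)
  have E3 := (euler (fun I => X (1 : ClassGroup (𝓞 K) →* ℂˣ) I * nn s I) (by simp [X_bot]) (by simp [X_top, nn_top])
    (fun I J => by simp only [X_mul, nn_mul]; ring)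
    (by simpa using Xw_summable (1 : ClassGroup (𝓞 K) →* ℂˣ) (fun _ => 1) (fun _ => by simp) hs)).comp
      (tendsto_biUnion (F := F) (K := K))
  simp only [Function.comp_def] at E3
  have hloc : ∀ p : HeightOneSpectrum (𝓞 F), ‖(1 - X χ p.asIdeal * nn s p.asIdeal) *
      (1 - X χ p.asIdeal * (psi N d p.asIdeal * nn s p.asIdeal))‖ ≤
      (if p ∈ Bad then 8 else 1) * ‖∏ P ∈ fib K p, (1 - nn s P.asIdeal)‖ := by
    intro p
    have := p.isMaximal
    split_ifs with hp
    · rw [psi_bad N d p.ne_bot ((hmem p).mp hp), zero_mul, mul_zero, sub_zero, mul_one]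
      have a1 : ‖1 - X χ p.asIdeal * nn s p.asIdeal‖ ≤ 2 := by
        refine (norm_sub_le _ _).trans ?_
        rw [norm_one, norm_mul]
        have := mul_le_mul (X_norm_le χ p.asIdeal) (nn_prime_le hs p) (norm_nonneg _) zero_le_one
        linarith
      have a2 : (1/4 : ℝ) ≤ ‖∏ P ∈ fib K p, (1 - nn s P.asIdeal)‖ := by
        rw [norm_prod]
        have hc := card_le p (fib K p) (fun P hP => mem_fib.mp hP)
        calc (1/4 : ℝ) = (1/2) ^ 2 := by norm_num
          _ ≤ (1/2) ^ (fib K p).card := pow_le_pow_of_le_one (by norm_num) (by norm_num) (hc.trans h2.le)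
          _ = ∏ P ∈ fib K p, (1/2 : ℝ) := by rw [Finset.prod_const]
          _ ≤ _ := by
            refine Finset.prod_le_prod (fun _ _ => by norm_num) fun P _ => ?_
            have h3 := norm_sub_norm_le (1:ℂ) (nn s P.asIdeal)
            rw [norm_one] at h3
            have := nn_prime_le hs P
            linarith
      linarith
    · have hNp : N ∉ p.asIdeal := fun h => hp ((hmem p).mpr h)
      rw [one_mul, local_factor h2 hδ τ hτ hτ2 χ hχ p (fun h => hNp (Ideal.mem_of_dvd _ hN h)) s,
        psi_prime N d p.ne_bot hNp]
  have hdisj : ∀ S : Finset (HeightOneSpectrum (𝓞 F)),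
      ∏ P ∈ S.biUnion (fib K), (1 - X (1 : ClassGroup (𝓞 K) →* ℂˣ) P.asIdeal * nn s P.asIdeal) =
      ∏ p ∈ S, ∏ P ∈ fib K p, (1 - nn s P.asIdeal) := by
    intro S
    rw [Finset.prod_biUnion]
    · refine Finset.prod_congr rfl fun p _ => Finset.prod_congr rfl fun P _ => ?_
      rw [X_one P.ne_bot, one_mul]
    · intro p _ q _ hpq
      rw [Function.onFun, Finset.disjoint_left]
      intro P hP hQ
      exact hpq ((mem_fib.mp hP).symm.trans (mem_fib.mp hQ))
  simp only [hdisj] at E3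
  have hS : ∀ S : Finset (HeightOneSpectrum (𝓞 F)),
      ‖(∏ p ∈ S, (1 - X χ p.asIdeal * nn s p.asIdeal)) * L‖ *
      ‖(∏ p ∈ S, (1 - X χ p.asIdeal * (psi N d p.asIdeal * nn s p.asIdeal))) * L'‖ * ‖Z‖ ≤
      8 ^ Bad.card * ‖(∏ p ∈ S, ∏ P ∈ fib K p, (1 - nn s P.asIdeal)) * Z‖ * (‖L‖ * ‖L'‖) := by
    intro S
    have h3 : ‖(∏ p ∈ S, (1 - X χ p.asIdeal * nn s p.asIdeal))‖ *
      ‖(∏ p ∈ S, (1 - X χ p.asIdeal * (psi N d p.asIdeal * nn s p.asIdeal)))‖ ≤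
      8 ^ Bad.card * ‖(∏ p ∈ S, ∏ P ∈ fib K p, (1 - nn s P.asIdeal))‖ := by
      rw [← norm_mul, ← Finset.prod_mul_distrib, norm_prod, norm_prod]
      refine (Finset.prod_le_prod (fun _ _ => norm_nonneg _) (fun p _ => hloc p)).trans ?_
      rw [Finset.prod_mul_distrib]
      refine mul_le_mul_of_nonneg_right ?_ (Finset.prod_nonneg fun _ _ => norm_nonneg _)
      rw [Finset.prod_ite, Finset.prod_const_one, mul_one, Finset.prod_const]
      refine pow_le_pow_right₀ (by norm_num) (Finset.card_le_card ?_)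
      intro p hp
      exact (Finset.mem_filter.mp hp).2
    rw [norm_mul, norm_mul, norm_mul]
    calc _ = (‖(∏ p ∈ S, (1 - X χ p.asIdeal * nn s p.asIdeal))‖ *
      ‖(∏ p ∈ S, (1 - X χ p.asIdeal * (psi N d p.asIdeal * nn s p.asIdeal)))‖) * (‖L‖ * ‖L'‖ * ‖Z‖) := by ring
      _ ≤ _ := mul_le_mul_of_nonneg_right h3 (by positivity)
      _ = _ := by ring
  have := le_of_tendsto_of_tendsto' ((E1.norm.mul E2.norm).mul_const ‖Z‖)
    ((E3.norm.const_mul (8 ^ Bad.card : ℝ)).mul_const (‖L‖ * ‖L'‖)) hS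
  simpa using this

theorem char_trivial [IsTotallyReal F] (h2 : Module.finrank F K = 2) {δ : 𝓞 K} {c : 𝓞 F}
    (hc : ∀ v : InfinitePlace F, 0 < rv v (c : F))
    (hδ : δ ^ 2 = algebraMap (𝓞 F) (𝓞 K) (-c))
    (τ : 𝓞 K →ₐ[𝓞 F] 𝓞 K) (hτ : τ δ = -δ) (hτ2 : ∀ x, τ (τ x) = x)
    (χ : ClassGroup (𝓞 F) →* ℂˣ)
    (hχ : ∀ P : HeightOneSpectrum (𝓞 K), X χ (Ideal.relNorm (𝓞 F) P.asIdeal) = 1) :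
    ∀ a, χ a = 1 := by
  classical
  by_contra hcon
  push Not at hcon
  obtain ⟨a, ha⟩ := hcon
  obtain ⟨N, hN0, hdiv, hsign⟩ := psi_sign hc
  have hPsi : Psi N (psi N (-c)) := by
    refine ⟨hN0, fun 𝔭 hm hp hN => psi_bad N (-c) hp hN, fun x hx hd => ?_⟩
    have e := hsign x hx hd
    have e2 : PP x = ((Algebra.norm ℚ (x : F) : ℚ) : ℝ) := (norm_eq (x : F)).symm
    rw [e2, ← Rat.cast_abs, Complex.ofReal_ratCast, Complex.ofReal_ratCast]
    simpa only [Complex.ofReal_ratCast] using e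
  have hsum : ∑ b, (χ b : ℂ) = 0 := by
    have h1 : (χ a : ℂ) * ∑ b, (χ b : ℂ) = ∑ b, (χ b : ℂ) := by
      rw [Finset.mul_sum]
      refine Fintype.sum_equiv (Equiv.mulLeft a) _ _ fun b => ?_
      simp
    have h2 : ((χ a : ℂ) - 1) * ∑ b, (χ b : ℂ) = 0 := by linear_combination h1
    rcases mul_eq_zero.mp h2 with h | h
    · exact absurd (Units.ext (by rw [Units.val_one]; exact sub_eq_zero.mp h)) ha
    · exact h
  obtain ⟨B, hB0, hB⟩ := zeta_le h2 hδ τ hτ hτ2 χ hχ N hN0 (by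
    rw [mul_neg, neg_dvd]; exact hdiv)
  choose C hC using fun b => class_bound hPsi b
  have hL' : ∀ s : ℝ, 1 < s → s ≤ 2 → ‖∑' I, X χ I * (psi N (-c) I * nn s I)‖ ≤ ∑ b, C b := by
    intro s hs hs2
    rw [Xw_tsum χ (psi N (-c)) (psi_le N (-c)) hs]
    refine (norm_sum_le _ _).trans (Finset.sum_le_sum fun b _ => ?_)
    rw [norm_mul, chi_norm, one_mul]
    exact hC b s hs hs2
  obtain ⟨ρ, hρ, hlim⟩ := L_chi_lim (F := F)
  obtain ⟨ρ', hρ', hlim'⟩ := L_chi_lim (F := K)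
  have l1 := (hlim χ).norm
  rw [← Finset.sum_mul, hsum, zero_mul, norm_zero] at l1
  have l2 := (hlim' 1).norm
  have l3 := l1.const_mul (B * ∑ b, C b)
  rw [mul_zero] at l3
  have hle := le_of_tendsto_of_tendsto l2 l3 (by
    have h12 : Set.Ioc (1:ℝ) 2 ∈ 𝓝[>] (1:ℝ) := Ioc_mem_nhdsGT (by norm_num)
    filter_upwards [h12] with s hs
    have hb := hB s hs.1
    have hb2 := hL' s hs.1 hs.2
    rw [norm_mul, norm_mul]
    calc ‖((s - 1 : ℝ) : ℂ)‖ * ‖∑' I, X (1 : ClassGroup (𝓞 K) →* ℂˣ) I * nn s I‖ ≤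
        ‖((s - 1 : ℝ) : ℂ)‖ * (B * (‖∑' I, X χ I * nn s I‖ * ∑ b, C b)) := by
          refine mul_le_mul_of_nonneg_left (hb.trans ?_) (norm_nonneg _)
          gcongr
      _ = _ := by ring)
  have hpos : 0 < ‖∑ b, (((1 : ClassGroup (𝓞 K) →* ℂˣ) b : ℂˣ) : ℂ) * (ρ' : ℂ)‖ := by
    simp only [MonoidHom.one_apply, Units.val_one, one_mul, Finset.sum_const, nsmul_eq_mul]
    rw [norm_pos_iff]
    refine mul_ne_zero ?_ (by exact_mod_cast hρ'.ne')
    rw [Finset.card_univ]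
    exact_mod_cast Fintype.card_ne_zero
  linarith

end Main
end CMNorm

namespace CMNorm
open MeasureTheory Complex NumberField Filter Topology
open scoped Real BigOperators nonZeroDivisors
set_option linter.unusedSectionVars false

section Assembly
open IsDedekindDomain
variable {F K : Type*} [Field F] [NumberField F] [Field K] [NumberField K] [Algebra F K]

lemma exists_delta [IsTotallyReal F] (hK : ∀ φ : K →+* ℂ, ∃ x, (φ x).im ≠ 0)
    (h2 : Module.finrank F K = 2) :
    ∃ (δ : 𝓞 K) (c : 𝓞 F) (τ : 𝓞 K →ₐ[𝓞 F] 𝓞 K),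
      (∀ v : InfinitePlace F, 0 < rv v (c : F)) ∧
      δ ^ 2 = algebraMap (𝓞 F) (𝓞 K) (-c) ∧ τ δ = -δ ∧ ∀ x, τ (τ x) = x := by
  have hq : Algebra.IsQuadraticExtension F K := ⟨h2⟩
  have hfd : FiniteDimensional F K := Module.finite_of_finrank_pos (by omega)
  have hgal : IsGalois F K := inferInstance
  have hcard : Nat.card Gal(K/F) = 2 := by rw [IsGalois.card_aut_eq_finrank, h2]
  have hnt : Nontrivial Gal(K/F) := by
    rw [← Finite.one_lt_card_iff_nontrivial]; omega
  obtain ⟨σ, hσ⟩ := exists_ne (1 : Gal(K/F))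
  have hσ2 : ∀ x, σ (σ x) = x := by
    intro x
    have : σ ^ 2 = 1 := by rw [← hcard]; exact pow_card_eq_one'
    rw [pow_two] at this
    exact DFunLike.congr_fun this x
  have hall : ∀ g : Gal(K/F), g = 1 ∨ g = σ := by
    intro g
    by_contra hcon
    push Not at hcon
    rw [Nat.card_eq_two_iff' (1 : Gal(K/F))] at hcard
    obtain ⟨y, hy, hu⟩ := hcard
    exact hcon.2 ((hu g hcon.1).trans (hu σ hσ).symm)
  have hfix : ∀ x : K, σ x = x → ∃ a : F, algebraMap F K a = x := by
    intro x hx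
    have := (IsGalois.mem_bot_iff_fixed (F := F) (E := K) x).mpr (by
      intro g
      rcases hall g with h | h
      · rw [h]; rfl
      · rw [h]; exact hx)
    exact IntermediateField.mem_bot.mp this
  have hex : ∃ x : 𝓞 K, σ (x : K) ≠ x := by
    by_contra hcon
    push Not at hcon
    apply hσ
    ext x
    obtain ⟨a, b, hb, rfl⟩ := IsFractionRing.div_surjective (A := 𝓞 K) x
    rw [map_div₀]
    erw [hcon a, hcon b]
    rfl
  obtain ⟨x, hx⟩ := hex
  let τ : 𝓞 K →ₐ[𝓞 F] 𝓞 K :=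
    { RingOfIntegers.mapRingHom (σ : K →+* K) with
      commutes' := fun r => by
        apply RingOfIntegers.ext
        exact σ.commutes (r : F) }
  have hτc : ∀ y : 𝓞 K, ((τ y : 𝓞 K) : K) = σ (y : K) := fun y => rfl
  have hτ2 : ∀ y, τ (τ y) = y := by
    intro y
    apply RingOfIntegers.ext
    rw [hτc, hτc, hσ2]
  let δ : 𝓞 K := x - τ x
  have hτδ : τ δ = -δ := by
    simp only [δ, map_sub, hτ2, neg_sub]
  have hδ0 : δ ≠ 0 := by
    intro h
    apply hx
    rw [← hτc]
    rw [← sub_eq_zero.mp h]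
  have hδ0K : (δ : K) ≠ 0 := by
    intro h; exact hδ0 (RingOfIntegers.ext h)
  have hσδ : σ (δ : K) = -(δ : K) := by
    rw [← hτc, hτδ]; simp
  obtain ⟨d, hd⟩ := hfix ((δ : K) ^ 2) (by rw [map_pow, hσδ]; ring)
  have hdint : IsIntegral ℤ d := by
    have h1 : IsIntegral ℤ (algebraMap F K d) := by
      rw [hd]; exact (RingOfIntegers.isIntegral_coe δ).pow 2
    exact (isIntegral_algebraMap_iff (algebraMap F K).injective).mp h1
  let c : 𝓞 F := ⟨-d, hdint.neg⟩
  have hcc : (c : F) = -d := rfl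
  refine ⟨δ, c, τ, ?_, ?_, hτδ, hτ2⟩
  · intro v
    by_contra hneg
    push Not at hneg
    have hr : 0 ≤ rv v d := by
      rw [hcc, map_neg] at hneg; linarith
    have : Algebra.IsAlgebraic F K := Algebra.IsAlgebraic.of_finite F K
    let φ : K →+* ℂ := ComplexEmbedding.lift K v.embedding
    have hφ : ∀ a : F, φ (algebraMap F K a) = ((rv v a : ℝ) : ℂ) := by
      intro a
      rw [rv_coe]
      exact ComplexEmbedding.lift_algebraMap_apply K v.embedding a
    have hsq : (φ δ) ^ 2 = ((Real.sqrt (rv v d) : ℝ) : ℂ) ^ 2 := by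
      rw [← map_pow, ← hd, hφ, ← Complex.ofReal_pow, Real.sq_sqrt hr]
    have him : (φ δ).im = 0 := by
      rcases sq_eq_sq_iff_eq_or_eq_neg.mp hsq with h | h <;> rw [h] <;> simp
    obtain ⟨y, hy⟩ := hK φ
    apply hy
    obtain ⟨a, ha⟩ := hfix (y + σ y) (by rw [map_add, hσ2]; ring)
    obtain ⟨b, hb⟩ := hfix ((y - σ y) / δ) (by
      rw [map_div₀, map_sub, hσ2, hσδ, div_neg, ← neg_div, neg_sub])
    have hy2 : 2 * y = algebraMap F K a + algebraMap F K b * δ := by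
      rw [ha, hb]; field_simp; ring
    have h3 := congrArg (fun z => (φ z).im) hy2
    simp only [map_add, map_mul, map_ofNat, hφ] at h3
    simpa [him] using h3
  · apply RingOfIntegers.ext
    have : ((algebraMap (𝓞 F) (𝓞 K) (-c) : 𝓞 K) : K) = algebraMap F K ((-c : 𝓞 F) : F) := rfl
    rw [this]
    have h4 : ((-c : 𝓞 F) : F) = d := by
      rw [show ((-c : 𝓞 F) : F) = -(c : F) from map_neg _ _, hcc, neg_neg]
    rw [h4, hd]
    exact map_pow _ _ _

theorem surj [IsTotallyReal F] (hK : ∀ φ : K →+* ℂ, ∃ x, (φ x).im ≠ 0)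
    (h2 : Module.finrank F K = 2) (a : ClassGroup (𝓞 F)) :
    ∃ (I : (Ideal (𝓞 K))⁰) (J : (Ideal (𝓞 F))⁰),
      (J : Ideal (𝓞 F)) = Ideal.relNorm (𝓞 F) (I : Ideal (𝓞 K)) ∧ ClassGroup.mk0 J = a := by
  classical
  have hmem : ∀ I : (Ideal (𝓞 K))⁰, Ideal.relNorm (𝓞 F) (I : Ideal (𝓞 K)) ∈ (Ideal (𝓞 F))⁰ := by
    intro I
    apply mem_nonZeroDivisors_of_ne_zero
    intro h
    exact nonZeroDivisors.coe_ne_zero I (Ideal.relNorm_eq_bot_iff.mp h)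
  let f : (Ideal (𝓞 K))⁰ →* ClassGroup (𝓞 F) :=
    { toFun := fun I => ClassGroup.mk0 ⟨_, hmem I⟩
      map_one' := by
        rw [← map_one (ClassGroup.mk0 (R := 𝓞 F))]
        congr 1
        apply Subtype.ext
        simp
      map_mul' := fun I J => by
        rw [← map_mul]
        congr 1
        apply Subtype.ext
        simp }
  let H : Subgroup (ClassGroup (𝓞 F)) :=
    { MonoidHom.mrange f with
      inv_mem' := by
        intro x hx
        have h1 : x⁻¹ = x ^ (Nat.card (ClassGroup (𝓞 F)) - 1) := by
          rw [inv_eq_iff_mul_eq_one, ← pow_succ', Nat.sub_add_cancel Nat.card_pos]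
          exact pow_card_eq_one'
        rw [h1]
        exact (MonoidHom.mrange f).pow_mem hx _ }
  have hH : ∀ I, f I ∈ H := fun I => ⟨I, rfl⟩
  by_cases ha : a ∈ H
  · obtain ⟨I, hI⟩ := ha
    exact ⟨I, ⟨_, hmem I⟩, rfl, hI⟩
  · exfalso
    have ha' : (QuotientGroup.mk a : ClassGroup (𝓞 F) ⧸ H) ≠ 1 := by
      rwa [Ne, QuotientGroup.eq_one_iff]
    obtain ⟨φ, hφ⟩ :=
      CommGroup.exists_apply_ne_one_of_hasEnoughRootsOfUnity (ClassGroup (𝓞 F) ⧸ H) ℂ ha'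
    obtain ⟨δ, c, τ, hc, hδ, hτ, hτ2⟩ := exists_delta hK h2
    refine hφ (char_trivial h2 hc hδ τ hτ hτ2 (φ.comp (QuotientGroup.mk' H)) ?_ a)
    intro P
    have hP : P.asIdeal ∈ (Ideal (𝓞 K))⁰ :=
      mem_nonZeroDivisors_of_ne_zero (show P.asIdeal ≠ 0 from P.ne_bot)
    rw [X_of_ne _ (hmem ⟨_, hP⟩)]
    have h5 : (QuotientGroup.mk (f ⟨_, hP⟩) : ClassGroup (𝓞 F) ⧸ H) = 1 :=
      (QuotientGroup.eq_one_iff _).mpr (hH _)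
    have h6 : φ (QuotientGroup.mk (f ⟨_, hP⟩)) = 1 := by rw [h5, map_one]
    exact congrArg Units.val h6

end Assembly
end CMNorm

/-- If `K` is a CM field with maximal totally real subfield `K₊` (i.e. `K`
is totally imaginary and quadratic over the totally real field `K₊`), then the
norm-induced homomorphism `Cl(𝓞_K) → Cl(𝓞_{K₊})` is surjective: every ideal class of
`K₊` is the class of the relative norm of a nonzero ideal of `𝓞_K`. -/
theorem stmt_7 (K Kp : IntermediateField ℚ ℂ)
    [FiniteDimensional ℚ K] [FiniteDimensional ℚ Kp]
    (hsub : Kp ≤ K) (hKim : TotallyImaginary K) (hKp : TotallyReal Kp)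
    (hquad : letI : Algebra Kp K := (IntermediateField.inclusion hsub).toRingHom.toAlgebra
      Module.finrank Kp K = 2) :
    ∀ c : ClassGroup (𝓞 Kp), ∃ (I : (Ideal (𝓞 K))⁰) (J : (Ideal (𝓞 Kp))⁰),
      (J : Ideal (𝓞 Kp)) = idealNorm Kp K hsub I ∧ ClassGroup.mk0 J = c := by
  intro c
  let _ : Algebra Kp K := (IntermediateField.inclusion hsub).toRingHom.toAlgebra
  have hq : Module.finrank Kp K = 2 := hquad
  have hR : IsTotallyReal Kp := ⟨fun v => by
    rw [InfinitePlace.isReal_iff, ComplexEmbedding.isReal_iff]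
    ext x
    rw [ComplexEmbedding.conjugate_coe_eq, Complex.conj_eq_iff_im]
    exact hKp _ x⟩
  obtain ⟨I, J, h1, h2⟩ := CMNorm.surj (F := Kp) (K := K) hKim hq c
  refine ⟨I, J, ?_, h2⟩
  rw [h1, Ideal.relNorm_apply]
  unfold idealNorm
  congr 1
  have hn : ∀ x : 𝓞 K, ((Algebra.intNorm (𝓞 Kp) (𝓞 K) x : 𝓞 Kp) : Kp) = Algebra.norm Kp (x : K) :=
    fun x => Algebra.algebraMap_intNorm (A := 𝓞 Kp) (K := Kp) (L := K) (B := 𝓞 K) x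
  ext y
  constructor
  · rintro ⟨x, hx, rfl⟩
    exact ⟨x, hx, hn x⟩
  · rintro ⟨x, hx, hxy⟩
    refine ⟨x, hx, ?_⟩
    apply RingOfIntegers.ext
    rw [hn x]
    exact hxy.symm
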